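/- arXiv:1412.2727 — 3 statements merged into one kernel-verified Lean document; each statement's English description precedes it below -/
import Mathlib

section
/- Let f and g be continuous real-valued functions on S³ and let ζ ∈ S³. Assume that for every w ∈ S²(ζ) there exists a rotation φ_w ∈ SO(3, S²(w)) with φ_w(ζ) = ζ such that f(φ_w(θ)) = g(θ) for all θ ∈ S²(w). Then either f = g on S³, or f(θ) = g(𝒪θ) for all θ ∈ S³. -/
noncomputable section

open scoped RealInnerProductSpace

/-- `ℝ⁴` as a Euclidean space. -/
abbrev E4 := EuclideanSpace ℝ (Fin 4)

/-- The unit sphere `S³` in `ℝ⁴`. -/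
def sph : Set E4 := Metric.sphere (0 : E4) 1

/-- The great subsphere `S²(w) = {θ ∈ S³ : θ·w = 0}`. -/
def S2 (w : E4) : Set E4 := {θ ∈ sph | ⟪θ, w⟫ = 0}

/-- The orthogonal transformation `𝒪` determined by `ζ`: for a unit vector `ζ` the map
`x ↦ 2⟪x,ζ⟫ζ - x` satisfies `𝒪 ζ = ζ` and `𝒪 = -I` on `ζ^⊥`. -/
def Ocal (ζ x : E4) : E4 := (2 * ⟪x, ζ⟫) • ζ - x

/-- `φ` is (the extension to `ℝ⁴` of) an element of `SO(3, S²(w))`: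
a linear isometry of `ℝ⁴` fixing `w`, of determinant `1`, i.e. a rotation
of the `3`-dimensional subspace `w^⊥`. -/
def IsRot (w : E4) (φ : E4 ≃ₗᵢ[ℝ] E4) : Prop :=
  φ w = w ∧ LinearMap.det (φ.toLinearEquiv : E4 →ₗ[ℝ] E4) = 1

/-- `φ ∈ SO(3, S²(w))` is a rotation by the angle `α·π` around the axis `u ∈ S²(w)`:
it fixes `w` and `u`, and turns the plane orthogonal to `w` and `u` by the angle `α·π`. -/
def IsRotAngleAbout (w u : E4) (α : ℝ) (φ : E4 ≃ₗᵢ[ℝ] E4) : Prop :=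
  IsRot w φ ∧ φ u = u ∧
    ∀ v : E4, ⟪v, w⟫ = 0 → ⟪v, u⟫ = 0 →
      ⟪φ v, v⟫ = Real.cos (α * Real.pi) * ⟪v, v⟫

theorem integral_sin_pow_mul_integral_sin_pow_succ (n : ℕ) :
    (∫ x in 0..Real.pi, Real.sin x ^ n) * (∫ x in 0..Real.pi, Real.sin x ^ (n + 1)) =
      2 * Real.pi / (n + 1) := by
  induction n with
  | zero => simp; ring
  | succ n ih =>
    have h := integral_sin_pow (a := 0) (b := Real.pi) n
    simp only [Real.sin_zero, Real.sin_pi, ne_eq, Nat.add_eq_zero_iff, one_ne_zero, and_false,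
      not_false_eq_true, zero_pow, zero_mul, sub_self, zero_div, zero_add] at h
    have e : n + 1 + 1 = n + 2 := rfl
    rw [e, h]
    have h2 : (∫ x in 0..Real.pi, Real.sin x ^ (n + 1)) *
        ((n + 1 : ℝ) / (n + 2) * ∫ x in 0..Real.pi, Real.sin x ^ n) =
        (n + 1 : ℝ) / (n + 2) * ((∫ x in 0..Real.pi, Real.sin x ^ n) *
          (∫ x in 0..Real.pi, Real.sin x ^ (n + 1))) := by ring
    rw [h2, ih]
    push_cast
    field_simp
    ring

/-- Archimedes' hat-box formula for polynomials, in polar coordinates on the hemisphere. -/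
theorem hatBox_polynomial (p : Polynomial ℝ) :
    ∫ u in 0..Real.pi, (∫ t in 0..Real.pi, p.eval (Real.sin u * Real.sin t)) * Real.sin u =
      2 * Real.pi * ∫ z in 0..1, p.eval z := by
  have hc (q : Polynomial ℝ) : Continuous fun x : ℝ × ℝ => q.eval (Real.sin x.1 * Real.sin x.2) :=
    q.continuous.comp (by fun_prop)
  have hc1 (q : Polynomial ℝ) : Continuous fun u : ℝ =>
      ∫ t in 0..Real.pi, q.eval (Real.sin u * Real.sin t) :=
    intervalIntegral.continuous_parametric_intervalIntegral_of_continuous' (hc q) _ _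
  induction p using Polynomial.induction_on' with
  | add p q hp hq =>
    have h1 (u : ℝ) : ∫ t in 0..Real.pi, (p + q).eval (Real.sin u * Real.sin t) =
        (∫ t in 0..Real.pi, p.eval (Real.sin u * Real.sin t)) +
          ∫ t in 0..Real.pi, q.eval (Real.sin u * Real.sin t) := by
      simp only [Polynomial.eval_add]
      apply intervalIntegral.integral_add <;> apply Continuous.intervalIntegrable
      · exact p.continuous.comp (by fun_prop)
      · exact q.continuous.comp (by fun_prop)
    simp only [h1, add_mul]
    rw [intervalIntegral.integral_add, hp, hq]
    · simp only [Polynomial.eval_add]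
      rw [intervalIntegral.integral_add (p.continuous.intervalIntegrable _ _)
        (q.continuous.intervalIntegrable _ _)]
      ring
    · exact ((hc1 p).mul Real.continuous_sin).intervalIntegrable _ _
    · exact ((hc1 q).mul Real.continuous_sin).intervalIntegrable _ _
  | monomial n a =>
    have h1 (u : ℝ) : (∫ t in 0..Real.pi, (Polynomial.monomial n a).eval
        (Real.sin u * Real.sin t)) * Real.sin u =
        (a * ∫ t in 0..Real.pi, Real.sin t ^ n) * Real.sin u ^ (n + 1) := by
      simp only [Polynomial.eval_monomial, mul_pow, intervalIntegral.integral_const_mul]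
      ring
    simp only [h1]
    rw [intervalIntegral.integral_const_mul, mul_assoc,
      integral_sin_pow_mul_integral_sin_pow_succ]
    simp only [Polynomial.eval_monomial, intervalIntegral.integral_const_mul, integral_pow]
    simp
    ring

theorem integral_eq_zero_of_hatBox {Q : ℝ → ℝ} (hQ : Continuous Q)
    (h : ∀ b ∈ Set.Icc (0 : ℝ) 1, ∫ t in 0..Real.pi, Q (b * Real.sin t) = 0) :
    ∫ z in 0..1, Q z = 0 := by
  have key : ∀ ε > 0, |2 * Real.pi * ∫ z in 0..1, Q z| ≤
      ε * (Real.pi * Real.pi + 2 * Real.pi) := by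
    intro ε hε
    obtain ⟨p, hp⟩ := exists_polynomial_near_of_continuousOn 0 1 Q hQ.continuousOn ε hε
    have hm : ∀ t ∈ Set.uIoc 0 Real.pi, Real.sin t ∈ Set.Icc (0 : ℝ) 1 := by
      intro t ht
      rw [Set.uIoc_of_le Real.pi_pos.le] at ht
      exact ⟨Real.sin_nonneg_of_nonneg_of_le_pi ht.1.le ht.2, Real.sin_le_one t⟩
    have h1 : ∀ u ∈ Set.uIoc 0 Real.pi,
        ‖(∫ t in 0..Real.pi, p.eval (Real.sin u * Real.sin t)) * Real.sin u‖ ≤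
          ε * Real.pi := by
      intro u hu
      have e : ∫ t in 0..Real.pi, p.eval (Real.sin u * Real.sin t) =
          ∫ t in 0..Real.pi, (p.eval (Real.sin u * Real.sin t) - Q (Real.sin u * Real.sin t)) := by
        rw [intervalIntegral.integral_sub, h _ (hm u hu), sub_zero] <;>
          apply Continuous.intervalIntegrable
        · exact p.continuous.comp (by fun_prop)
        · fun_prop
      have b1 : ‖∫ t in 0..Real.pi, p.eval (Real.sin u * Real.sin t)‖ ≤
          ε * |Real.pi - 0| := by
        rw [e]
        apply intervalIntegral.norm_integral_le_of_norm_le_const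
        intro t ht
        obtain ⟨a1, a2⟩ := hm u hu
        obtain ⟨b1, b2⟩ := hm t ht
        exact (hp _ ⟨mul_nonneg a1 b1, mul_le_one₀ a2 b1 b2⟩).le
      rw [sub_zero, abs_of_pos Real.pi_pos] at b1
      rw [norm_mul]
      calc _ ≤ ε * Real.pi * 1 :=
            mul_le_mul b1 (Real.abs_sin_le_one u) (abs_nonneg _) (by positivity)
        _ = _ := mul_one _
    have h2 := intervalIntegral.norm_integral_le_of_norm_le_const h1
    rw [hatBox_polynomial, sub_zero, abs_of_pos Real.pi_pos, Real.norm_eq_abs] at h2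
    have h3 : ‖∫ z in 0..1, (p.eval z - Q z)‖ ≤ ε * |1 - 0| := by
      apply intervalIntegral.norm_integral_le_of_norm_le_const
      intro z hz
      rw [Set.uIoc_of_le zero_le_one] at hz
      exact (hp z ⟨hz.1.le, hz.2⟩).le
    rw [intervalIntegral.integral_sub (p.continuous.intervalIntegrable _ _)
      (hQ.intervalIntegrable _ _)] at h3
    norm_num at h3
    have e : 2 * Real.pi * ∫ z in 0..1, Q z = (2 * Real.pi * ∫ z in 0..1, p.eval z) -
      2 * Real.pi * ((∫ z in 0..1, p.eval z) - ∫ z in 0..1, Q z) := by ring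
    rw [e]
    refine (abs_sub _ _).trans ?_
    rw [abs_mul _ ((∫ z in 0..1, p.eval z) - ∫ z in 0..1, Q z),
      abs_of_pos Real.two_pi_pos]
    have := mul_le_mul_of_nonneg_left h3 Real.two_pi_pos.le
    linarith
  have hz : |2 * Real.pi * ∫ z in 0..1, Q z| ≤ 0 := by
    apply le_of_forall_pos_le_add
    intro δ hδ
    have := key (δ / (Real.pi * Real.pi + 2 * Real.pi)) (by positivity)
    rwa [div_mul_cancel₀ _ (by positivity), ← zero_add δ] at this
  have := abs_nonpos_iff.1 hz
  simpa [Real.pi_ne_zero] using this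

/-- Injectivity of the Abel transform. -/
theorem eq_zero_of_abel {P : ℝ → ℝ} (hP : Continuous P)
    (h : ∀ b ∈ Set.Icc (0 : ℝ) 1, ∫ t in 0..Real.pi, P (b * Real.sin t) = 0) :
    P 1 = 0 := by
  have h1 : ∀ b ∈ Set.Icc (0 : ℝ) 1, ∫ z in 0..b, P z = 0 := by
    intro b hb
    have := integral_eq_zero_of_hatBox (Q := fun z => P (b * z)) (by fun_prop) (by
      intro c hc
      simp only [← mul_assoc]
      exact h _ ⟨mul_nonneg hb.1 hc.1, mul_le_one₀ hb.2 hc.1 hc.2⟩)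
    rcases hb.1.eq_or_lt with rfl | hpos
    · simp
    · rw [intervalIntegral.integral_comp_mul_left _ hpos.ne'] at this
      simpa [hpos.ne'] using this
  have h2 : ∀ b ∈ Set.Ioo (0 : ℝ) 1, P b = 0 := by
    intro b hb
    have d1 := intervalIntegral.integral_hasDerivAt_right (hP.intervalIntegrable 0 b)
      (hP.stronglyMeasurableAtFilter _ _) hP.continuousAt
    have d2 : HasDerivAt (fun u => ∫ z in 0..u, P z) 0 b := by
      refine (hasDerivAt_const b (0 : ℝ)).congr_of_eventuallyEq ?_
      filter_upwards [Ioo_mem_nhds hb.1 hb.2] with c hc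
      exact h1 c ⟨hc.1.le, hc.2.le⟩
    exact d1.unique d2
  have h3 : Set.EqOn P 0 (closure (Set.Ioo (0 : ℝ) 1)) :=
    Set.EqOn.closure h2 hP continuous_zero
  rw [closure_Ioo zero_ne_one] at h3
  exact h3 (Set.right_mem_Icc.2 zero_le_one)

section Circles

variable {V : Type*} [NormedAddCommGroup V] [InnerProductSpace ℝ V]

/-- An orthonormal pair of vectors. -/
def OrthoPair (a b : V) : Prop := ⟪a, a⟫ = 1 ∧ ⟪b, b⟫ = 1 ∧ ⟪a, b⟫ = 0

/-- An orthonormal triple of vectors. -/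
def OrthoTriple (a b c : V) : Prop := OrthoPair a b ∧ ⟪c, c⟫ = 1 ∧ ⟪a, c⟫ = 0 ∧ ⟪b, c⟫ = 0

/-- The great circle through `a` and `b`, parametrized by arc length for an orthonormal pair. -/
def circ (a b : V) (t : ℝ) : V := Real.cos t • a + Real.sin t • b

theorem circ_zero (a b : V) : circ a b 0 = a := by simp [circ]

theorem circ_add_pi (a b : V) (t : ℝ) : circ a b (t + Real.pi) = -circ a b t := by
  simp [circ]; abel

theorem circ_add_two_pi (a b : V) (t : ℝ) : circ a b (t + 2 * Real.pi) = circ a b t := by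
  simp [circ]

theorem circ_circ (a b : V) (s t : ℝ) :
    circ (circ a b s) (circ a b (s + Real.pi / 2)) t = circ a b (s + t) := by
  simp only [circ, Real.cos_add, Real.sin_add, Real.cos_pi_div_two, Real.sin_pi_div_two]
  module

theorem continuous_circ_right (a b : V) : Continuous (circ a b) := by
  unfold circ; fun_prop

theorem continuous_circ_left (t : ℝ) : Continuous fun q : V × V => circ q.1 q.2 t := by
  unfold circ; fun_prop

theorem OrthoTriple.inner_comb {a b c : V} (h : OrthoTriple a b c) (p q r p' q' r' : ℝ) :
    ⟪p • a + q • b + r • c, p' • a + q' • b + r' • c⟫ = p * p' + q * q' + r * r' := by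
  obtain ⟨⟨ha, hb, hab⟩, hc, hac, hbc⟩ := h
  have hba : ⟪b, a⟫ = 0 := by rw [real_inner_comm, hab]
  have hca : ⟪c, a⟫ = 0 := by rw [real_inner_comm, hac]
  have hcb : ⟪c, b⟫ = 0 := by rw [real_inner_comm, hbc]
  simp only [inner_add_left, inner_add_right, real_inner_smul_left, real_inner_smul_right, ha, hb,
    hc, hab, hac, hbc, hba, hca, hcb]
  ring

theorem OrthoPair.inner_comb {a b : V} (h : OrthoPair a b) (p q p' q' : ℝ) :
    ⟪p • a + q • b, p' • a + q' • b⟫ = p * p' + q * q' := by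
  obtain ⟨ha, hb, hab⟩ := h
  have hba : ⟪b, a⟫ = 0 := by rw [real_inner_comm, hab]
  simp only [inner_add_left, inner_add_right, real_inner_smul_left, real_inner_smul_right, ha, hb,
    hab, hba]
  ring

theorem OrthoPair.inner_circ_self {a b : V} (h : OrthoPair a b) (t : ℝ) :
    ⟪circ a b t, circ a b t⟫ = 1 := by
  rw [circ, h.inner_comb]
  nlinarith [Real.sin_sq_add_cos_sq t]

theorem OrthoPair.rotate {a b : V} (h : OrthoPair a b) (t : ℝ) :
    OrthoPair (circ a b t) (circ a b (t + Real.pi / 2)) := by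
  refine ⟨h.inner_circ_self _, h.inner_circ_self _, ?_⟩
  rw [circ, circ, h.inner_comb, Real.cos_add_pi_div_two, Real.sin_add_pi_div_two]
  ring

theorem exists_polar (p q : ℝ) :
    ∃ δ : ℝ, p = √(p ^ 2 + q ^ 2) * Real.cos δ ∧ q = √(p ^ 2 + q ^ 2) * Real.sin δ := by
  refine ⟨Complex.arg ⟨p, q⟩, ?_, ?_⟩
  · have := Complex.norm_mul_cos_arg ⟨p, q⟩
    rw [Complex.norm_eq_sqrt_sq_add_sq] at this
    exact this.symm
  · have := Complex.norm_mul_sin_arg ⟨p, q⟩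
    rw [Complex.norm_eq_sqrt_sq_add_sq] at this
    exact this.symm

/-- Injectivity of the Funk transform on even functions. -/
theorem add_neg_eq_zero_of_integral_circ {H : V → ℝ} (hH : Continuous H)
    (h : ∀ a b : V, OrthoPair a b → ∫ t in 0..2 * Real.pi, H (circ a b t) = 0)
    {x y z : V} (hx : OrthoTriple x y z) : H x + H (-x) = 0 := by
  set N : ℝ → ℝ := fun s => ∫ φ in 0..2 * Real.pi, H (s • x + √(1 - s ^ 2) • circ y z φ) with hN
  have hcy := continuous_circ_right y z
  have cN : Continuous N := by
    apply intervalIntegral.continuous_parametric_intervalIntegral_of_continuous'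
    unfold circ
    fun_prop
  have key : ∀ b ∈ Set.Icc (0 : ℝ) 1, ∫ t in 0..Real.pi, (N (b * Real.sin t) +
      N (-(b * Real.sin t))) = 0 := by
    intro b hb
    have hb2 : 0 ≤ 1 - b ^ 2 := by nlinarith [hb.1, hb.2]
    set b' := √(1 - b ^ 2) with hb'
    have hbb : b' ^ 2 = 1 - b ^ 2 := Real.sq_sqrt hb2
    set e₁ : ℝ → V := fun φ => -Real.sin φ • y + Real.cos φ • z with he₁
    set e₂ : ℝ → V := fun φ => b • x + b' • circ y z φ with he₂
    have hp : ∀ φ, OrthoPair (e₁ φ) (e₂ φ) := by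
      intro φ
      have r1 : e₁ φ = (0 : ℝ) • x + (-Real.sin φ) • y + Real.cos φ • z := by
        simp only [he₁]; module
      have r2 : e₂ φ = b • x + (b' * Real.cos φ) • y + (b' * Real.sin φ) • z := by
        simp only [he₂, circ]; module
      have hs := Real.sin_sq_add_cos_sq φ
      rw [r1, r2]
      refine ⟨?_, ?_, ?_⟩ <;> rw [hx.inner_comb]
      · linear_combination hs
      · linear_combination b' ^ 2 * hs + hbb
      · ring
    have inner_eq : ∀ t, ∫ φ in 0..2 * Real.pi, H (circ (e₁ φ) (e₂ φ) t) =
        N (b * Real.sin t) := by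
      intro t
      obtain ⟨δ, h1, h2⟩ := exists_polar (b' * Real.sin t) (Real.cos t)
      have hr : (b' * Real.sin t) ^ 2 + Real.cos t ^ 2 = 1 - (b * Real.sin t) ^ 2 := by
        rw [mul_pow, hbb, Real.cos_sq']; ring
      rw [hr] at h1 h2
      set r := √(1 - (b * Real.sin t) ^ 2) with hr'
      have hshift : ∀ φ, circ (e₁ φ) (e₂ φ) t =
          (b * Real.sin t) • x + r • circ y z (φ + δ) := by
        intro φ
        have : circ (e₁ φ) (e₂ φ) t = (b * Real.sin t) • x +
            ((b' * Real.sin t) * Real.cos φ - Real.cos t * Real.sin φ) • y +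
            ((b' * Real.sin t) * Real.sin φ + Real.cos t * Real.cos φ) • z := by
          simp only [circ, he₁, he₂]; module
        rw [this, h1, h2, circ, Real.cos_add, Real.sin_add]
        module
      simp only [hshift]
      rw [intervalIntegral.integral_comp_add_right
        (fun φ => H ((b * Real.sin t) • x + r • circ y z φ))]
      have per : Function.Periodic
          (fun φ => H ((b * Real.sin t) • x + r • circ y z φ)) (2 * Real.pi) := by
        intro φ
        simp only [circ_add_two_pi]
      have := per.intervalIntegral_add_eq δ 0
      rw [zero_add, add_comm (2 * Real.pi) δ, this, zero_add]
    have swap : ∫ t in 0..2 * Real.pi, N (b * Real.sin t) = 0 := by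
      simp only [← inner_eq]
      have cH : Continuous (Function.uncurry fun t φ => H (circ (e₁ φ) (e₂ φ) t)) := by
        simp only [he₁, he₂, circ]; fun_prop
      rw [MeasureTheory.intervalIntegral_intervalIntegral_swap]
      · simp only [h _ _ (hp _), intervalIntegral.integral_zero]
      · exact (cH.continuousOn.integrableOn_compact
          (isCompact_uIcc.prod isCompact_uIcc)).mono_set
            (Set.prod_mono Set.uIoc_subset_uIcc Set.uIoc_subset_uIcc)
    have c1 : Continuous fun t => N (b * Real.sin t) := by fun_prop
    have c2 : Continuous fun t => N (-(b * Real.sin t)) := by fun_prop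
    rw [← intervalIntegral.integral_add_adjacent_intervals (c1.intervalIntegrable 0 Real.pi)
      (c1.intervalIntegrable _ _)] at swap
    rw [intervalIntegral.integral_add (c1.intervalIntegrable _ _) (c2.intervalIntegrable _ _)]
    have := intervalIntegral.integral_comp_add_right (a := 0) (b := Real.pi)
      (fun t => N (b * Real.sin t)) Real.pi
    rw [zero_add, ← two_mul] at this
    rw [← this] at swap
    simpa only [Real.sin_add_pi, mul_neg] using swap
  have h0 := eq_zero_of_abel (P := fun s => N s + N (-s)) (by fun_prop) key
  simp only [hN, one_pow, sub_self, Real.sqrt_zero, zero_smul, add_zero, one_smul, even_two,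
    Even.neg_pow, neg_smul, intervalIntegral.integral_const, sub_zero, smul_eq_mul,
    ← mul_add] at h0
  simpa [Real.pi_ne_zero] using h0


variable {Y : Type*}

/-- On the great circle through the pair `q`, the map `G` is `F` rotated by the angle `α`. -/
def RotCirc (F G : V → Y) (α : ℝ) (q : V × V) : Prop :=
  ∀ t, F (circ q.1 q.2 (t + α)) = G (circ q.1 q.2 t)

theorem RotCirc.symm {F G : V → Y} {α : ℝ} {q : V × V} (h : RotCirc F G α q) :
    RotCirc G F (-α) q := by
  intro t
  rw [← h (t + -α), neg_add_cancel_right]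

theorem orthoPair_of_inner_eq_cos {α : ℝ} (hα : Real.sin α ≠ 0) {x y : V}
    (hx : ⟪x, x⟫ = 1) (hy : ⟪y, y⟫ = 1) (hxy : ⟪x, y⟫ = Real.cos α) :
    OrthoPair y ((Real.sin α)⁻¹ • (Real.cos α • y - x)) := by
  have hyx : ⟪y, x⟫ = Real.cos α := by rw [real_inner_comm, hxy]
  refine ⟨hy, ?_, ?_⟩ <;>
    simp only [inner_sub_left, inner_sub_right, real_inner_smul_left, real_inner_smul_right, hx,
      hy, hxy, hyx]
  · field_simp
    linear_combination -Real.sin_sq_add_cos_sq α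
  · ring

theorem eventually_eq_of_sphere_values {F G : V → Y} {α : ℝ} (hα : Real.sin α ≠ 0)
    {e₁ e₂ : V} (h : ∀ᶠ q : V × V in nhds (e₁, e₂), OrthoPair q.1 q.2 →
      F q.1 = G (Real.cos α • q.1 - Real.sin α • q.2)) (e₃ : V) :
    ∀ᶠ q : V × V × V × ℝ × ℝ in nhds (e₁, e₃, e₂, 1, 0),
      OrthoTriple q.1 q.2.1 q.2.2.1 → q.2.2.2.1 ^ 2 + q.2.2.2.2 ^ 2 = 1 →
        F (q.2.2.2.1 • q.1 + q.2.2.2.2 • q.2.1) = F q.1 := by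
  set p : V × V × V × ℝ × ℝ → V := fun q => q.2.2.2.1 • q.1 + q.2.2.2.2 • q.2.1 with hp
  set D : V × V × V × ℝ × ℝ → ℝ := fun q => 1 - 2 * Real.cos α ^ 2 / (1 + q.2.2.2.1) with hD
  set x : V × V × V × ℝ × ℝ → V := fun q => (Real.cos α / (1 + q.2.2.2.1)) • (q.1 + p q) -
    (Real.sin α * √(D q / Real.sin α ^ 2)) • q.2.2.1 with hx
  have hD0 : D (e₁, e₃, e₂, 1, 0) = Real.sin α ^ 2 := by
    simp only [hD]
    rw [Real.sin_sq]
    norm_num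
  have cp : Continuous p := by fun_prop
  have cD : ContinuousAt D (e₁, e₃, e₂, 1, 0) := by
    have : ContinuousAt (fun q : V × V × V × ℝ × ℝ => q.2.2.2.1) (e₁, e₃, e₂, 1, 0) := by fun_prop
    refine continuousAt_const.sub (continuousAt_const.div (continuousAt_const.add this) ?_)
    norm_num
  have cx : ContinuousAt x (e₁, e₃, e₂, 1, 0) := by
    have : ContinuousAt (fun q : V × V × V × ℝ × ℝ => q.2.2.2.1) (e₁, e₃, e₂, 1, 0) := by fun_prop
    refine ContinuousAt.sub (ContinuousAt.smul
      (continuousAt_const.div (continuousAt_const.add this) (by norm_num)) (by fun_prop))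
      (ContinuousAt.smul (continuousAt_const.mul
        (Real.continuous_sqrt.continuousAt.comp (cD.div_const _))) (by fun_prop))
  have hp0 : p (e₁, e₃, e₂, 1, 0) = e₁ := by simp [hp]
  have hx0 : x (e₁, e₃, e₂, 1, 0) = Real.cos α • e₁ - Real.sin α • e₂ := by
    simp only [hx, hp0, hD0, div_self (pow_ne_zero 2 hα), Real.sqrt_one]
    module
  have hτ0 : (Real.sin α)⁻¹ • (Real.cos α • e₁ - (Real.cos α • e₁ - Real.sin α • e₂)) = e₂ := by
    rw [sub_sub_cancel, smul_smul, inv_mul_cancel₀ hα, one_smul]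
  have t1 : Filter.Tendsto (fun q => (q.1, (Real.sin α)⁻¹ • (Real.cos α • q.1 - x q)))
      (nhds (e₁, e₃, e₂, (1 : ℝ), (0 : ℝ))) (nhds (e₁, e₂)) := by
    have : ContinuousAt (fun q => (q.1, (Real.sin α)⁻¹ • (Real.cos α • q.1 - x q)))
      (e₁, e₃, e₂, (1 : ℝ), (0 : ℝ)) := by fun_prop
    have := this.tendsto
    rwa [hx0, hτ0] at this
  have t2 : Filter.Tendsto (fun q => (p q, (Real.sin α)⁻¹ • (Real.cos α • p q - x q)))
      (nhds (e₁, e₃, e₂, (1 : ℝ), (0 : ℝ))) (nhds (e₁, e₂)) := by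
    have : ContinuousAt (fun q => (p q, (Real.sin α)⁻¹ • (Real.cos α • p q - x q)))
      (e₁, e₃, e₂, (1 : ℝ), (0 : ℝ)) := by fun_prop
    have := this.tendsto
    rwa [hx0, hp0, hτ0] at this
  have c1 : ∀ᶠ q : V × V × V × ℝ × ℝ in nhds (e₁, e₃, e₂, (1 : ℝ), (0 : ℝ)),
      0 < 1 + q.2.2.2.1 := by
    have : ContinuousAt (fun q : V × V × V × ℝ × ℝ => 1 + q.2.2.2.1) (e₁, e₃, e₂, 1, 0) := by
      fun_prop
    exact this.eventually_const_lt (by norm_num)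
  have c2 : ∀ᶠ q in nhds (e₁, e₃, e₂, (1 : ℝ), (0 : ℝ)), 0 < D q :=
    cD.eventually_const_lt (by rw [hD0]; positivity)
  filter_upwards [t1.eventually h, t2.eventually h, c1, c2] with q h1 h2 h3 h4 ho hCS
  have hR : √(D q / Real.sin α ^ 2) ^ 2 = D q / Real.sin α ^ 2 := Real.sq_sqrt (by positivity)
  have hDq : D q * (1 + q.2.2.2.1) = 1 + q.2.2.2.1 - 2 * Real.cos α ^ 2 := by
    simp only [hD]; field_simp
  obtain ⟨y, ν, τ, C, S⟩ := q
  simp only at h1 h2 h3 hR hDq ho hCS ⊢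
  set A := Real.cos α / (1 + C) with hA
  have hA' : A * (1 + C) = Real.cos α := by rw [hA]; field_simp
  set R := √(D (y, ν, τ, C, S) / Real.sin α ^ 2) with hR0
  rw [eq_div_iff (pow_ne_zero 2 hα)] at hR
  have rx : x (y, ν, τ, C, S) = (A * (1 + C)) • y + (A * S) • ν + (-(Real.sin α * R)) • τ := by
    simp only [hx, hp, ← hA, ← hR0]
    module
  have ry : y = (1 : ℝ) • y + (0 : ℝ) • ν + (0 : ℝ) • τ := by module
  have rp : p (y, ν, τ, C, S) = C • y + S • ν + (0 : ℝ) • τ := by simp only [hp]; module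
  have ixx : ⟪x (y, ν, τ, C, S), x (y, ν, τ, C, S)⟫ = 1 := by
    rw [rx, ho.inner_comb]
    have e : A * (1 + C) * (A * (1 + C)) + A * S * (A * S) +
        -(Real.sin α * R) * -(Real.sin α * R) = 1 ↔
      (A * (1 + C) * (A * (1 + C)) + A * S * (A * S) +
        -(Real.sin α * R) * -(Real.sin α * R)) * (1 + C) = 1 * (1 + C) :=
      (mul_left_inj' h3.ne').symm
    rw [e]
    linear_combination (1 + C) * hR + hDq + A ^ 2 * (1 + C) * hCS +
      (2 * A * (1 + C) + 2 * Real.cos α) * hA'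
  have ipp : ⟪p (y, ν, τ, C, S), p (y, ν, τ, C, S)⟫ = 1 := by
    rw [rp, ho.inner_comb]
    linear_combination hCS
  have ixy : ⟪x (y, ν, τ, C, S), y⟫ = Real.cos α := by
    conv_lhs => rw [rx]; arg 3; rw [ry]
    rw [ho.inner_comb]
    linear_combination hA'
  have ixp : ⟪x (y, ν, τ, C, S), p (y, ν, τ, C, S)⟫ = Real.cos α := by
    rw [rx, rp, ho.inner_comb]
    linear_combination hA' + A * hCS
  have f1 := h1 (orthoPair_of_inner_eq_cos hα ixx ho.1.1 ixy)
  have f2 := h2 (orthoPair_of_inner_eq_cos hα ixx ipp ixp)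
  rw [smul_smul, mul_inv_cancel₀ hα, one_smul, sub_sub_cancel] at f1 f2
  exact f2.trans f1.symm

/-- If the restrictions of `G` and `F` to all great circles near a given one differ by a fixed
nontrivial rotation, then `F` is locally constant along that circle. -/
theorem eventually_circ_eq {F G : V → Y} {α : ℝ} (hα : Real.sin α ≠ 0)
    {e₁ e₂ e₃ : V} (he : OrthoTriple e₁ e₂ e₃)
    (h : ∀ᶠ q : V × V in nhds (e₁, e₂), OrthoPair q.1 q.2 →
      F q.1 = G (Real.cos α • q.1 - Real.sin α • q.2)) :
    ∀ᶠ ε in nhds (0 : ℝ), F (circ e₁ e₂ ε) = F e₁ := by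
  have key := (eventually_eq_of_sphere_values hα h e₃).eventually_nhds
  have th : Filter.Tendsto (fun h : ℝ => (e₁, e₃, e₂, Real.cos h, Real.sin h))
      (nhdsWithin 0 (Set.Ioi 0)) (nhds (e₁, e₃, e₂, 1, 0)) := by
    have : Continuous (fun h : ℝ => (e₁, e₃, e₂, Real.cos h, Real.sin h)) := by fun_prop
    have := this.tendsto 0
    rw [Real.cos_zero, Real.sin_zero] at this
    exact this.mono_left nhdsWithin_le_nhds
  obtain ⟨η, hη, hη0, hηpi⟩ := ((th.eventually key).and
    (Ioo_mem_nhdsGT Real.pi_pos)).exists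
  have hs : 0 < Real.sin η := Real.sin_pos_of_pos_of_lt_pi hη0 hηpi
  set s : ℝ → ℝ := fun ε => √(1 - (Real.cos η * Real.cos ε) ^ 2) with hs_def
  have hs0 : s 0 = Real.sin η := by
    simp only [hs_def, Real.cos_zero, mul_one, ← Real.sin_sq]
    exact Real.sqrt_sq hs.le
  have cs : Continuous s := by fun_prop
  have t1 : Filter.Tendsto (fun ε : ℝ => (circ e₁ e₂ ε, e₃, circ e₁ e₂ (ε + Real.pi / 2),
      Real.cos η, Real.sin η)) (nhds 0) (nhds (e₁, e₃, e₂, Real.cos η, Real.sin η)) := by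
    have : Continuous (fun ε : ℝ => (circ e₁ e₂ ε, e₃, circ e₁ e₂ (ε + Real.pi / 2),
      Real.cos η, Real.sin η)) := by unfold circ; fun_prop
    have := this.tendsto 0
    simpa [circ] using this
  have t2 : Filter.Tendsto (fun ε : ℝ => (e₁,
      (s ε)⁻¹ • ((Real.cos η * Real.sin ε) • e₂ + Real.sin η • e₃),
      (s ε)⁻¹ • (Real.sin η • e₂ - (Real.cos η * Real.sin ε) • e₃),
      Real.cos η * Real.cos ε, s ε)) (nhds 0)
      (nhds (e₁, e₃, e₂, Real.cos η, Real.sin η)) := by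
    have ci : ContinuousAt (fun ε => (s ε)⁻¹) 0 :=
      cs.continuousAt.inv₀ (by rw [hs0]; exact hs.ne')
    have : ContinuousAt (fun ε : ℝ => (e₁,
      (s ε)⁻¹ • ((Real.cos η * Real.sin ε) • e₂ + Real.sin η • e₃),
      (s ε)⁻¹ • (Real.sin η • e₂ - (Real.cos η * Real.sin ε) • e₃),
      Real.cos η * Real.cos ε, s ε)) 0 := by fun_prop
    have := this.tendsto
    simpa [hs0, smul_smul, hs.ne'] using this
  have c3 : ∀ᶠ ε in nhds (0 : ℝ), 0 < s ε :=
    cs.continuousAt.eventually_const_lt (by rw [hs0]; exact hs)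
  filter_upwards [t1.eventually hη, t2.eventually hη, c3] with ε h1 h2 h3
  have hsε : s ε ^ 2 = 1 - (Real.cos η * Real.cos ε) ^ 2 :=
    Real.sq_sqrt (Real.sqrt_pos.1 h3).le
  have tε := Real.sin_sq_add_cos_sq ε
  have tη := Real.sin_sq_add_cos_sq η
  have o1 : OrthoTriple (circ e₁ e₂ ε) e₃ (circ e₁ e₂ (ε + Real.pi / 2)) := by
    have r1 : circ e₁ e₂ ε = Real.cos ε • e₁ + Real.sin ε • e₂ + (0 : ℝ) • e₃ := by
      simp only [circ]; module
    have r2 : circ e₁ e₂ (ε + Real.pi / 2) =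
        (-Real.sin ε) • e₁ + Real.cos ε • e₂ + (0 : ℝ) • e₃ := by
      simp only [circ, Real.cos_add_pi_div_two, Real.sin_add_pi_div_two]; module
    have r3 : e₃ = (0 : ℝ) • e₁ + (0 : ℝ) • e₂ + (1 : ℝ) • e₃ := by module
    refine ⟨⟨he.1.inner_circ_self _, he.2.1, ?_⟩, he.1.inner_circ_self _, ?_, ?_⟩
    · rw [r1]; nth_rw 2 [r3]; rw [he.inner_comb]; ring
    · rw [r1, r2, he.inner_comb]; ring
    · rw [r2]; nth_rw 1 [r3]; rw [he.inner_comb]; ring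
  have o2 : OrthoTriple e₁ ((s ε)⁻¹ • ((Real.cos η * Real.sin ε) • e₂ + Real.sin η • e₃))
      ((s ε)⁻¹ • (Real.sin η • e₂ - (Real.cos η * Real.sin ε) • e₃)) := by
    have r1 : (s ε)⁻¹ • ((Real.cos η * Real.sin ε) • e₂ + Real.sin η • e₃) =
        (0 : ℝ) • e₁ + ((s ε)⁻¹ * (Real.cos η * Real.sin ε)) • e₂ +
          ((s ε)⁻¹ * Real.sin η) • e₃ := by module
    have r2 : (s ε)⁻¹ • (Real.sin η • e₂ - (Real.cos η * Real.sin ε) • e₃) =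
        (0 : ℝ) • e₁ + ((s ε)⁻¹ * Real.sin η) • e₂ +
          (-((s ε)⁻¹ * (Real.cos η * Real.sin ε))) • e₃ := by module
    have r3 : e₁ = (1 : ℝ) • e₁ + (0 : ℝ) • e₂ + (0 : ℝ) • e₃ := by module
    have i1 {v : V} (p q : ℝ) (hv : v = (0 : ℝ) • e₁ + p • e₂ + q • e₃) : ⟪e₁, v⟫ = 0 := by
      rw [hv]
      nth_rw 1 [r3]
      rw [he.inner_comb]; ring
    rw [r1, r2]
    refine ⟨⟨he.1.1, ?_, i1 _ _ rfl⟩, ?_, i1 _ _ rfl, ?_⟩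
    · rw [he.inner_comb]
      field_simp
      linear_combination tη - hsε + Real.cos η ^ 2 * tε
    · rw [he.inner_comb]
      field_simp
      linear_combination tη - hsε + Real.cos η ^ 2 * tε
    · rw [he.inner_comb]; ring
  have f1 := h1 o1 (by linear_combination tη)
  have f2 := h2 o2 (by linear_combination hsε)
  simp only [smul_smul] at f2
  rw [mul_inv_cancel₀ h3.ne', one_smul] at f2
  rw [← f1, ← f2]
  congr 1
  simp only [circ]
  module

theorem RotCirc.rotate {F G : V → Y} {α : ℝ} {q : V × V} (h : RotCirc F G α q) (s : ℝ) :
    RotCirc F G α (circ q.1 q.2 s, circ q.1 q.2 (s + Real.pi / 2)) := by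
  intro t
  rw [circ_circ, circ_circ, ← add_assoc]
  exact h _

theorem circ_add_of_sin_eq_zero (a b : V) (t : ℝ) {α : ℝ} (hα : Real.sin α = 0) :
    circ a b (t + α) = Real.cos α • circ a b t := by
  simp only [circ, Real.cos_add, Real.sin_add, hα]
  module

theorem sin_ne_zero_of_rotCirc {F G : V → Y} {α : ℝ} {a b : V} (h : RotCirc F G α (a, b))
    (ha : F a ≠ G a) {s : ℝ} (hs : F (circ a b s) ≠ G (-circ a b s)) : Real.sin α ≠ 0 := by
  intro hα
  have h' : ∀ t, F (Real.cos α • circ a b t) = G (circ a b t) := fun t => by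
    rw [← circ_add_of_sin_eq_zero a b t hα]; exact h t
  have hc : (Real.cos α - 1) * (Real.cos α + 1) = 0 := by
    linear_combination Real.sin_sq_add_cos_sq α - Real.sin α * hα
  rcases mul_eq_zero.1 hc with hc | hc
  · have := h' 0
    rw [sub_eq_zero.1 hc, one_smul, circ_zero] at this
    exact ha this
  · have := h' (s + Real.pi)
    rw [eq_neg_of_add_eq_zero_left hc, circ_add_pi, neg_one_smul, neg_neg] at this
    exact hs this

theorem apply_eq_apply_neg_of_eventually_rotCirc {F G : V → Y} {α : ℝ} (hα : Real.sin α ≠ 0)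
    {a b c : V} (hab : OrthoTriple a b c)
    (h : ∀ᶠ q : V × V in nhds (a, b), OrthoPair q.1 q.2 → RotCirc F G α q) : F a = F (-a) := by
  have loc : ∀ s, ∀ᶠ t in nhds s, F (circ a b t) = F (circ a b s) := by
    intro s
    have hT : OrthoTriple (circ a b s) (circ a b (s + Real.pi / 2)) c := by
      refine ⟨hab.1.rotate s, hab.2.1, ?_, ?_⟩ <;>
        simp [circ, inner_add_left, real_inner_smul_left, hab.2.2.1, hab.2.2.2]
    have ev : ∀ᶠ q : V × V in nhds (circ a b s, circ a b (s + Real.pi / 2)),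
        OrthoPair q.1 q.2 → F q.1 = G (Real.cos α • q.1 - Real.sin α • q.2) := by
      have tend (r : ℝ) : Filter.Tendsto
          (fun q : V × V => (circ q.1 q.2 r, circ q.1 q.2 (r + Real.pi / 2)))
          (nhds (circ a b s, circ a b (s + Real.pi / 2))) (nhds (circ a b (s + r),
            circ a b (s + (r + Real.pi / 2)))) := by
        have := ((continuous_circ_left r).prodMk
          (continuous_circ_left (V := V) (r + Real.pi / 2))).tendsto
          (circ a b s, circ a b (s + Real.pi / 2))
        rwa [circ_circ, circ_circ] at this
      have t0 := tend (-s)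
      rw [add_neg_cancel, add_neg_cancel_left, circ_zero] at t0
      have hb : circ a b (Real.pi / 2) = b := by simp [circ]
      rw [hb] at t0
      filter_upwards [t0.eventually h] with q hq ho
      have := (hq (ho.rotate _)).rotate s (-α)
      simp only [circ_circ] at this
      rw [← add_assoc, neg_add_cancel, zero_add, circ_zero, neg_add_cancel, circ_zero] at this
      simpa [circ, sub_eq_add_neg] using this
    have e := eventually_circ_eq hα hT ev
    have t1 : Filter.Tendsto (fun t => t - s) (nhds s) (nhds 0) := by
      have : Continuous fun t : ℝ => t - s := by fun_prop
      simpa using this.tendsto s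
    filter_upwards [t1.eventually e] with t ht
    rwa [circ_circ, add_sub_cancel] at ht
  have := (IsLocallyConstant.iff_eventually_eq _).2 loc
  have := this.apply_eq_of_preconnectedSpace 0 (0 + Real.pi)
  rwa [circ_add_pi, circ_zero] at this

variable [MetricSpace Y]

theorem comp_add_comp_neg_eq {F G : V → Y} (hF : Continuous F) (hG : Continuous G)
    (h : ∀ a b : V, OrthoPair a b → ∃ α, RotCirc F G α (a, b))
    {x y z : V} (hx : OrthoTriple x y z) {k : Y → ℝ} (hk : Continuous k) :
    k (F x) + k (F (-x)) = k (G x) + k (G (-x)) := by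
  have key := add_neg_eq_zero_of_integral_circ (H := fun v => k (F v) - k (G v)) (by fun_prop)
    (by
      intro a b hab
      obtain ⟨α, hα⟩ := h a b hab
      have hc := continuous_circ_right a b
      have c1 : Continuous fun t => k (F (circ a b t)) := by fun_prop
      have c2 : Continuous fun t => k (G (circ a b t)) := by fun_prop
      rw [intervalIntegral.integral_sub (c1.intervalIntegrable _ _) (c2.intervalIntegrable _ _),
        sub_eq_zero]
      have hα' : ∀ t, k (G (circ a b t)) = k (F (circ a b (t + α))) := fun t => by rw [← hα t]
      simp only [hα']
      rw [intervalIntegral.integral_comp_add_right (fun t => k (F (circ a b t)))]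
      have per : Function.Periodic (fun t => k (F (circ a b t))) (2 * Real.pi) := by
        intro t
        simp only [circ_add_two_pi]
      have := per.intervalIntegral_add_eq α 0
      rw [zero_add, add_comm (2 * Real.pi) α, this, zero_add]) hx
  linarith

theorem mem_antipodal_values {F G : V → Y} (hF : Continuous F) (hG : Continuous G)
    (h : ∀ a b : V, OrthoPair a b → ∃ α, RotCirc F G α (a, b))
    {x y z : V} (hx : OrthoTriple x y z) :
    (F x = G x ∨ F x = G (-x)) ∧ (F (-x) = G x ∨ F (-x) = G (-x)) := by
  have := comp_add_comp_neg_eq hF hG h hx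
    (k := fun v => min (dist v (G x)) (dist v (G (-x)))) (by fun_prop)
  simp only [dist_self, dist_nonneg, min_eq_left, min_eq_right, add_zero] at this
  have h1 : 0 ≤ min (dist (F x) (G x)) (dist (F x) (G (-x))) := le_min dist_nonneg dist_nonneg
  have h2 : 0 ≤ min (dist (F (-x)) (G x)) (dist (F (-x)) (G (-x))) :=
    le_min dist_nonneg dist_nonneg
  have e1 : min (dist (F x) (G x)) (dist (F x) (G (-x))) ≤ 0 := by linarith
  have e2 : min (dist (F (-x)) (G x)) (dist (F (-x)) (G (-x))) ≤ 0 := by linarith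
  simpa only [min_le_iff, dist_le_zero] using And.intro e1 e2

theorem antipodal_values_eq {F G : V → Y} (hF : Continuous F) (hG : Continuous G)
    (h : ∀ a b : V, OrthoPair a b → ∃ α, RotCirc F G α (a, b))
    {x y z : V} (hx : OrthoTriple x y z) :
    (F x = G x ∧ F (-x) = G (-x)) ∨ (F x = G (-x) ∧ F (-x) = G x) := by
  have h1 := mem_antipodal_values hF hG h hx
  have h2 := mem_antipodal_values hG hF (fun a b hab => (h a b hab).imp' _ fun _ hα => hα.symm) hx
  grind

/-- A rotation angle on a circle where neither alternative holds is a rational multiple of `π`. -/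
theorem exists_rat_mul_pi_of_rotCirc {F G : V → Y} (hF : Continuous F) (hG : Continuous G)
    {a b : V}
    (hv : ∀ t, (F (circ a b t) = G (circ a b t) ∧ F (-circ a b t) = G (-circ a b t)) ∨
      (F (circ a b t) = G (-circ a b t) ∧ F (-circ a b t) = G (circ a b t)))
    (ha : F a ≠ G a) {s : ℝ} (hs : F (circ a b s) ≠ G (-circ a b s))
    {α : ℝ} (h : RotCirc F G α (a, b)) : ∃ r : ℚ, α = r * Real.pi := by
  by_contra! hr
  have hirr : Irrational (α / Real.pi) := by
    rintro ⟨r, h⟩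
    exact hr r (by rw [h, div_mul_cancel₀ _ Real.pi_ne_zero])
  set d : ℝ → ℝ := fun t => dist (F (circ a b t)) (F (-circ a b t)) with hd
  have hc := continuous_circ_right a b
  have cd : Continuous d := by fun_prop
  have dpi : ∀ t, d (t + Real.pi) = d t := by
    intro t
    simp only [hd, circ_add_pi, neg_neg]
    exact dist_comm _ _
  have dα : ∀ t, d (t + α) = d t := by
    intro t
    have h1 := h (t + Real.pi)
    have h2 := h t
    rw [add_right_comm, circ_add_pi, circ_add_pi] at h1
    simp only [hd, h1, h2]
    rcases hv t with h | h
    · rw [h.1, h.2]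
    · rw [h.1, h.2, dist_comm]
  let S : AddSubgroup ℝ :=
    { carrier := {s | ∀ t, d (t + s) = d t}
      zero_mem' := by simp
      add_mem' := by
        intro x y hx hy t
        rw [← add_assoc, hy, hx]
      neg_mem' := by
        intro x hx t
        rw [← hx (t + -x), neg_add_cancel_right] }
  have hSd : Dense (S : Set ℝ) :=
    (dense_addSubgroupClosure_pair_iff.2 hirr).mono ((AddSubgroup.closure_le S).2 (by
      rintro x (rfl | rfl)
      · exact dα
      · exact dpi))
  have dconst : ∀ t, d t = d 0 := by
    intro t
    have : (S : Set ℝ) ⊆ {t | d t = d 0} := by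
      intro x hx
      have := hx 0
      rwa [zero_add] at this
    have h2 := closure_minimal this (isClosed_eq cd continuous_const)
    rw [hSd.closure_eq] at h2
    exact h2 (Set.mem_univ t)
  have hne : ∀ t, F (circ a b t) ≠ F (-circ a b t) := by
    intro t ht
    have h0 : d 0 = 0 := by
      rw [← dconst t]
      exact dist_eq_zero.2 ht
    have h1 := hv 0
    simp only [hd, circ_zero, dist_eq_zero] at h0 h1
    rcases h1 with h1 | h1
    · exact ha h1.1
    · exact ha (h0.trans h1.2)
  have c1 : IsClosed {t | F (circ a b t) = G (circ a b t)} :=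
    isClosed_eq (by fun_prop) (by fun_prop)
  have c2 : IsClosed {t | F (circ a b t) = G (-circ a b t)} :=
    isClosed_eq (by fun_prop) (by fun_prop)
  have hcompl : {t | F (circ a b t) = G (circ a b t)} =
      {t | F (circ a b t) = G (-circ a b t)}ᶜ := by
    ext t
    have := hne t
    have := hv t
    simp only [Set.mem_ofPred_eq, Set.mem_compl_iff]
    grind
  have hclopen : IsClopen {t | F (circ a b t) = G (circ a b t)} :=
    ⟨c1, by rw [hcompl]; exact c2.isOpen_compl⟩
  rcases isClopen_iff.1 hclopen with h | h
  · have : s ∈ {t | F (circ a b t) = G (circ a b t)} := by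
      rw [hcompl]; exact hs
    rw [h] at this
    exact this
  · have : (0 : ℝ) ∈ {t | F (circ a b t) = G (circ a b t)} := by
      rw [h]; trivial
    simp only [Set.mem_ofPred_eq, circ_zero] at this
    exact ha this

theorem exists_orthoPair_circ_eq {u v : V} (hu : ⟪u, u⟫ = 1) (hv : ⟪v, v⟫ = 1)
    (h1 : v ≠ u) (h2 : v ≠ -u) : ∃ u' t, OrthoPair u u' ∧ circ u u' t = v := by
  set c := ⟪u, v⟫ with hc
  set w := v - c • u with hw
  have huw : ⟪u, w⟫ = 0 := by
    rw [hw, inner_sub_right, real_inner_smul_right, hu, ← hc]; ring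
  have hvu : ⟪v, u⟫ = c := by rw [real_inner_comm]
  have hww : ⟪w, w⟫ = 1 - c ^ 2 := by
    simp only [hw, inner_sub_left, inner_sub_right, real_inner_smul_left, real_inner_smul_right,
      hu, hv, hvu, ← hc]
    ring
  have hw0 : w ≠ 0 := by
    intro h0
    have hcc : (c - 1) * (c + 1) = 0 := by
      rw [h0, inner_zero_left] at hww
      linear_combination hww
    have hvc : v = c • u := sub_eq_zero.1 h0
    rcases mul_eq_zero.1 hcc with h | h
    · exact h1 (by rw [hvc, sub_eq_zero.1 h, one_smul])
    · exact h2 (by rw [hvc, eq_neg_of_add_eq_zero_left h, neg_one_smul])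
  have hn : ‖w‖ ≠ 0 := norm_ne_zero_iff.2 hw0
  have hn2 : ‖w‖ ^ 2 = 1 - c ^ 2 := by rw [← hww, real_inner_self_eq_norm_sq]
  obtain ⟨t, ht1, ht2⟩ := exists_polar c ‖w‖
  rw [hn2, add_sub_cancel, Real.sqrt_one, one_mul] at ht1 ht2
  refine ⟨‖w‖⁻¹ • w, t, ⟨hu, ?_, ?_⟩, ?_⟩
  · rw [real_inner_smul_left, real_inner_smul_right, real_inner_self_eq_norm_sq]
    field_simp
  · rw [real_inner_smul_right, huw, mul_zero]
  · rw [circ, ← ht1, ← ht2, smul_smul, mul_inv_cancel₀ hn, one_smul, hw, add_sub_cancel]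

/-- If two continuous maps on a sphere differ by a rotation on each great circle, then they agree
or agree up to the antipodal map. -/
theorem eqOn_or_eqOn_neg_of_rotCirc [CompleteSpace V] {F G : V → Y}
    (hF : Continuous F) (hG : Continuous G)
    (hV : ∀ a b : V, ∃ c : V, ⟪c, c⟫ = 1 ∧ ⟪a, c⟫ = 0 ∧ ⟪b, c⟫ = 0)
    (h : ∀ a b : V, OrthoPair a b → ∃ α, RotCirc F G α (a, b)) :
    (∀ x, ⟪x, x⟫ = 1 → F x = G x) ∨ (∀ x, ⟪x, x⟫ = 1 → F x = G (-x)) := by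
  have hval : ∀ x, ⟪x, x⟫ = 1 →
      (F x = G x ∧ F (-x) = G (-x)) ∨ (F x = G (-x) ∧ F (-x) = G x) := by
    intro x hx
    obtain ⟨y, hy, hxy, -⟩ := hV x x
    obtain ⟨z, hz, hxz, hyz⟩ := hV x y
    exact antipodal_values_eq hF hG h ⟨⟨hx, hy, hxy⟩, hz, hxz, hyz⟩
  by_contra! hcon
  obtain ⟨⟨u, hu, hFu⟩, v, hv, hFv⟩ := hcon
  obtain ⟨u', s, huu', rfl⟩ := exists_orthoPair_circ_eq hu hv
    (by rintro rfl; have := hval v hu; grind)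
    (by rintro rfl; have := hval u hu; rw [neg_neg] at hFv; grind)
  have cO : IsClosed {q : V × V | OrthoPair q.1 q.2} := by
    unfold OrthoPair
    simp only [Set.ofPred_and]
    exact (isClosed_eq (by fun_prop) (by fun_prop)).inter
      ((isClosed_eq (by fun_prop) (by fun_prop)).inter (isClosed_eq (by fun_prop) (by fun_prop)))
  have : CompleteSpace {q : V × V | OrthoPair q.1 q.2} := cO.completeSpace_coe
  have cs := continuous_circ_left (V := V) s
  set X : Set {q : V × V | OrthoPair q.1 q.2} :=
    {q | F q.1.1 ≠ G q.1.1} ∩ {q | F (circ q.1.1 q.1.2 s) ≠ G (-circ q.1.1 q.1.2 s)} with hX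
  have cs' : Continuous fun q : {q : V × V | OrthoPair q.1 q.2} => circ q.1.1 q.1.2 s :=
    cs.comp continuous_subtype_val
  have oX : IsOpen X := (isOpen_ne_fun (by fun_prop) (by fun_prop)).inter
    (isOpen_ne_fun (by fun_prop) (by fun_prop))
  have : BaireSpace X := oX.baireSpace
  have : Nonempty X := ⟨⟨⟨(u, u'), huu'⟩, hFu, hFv⟩⟩
  obtain ⟨r, q, hq⟩ := nonempty_interior_of_iUnion_of_closed
    (f := fun r : ℚ => {q : X | RotCirc F G (r * Real.pi) q.1.1})
    (by
      intro r
      simp only [RotCirc, Set.ofPred_forall]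
      refine isClosed_iInter fun t => isClosed_eq ?_ ?_
      · exact hF.comp ((continuous_circ_left _).comp
          (continuous_subtype_val.comp continuous_subtype_val))
      · exact hG.comp ((continuous_circ_left _).comp
          (continuous_subtype_val.comp continuous_subtype_val)))
    (by
      refine Set.eq_univ_of_forall fun q => Set.mem_iUnion.2 ?_
      obtain ⟨α, hα⟩ := h _ _ q.1.2
      obtain ⟨r, rfl⟩ := exists_rat_mul_pi_of_rotCirc hF hG
        (fun t => hval _ (OrthoPair.inner_circ_self q.1.2 t)) q.2.1 q.2.2 hα
      exact ⟨r, hα⟩)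
  have hq' : ∀ᶠ p in nhds q, RotCirc F G (r * Real.pi) p.1.1 := mem_interior_iff_mem_nhds.1 hq
  obtain ⟨⟨⟨a, b⟩, hab⟩, hqX⟩ := q
  have h1 : ∀ᶠ p in Filter.map (Subtype.val : X → {q : V × V | OrthoPair q.1 q.2}) (nhds ⟨⟨(a, b), hab⟩, hqX⟩),
      RotCirc F G (r * Real.pi) p.1 := hq'
  rw [map_nhds_subtype_val, oX.nhdsWithin_eq hqX] at h1
  have h2 : ∀ᶠ p in Filter.map (Subtype.val : {q : V × V | OrthoPair q.1 q.2} → V × V)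
      (nhds ⟨(a, b), hab⟩), RotCirc F G (r * Real.pi) p := h1
  rw [map_nhds_subtype_val, eventually_nhdsWithin_iff] at h2
  obtain ⟨c, hc, hac, hbc⟩ := hV a b
  have hα := sin_ne_zero_of_rotCirc (h2.self_of_nhds hab) hqX.1 hqX.2
  have heq := apply_eq_apply_neg_of_eventually_rotCirc hα ⟨hab, hc, hac, hbc⟩ h2
  have hFa : F a ≠ G a := hqX.1
  have := hval a hab.1
  grind

end Circles

theorem exists_unit_orthogonal_pair {V : Type*} [NormedAddCommGroup V] [InnerProductSpace ℝ V]
    [FiniteDimensional ℝ V] (hV : 2 < Module.finrank ℝ V) (a b : V) :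
    ∃ c : V, ⟪c, c⟫ = 1 ∧ ⟪a, c⟫ = 0 ∧ ⟪b, c⟫ = 0 := by
  have h1 : Module.finrank ℝ (Submodule.span ℝ ({a, b} : Set V)) ≤ 2 := by
    classical
    have := finrank_span_finset_le_card (R := ℝ) ({a, b} : Finset V)
    push_cast at this
    exact this.trans Finset.card_le_two
  have h2 := (Submodule.span ℝ ({a, b} : Set V)).finrank_add_finrank_orthogonal
  have h3 : (Submodule.span ℝ ({a, b} : Set V))ᗮ ≠ ⊥ := by
    intro h
    rw [h, finrank_bot] at h2
    omega
  obtain ⟨w, hw, hw0⟩ := Submodule.exists_mem_ne_zero_of_ne_bot h3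
  rw [Submodule.mem_orthogonal] at hw
  have hn : ‖w‖ ≠ 0 := norm_ne_zero_iff.2 hw0
  refine ⟨‖w‖⁻¹ • w, ?_, ?_, ?_⟩
  · rw [real_inner_smul_left, real_inner_smul_right, real_inner_self_eq_norm_sq]
    field_simp
  · rw [real_inner_smul_right, hw a (Submodule.subset_span (by simp)), mul_zero]
  · rw [real_inner_smul_right, hw b (Submodule.subset_span (by simp)), mul_zero]

theorem mem_sph_iff {x : E4} : x ∈ sph ↔ ⟪x, x⟫ = 1 := by
  rw [sph, mem_sphere_zero_iff_norm, real_inner_self_eq_norm_sq]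
  exact (pow_eq_one_iff_of_nonneg (norm_nonneg x) two_ne_zero).symm

/-- A linear isometry of `ℝ⁴` of determinant one which fixes two vectors of an orthonormal frame
rotates the plane of the other two. -/
theorem exists_angle_of_det_eq_one {ζ n a b : E4} (hζ : ⟪ζ, ζ⟫ = 1) (hn : OrthoTriple a b n)
    (hζa : ⟪ζ, a⟫ = 0) (hζb : ⟪ζ, b⟫ = 0) (hζn : ⟪ζ, n⟫ = 0) (φ : E4 ≃ₗᵢ[ℝ] E4)
    (hφn : φ n = n) (hφζ : φ ζ = ζ)
    (hdet : LinearMap.det (φ.toLinearEquiv : E4 →ₗ[ℝ] E4) = 1) :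
    ∃ α, ∀ t, φ (circ a b t) = circ a b (t + α) := by
  obtain ⟨⟨haa, hbb, hab⟩, hnn, han, hbn⟩ := hn
  have haζ : ⟪a, ζ⟫ = 0 := by rw [real_inner_comm, hζa]
  have hbζ : ⟪b, ζ⟫ = 0 := by rw [real_inner_comm, hζb]
  have hnζ : ⟪n, ζ⟫ = 0 := by rw [real_inner_comm, hζn]
  have hna : ⟪n, a⟫ = 0 := by rw [real_inner_comm, han]
  have hnb : ⟪n, b⟫ = 0 := by rw [real_inner_comm, hbn]
  have hba : ⟪b, a⟫ = 0 := by rw [real_inner_comm, hab]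
  have norm_one : ∀ v : E4, ⟪v, v⟫ = 1 → ‖v‖ = 1 := fun v hv => by
    rw [norm_eq_sqrt_real_inner, hv, Real.sqrt_one]
  have hon : Orthonormal ℝ ![ζ, n, a, b] := by
    rw [orthonormal_iff_ite]
    intro i j
    fin_cases i <;> fin_cases j <;>
      simp [*, norm_one _ hζ, norm_one _ hnn, norm_one _ haa, norm_one _ hbb]
  let B := basisOfOrthonormalOfCardEqFinrank hon (by simp)
  have hB : ⇑B = ![ζ, n, a, b] := coe_basisOfOrthonormalOfCardEqFinrank _ _
  let OB := B.toOrthonormalBasis (by rw [hB]; exact hon)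
  have hOB : ⇑OB = ![ζ, n, a, b] := by rw [Module.Basis.coe_toOrthonormalBasis, hB]
  have hexp : ∀ v, ⟪ζ, v⟫ = 0 → ⟪n, v⟫ = 0 → v = ⟪a, v⟫ • a + ⟪b, v⟫ • b := by
    intro v h1 h2
    have := OB.sum_repr' v
    simp [hOB, Fin.sum_univ_four, h1, h2] at this
    exact this.symm
  have iζ : ∀ v, ⟪ζ, φ v⟫ = ⟪ζ, v⟫ := fun v => by
    conv_lhs => rw [← hφζ]
    exact φ.inner_map_map _ _
  have inn : ∀ v, ⟪n, φ v⟫ = ⟪n, v⟫ := fun v => by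
    conv_lhs => rw [← hφn]
    exact φ.inner_map_map _ _
  have ea := hexp (φ a) (by rw [iζ, hζa]) (by rw [inn, real_inner_comm, han])
  have eb := hexp (φ b) (by rw [iζ, hζb]) (by rw [inn, real_inner_comm, hbn])
  set p := ⟪a, φ a⟫ with hp
  set q := ⟪b, φ a⟫ with hq
  set r := ⟪a, φ b⟫ with hr
  set s := ⟪b, φ b⟫ with hs
  have hP : OrthoPair a b := ⟨haa, hbb, hab⟩
  have m1 : p * p + q * q = 1 := by
    rw [← hP.inner_comb, ← ea, φ.inner_map_map, haa]
  have m2 : r * r + s * s = 1 := by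
    rw [← hP.inner_comb, ← eb, φ.inner_map_map, hbb]
  have m3 : p * r + q * s = 0 := by
    rw [← hP.inner_comb, ← ea, ← eb, φ.inner_map_map, hab]
  have hd : p * s - r * q = 1 := by
    rw [← LinearMap.det_toMatrix B] at hdet
    have hent : ∀ i j, LinearMap.toMatrix B B (φ.toLinearEquiv : E4 →ₗ[ℝ] E4) i j =
        ⟪![ζ, n, a, b] i, φ (![ζ, n, a, b] j)⟫ := by
      intro i j
      rw [LinearMap.toMatrix_apply, ← hOB, ← OB.repr_apply_apply]
      simp [OB, hB]
    have hM : LinearMap.toMatrix B B (φ.toLinearEquiv : E4 →ₗ[ℝ] E4) =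
        !![1, 0, 0, 0; 0, 1, 0, 0; 0, 0, p, r; 0, 0, q, s] := by
      ext i j
      rw [hent]
      fin_cases i <;> fin_cases j <;>
        simp [hφζ, hφn, iζ, inn, hζa, hζb, hζn, han, hbn, haζ, hbζ, hnζ, hna, hnb, norm_one _ hζ,
          norm_one _ hnn, ← hp, ← hq, ← hr, ← hs]
    rw [hM] at hdet
    simpa [Matrix.det_succ_row_zero, Fin.sum_univ_succ, Fin.succAbove, sub_eq_add_neg] using hdet
  obtain ⟨α, h1, h2⟩ := exists_polar p q
  have hpq : p ^ 2 + q ^ 2 = 1 := by linear_combination m1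
  rw [hpq, Real.sqrt_one, one_mul] at h1 h2
  have hsp : s = p := by linear_combination p * hd - s * m1 + q * m3
  have hrq : r = -q := by linear_combination -q * hd - r * m1 + p * m3
  refine ⟨α, fun t => ?_⟩
  rw [circ, circ, map_add, map_smul, map_smul, ea, eb, hsp, hrq, Real.cos_add, Real.sin_add,
    ← h1, ← h2]
  module

/-- The values of `f` along the meridian of poles `±ζ` in direction `x`, indexed by height. -/
def meridian (ζ : E4) (f : C(E4, ℝ)) : C((ℝ ∙ ζ)ᗮ, C(Set.Icc (-1 : ℝ) 1, ℝ)) :=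
  ContinuousMap.curry ⟨fun q => f (q.2.1 • ζ + √(1 - q.2.1 ^ 2) • (q.1 : E4)), by fun_prop⟩

theorem meridian_apply (ζ : E4) (f : C(E4, ℝ)) (x : (ℝ ∙ ζ)ᗮ) (t : Set.Icc (-1 : ℝ) 1) :
    meridian ζ f x t = f (t.1 • ζ + √(1 - t.1 ^ 2) • (x : E4)) := rfl

theorem isClosed_sph : IsClosed sph := Metric.isClosed_sphere

theorem exists_continuousMap_eqOn_sph {f : E4 → ℝ} (hf : ContinuousOn f sph) :
    ∃ f' : C(E4, ℝ), ∀ x ∈ sph, f' x = f x := by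
  obtain ⟨f', hf'⟩ := ContinuousMap.exists_restrict_eq isClosed_sph
    ⟨sph.domRestrict f, hf.domRestrict⟩
  exact ⟨f', fun x hx => congrArg (fun k : C(sph, ℝ) => k ⟨x, hx⟩) hf'⟩

/-- Cylindrical coordinates on `S³` with respect to `ζ`. -/
theorem exists_meridian_coordinates {ζ : E4} (hζ : ⟪ζ, ζ⟫ = 1)
    (h3 : 2 < Module.finrank ℝ (ℝ ∙ ζ)ᗮ) {θ : E4} (hθ : ⟪θ, θ⟫ = 1) :
    ∃ (x : (ℝ ∙ ζ)ᗮ) (t : Set.Icc (-1 : ℝ) 1), ⟪x, x⟫ = 1 ∧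
      θ = t.1 • ζ + √(1 - t.1 ^ 2) • (x : E4) := by
  set c := ⟪ζ, θ⟫ with hc
  have hθζ : ⟪θ, ζ⟫ = c := by rw [real_inner_comm]
  set w := θ - c • ζ with hw
  have hζw : ⟪ζ, w⟫ = 0 := by
    rw [hw, inner_sub_right, real_inner_smul_right, hζ, ← hc]; ring
  have hww : ‖w‖ ^ 2 = 1 - c ^ 2 := by
    rw [← real_inner_self_eq_norm_sq]
    simp only [hw, inner_sub_left, inner_sub_right, real_inner_smul_left, real_inner_smul_right,
      hζ, hθ, hθζ, ← hc]
    ring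
  have hcm : c ∈ Set.Icc (-1 : ℝ) 1 := by
    constructor <;> nlinarith [sq_nonneg ‖w‖]
  have hsq : √(1 - c ^ 2) = ‖w‖ := by rw [← hww, Real.sqrt_sq (norm_nonneg _)]
  by_cases hw0 : w = 0
  · obtain ⟨x, hx, -⟩ := exists_unit_orthogonal_pair h3 0 0
    refine ⟨x, ⟨c, hcm⟩, hx, ?_⟩
    simp only
    rw [hsq, hw0, norm_zero, zero_smul, add_zero]
    exact sub_eq_zero.1 hw0
  · have hn : ‖w‖ ≠ 0 := norm_ne_zero_iff.2 hw0
    refine ⟨⟨‖w‖⁻¹ • w, ?_⟩, ⟨c, hcm⟩, ?_, ?_⟩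
    · rw [Submodule.mem_orthogonal_singleton_iff_inner_right, real_inner_smul_right, hζw, mul_zero]
    · rw [Submodule.coe_inner, real_inner_smul_left, real_inner_smul_right,
        real_inner_self_eq_norm_sq]
      field_simp
    · simp only
      rw [hsq, smul_smul, mul_inv_cancel₀ hn, one_smul, hw, add_sub_cancel]

theorem inner_meridian_self {ζ x : E4} (hζ : ⟪ζ, ζ⟫ = 1) (hx : ⟪x, x⟫ = 1) (hζx : ⟪ζ, x⟫ = 0)
    (t : Set.Icc (-1 : ℝ) 1) :
    ⟪t.1 • ζ + √(1 - t.1 ^ 2) • x, t.1 • ζ + √(1 - t.1 ^ 2) • x⟫ = 1 := by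
  have h0 : 0 ≤ 1 - t.1 ^ 2 := by nlinarith [t.2.1, t.2.2]
  rw [OrthoPair.inner_comb ⟨hζ, hx, hζx⟩]
  linear_combination Real.mul_self_sqrt h0

/-- Proposition, hypothesis (a): if continuous `f, g` on `S³` satisfy
`f ∘ φ_w = g` on `S²(w)` for every `w ∈ S²(ζ)`, with rotations `φ_w ∈ SO(3, S²(w))`
fixing `ζ`, then `f = g` on `S³` or `f = g ∘ 𝒪` on `S³`. -/
theorem stmt_0 (ζ : E4) (hζ : ζ ∈ sph) (f g : E4 → ℝ)
    (hf : ContinuousOn f sph) (hg : ContinuousOn g sph)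
    (hrot : ∀ w ∈ S2 ζ, ∃ φ : E4 ≃ₗᵢ[ℝ] E4,
      IsRot w φ ∧ φ ζ = ζ ∧ ∀ θ ∈ S2 w, f (φ θ) = g θ) :
    (∀ θ ∈ sph, f θ = g θ) ∨ (∀ θ ∈ sph, f θ = g (Ocal ζ θ)) := by
  have hζ' := mem_sph_iff.1 hζ
  have hζ0 : ζ ≠ 0 := by
    rintro rfl
    simp at hζ'
  have : Fact (Module.finrank ℝ E4 = 3 + 1) := ⟨by simp⟩
  have h3 : 2 < Module.finrank ℝ (ℝ ∙ ζ)ᗮ := by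
    rw [Submodule.finrank_orthogonal_span_singleton (n := 3) hζ0]
    norm_num
  have hperp : ∀ x : (ℝ ∙ ζ)ᗮ, ⟪ζ, (x : E4)⟫ = 0 := fun x =>
    Submodule.mem_orthogonal_singleton_iff_inner_right.1 x.2
  obtain ⟨f', hf'⟩ := exists_continuousMap_eqOn_sph hf
  obtain ⟨g', hg'⟩ := exists_continuousMap_eqOn_sph hg
  have hmem : ∀ x : (ℝ ∙ ζ)ᗮ, ⟪x, x⟫ = 1 → ∀ t : Set.Icc (-1 : ℝ) 1,
      t.1 • ζ + √(1 - t.1 ^ 2) • (x : E4) ∈ sph := fun x hx t =>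
    mem_sph_iff.2 (inner_meridian_self hζ' hx (hperp x) t)
  have key := eqOn_or_eqOn_neg_of_rotCirc (meridian ζ f').continuous (meridian ζ g').continuous
    (exists_unit_orthogonal_pair h3) (by
      intro a b hab
      obtain ⟨n, hn, han, hbn⟩ := exists_unit_orthogonal_pair h3 a b
      obtain ⟨φ, ⟨hφn, hdet⟩, hφζ, hφ⟩ := hrot n ⟨mem_sph_iff.2 hn, by
        rw [real_inner_comm]; exact hperp n⟩
      obtain ⟨α, hα⟩ := exists_angle_of_det_eq_one (a := a) (b := b) (n := n) hζ'
        ⟨hab, hn, han, hbn⟩ (hperp a) (hperp b) (hperp n) φ hφn hφζ hdet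
      refine ⟨α, fun t => ContinuousMap.ext fun τ => ?_⟩
      have hcoe : ∀ t, ((circ a b t : (ℝ ∙ ζ)ᗮ) : E4) = circ (a : E4) (b : E4) t := by
        intro t
        simp [circ]
      have hs := hmem _ (hab.inner_circ_self t) τ
      simp only [meridian_apply]
      rw [hf' _ (hmem _ (hab.inner_circ_self _) τ), hg' _ hs, ← hφ _ ⟨hs, ?_⟩]
      · rw [map_add, map_smul, map_smul, hφζ, hcoe, hcoe, hα]
      · have h1 : ⟪(a : E4), (n : E4)⟫ = 0 := han
        have h2 : ⟪(b : E4), (n : E4)⟫ = 0 := hbn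
        rw [hcoe, circ]
        simp only [inner_add_left, real_inner_smul_left, hperp n, h1, h2]
        ring)
  refine key.imp (fun h θ hθ => ?_) fun h θ hθ => ?_
  all_goals
    obtain ⟨x, t, hx, rfl⟩ := exists_meridian_coordinates hζ' h3 (mem_sph_iff.1 hθ)
    have e := congrArg (fun k : C(Set.Icc (-1 : ℝ) 1, ℝ) => k t) (h x hx)
    simp only [meridian_apply] at e
    rw [hf' _ hθ] at e
  · rwa [hg' _ hθ] at e
  · rw [hg' _ (hmem (-x) (by rw [inner_neg_neg, hx]) t)] at e
    rw [e]
    congr 1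
    rw [Ocal, inner_add_left, real_inner_smul_left, real_inner_smul_left, hζ',
      real_inner_comm, hperp x, Submodule.coe_neg]
    module
end
end

section
/- Let f and g be continuous real-valued functions on S³ and let ζ ∈ S³. Assume that for every w ∈ S²(ζ) there exists a rotation φ_w ∈ SO(3, S²(w)) with φ_w(ζ) = ζ or φ_w(ζ) = −ζ, such that f(φ_w(θ)) = g(θ) for all θ ∈ S²(w). Assume in addition that for every w ∈ S²(ζ), neither f nor g has a (ζ, π)-rotational symmetry on S²(w), nor a (u, π)-rotational symmetry on S²(w) for any u ∈ S²(ζ) ∩ S²(w). Then either f = g on S³, or f(θ) = g(𝒪θ) for all θ ∈ S³. -/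
noncomputable section

open scoped RealInnerProductSpace

/-- The function `f` has a `(u, π)`-rotational symmetry on `S²(ξ)`:
`f ∘ φ = f` on `S²(ξ)` for the rotation `φ ∈ SO(3, S²(ξ))` by the angle `π` about `u`. -/
def HasPiRotSym (f : E4 → ℝ) (ξ u : E4) : Prop :=
  ∃ φ : E4 ≃ₗᵢ[ℝ] E4, IsRotAngleAbout ξ u 1 φ ∧ ∀ θ ∈ S2 ξ, f (φ θ) = f θ

open scoped Matrix
open Set Filter Topology

/-- Coordinate space for the orthogonal complement of `ζ`. -/
abbrev V3 := Fin 3 → ℝ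

/-- The Euclidean unit sphere of `V3`. -/
def unitSph : Set V3 := {v | v ⬝ᵥ v = 1}

/-- Rotation by the angle `α` in the oriented plane orthogonal to the unit vector `w`. -/
def rotAbout (w : V3) (α : ℝ) (v : V3) : V3 := Real.cos α • v + Real.sin α • (w ⨯₃ v)

/-- Rotation by the angle `π` about the unit vector `u`. -/
def axialFlip (u v : V3) : V3 := (2 * (v ⬝ᵥ u)) • u - v

lemma dot3 (a b : V3) : a ⬝ᵥ b = a 0 * b 0 + a 1 * b 1 + a 2 * b 2 := by
  simp [dotProduct, Fin.sum_univ_three]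

lemma cross3 (a b : V3) :
    a ⨯₃ b = ![a 1 * b 2 - a 2 * b 1, a 2 * b 0 - a 0 * b 2, a 0 * b 1 - a 1 * b 0] :=
  cross_apply a b

lemma cross_cross_of_orthogonal {w v : V3} (hw : w ∈ unitSph) (hv : v ⬝ᵥ w = 0) :
    w ⨯₃ (w ⨯₃ v) = -v := by
  have h : w ⨯₃ (w ⨯₃ v) = (w ⬝ᵥ v) • w - (w ⬝ᵥ w) • v := by
    ext i; fin_cases i <;> simp [dot3, cross3] <;> ring
  rw [h, dotProduct_comm w v, hv, show w ⬝ᵥ w = 1 from hw]; simp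

lemma cross_dot_left (w v : V3) : (w ⨯₃ v) ⬝ᵥ w = 0 := by
  rw [dotProduct_comm]; exact dot_self_cross w v

lemma cross_dot_right (w v : V3) : (w ⨯₃ v) ⬝ᵥ v = 0 := by
  rw [dotProduct_comm]; exact dot_cross_self w v

lemma cross_dot_cross_of_orthogonal {w u v : V3} (hw : w ∈ unitSph) (hv : v ⬝ᵥ w = 0) :
    (w ⨯₃ u) ⬝ᵥ (w ⨯₃ v) = u ⬝ᵥ v := by
  rw [cross_dot_cross, show w ⬝ᵥ w = 1 from hw, dotProduct_comm w v, hv]; ring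

lemma exists_cross_eq {w v : V3} (hw : w ∈ unitSph) (hv : v ⬝ᵥ w = 0) : ∃ y, w ⨯₃ y = v :=
  ⟨-(w ⨯₃ v), by rw [map_neg, cross_cross_of_orthogonal hw hv, neg_neg]⟩

lemma rotAbout_zero (w v : V3) : rotAbout w 0 v = v := by simp [rotAbout]

lemma rotAbout_pi (w v : V3) : rotAbout w Real.pi v = -v := by simp [rotAbout]

lemma rotAbout_smul (w : V3) (α c : ℝ) (v : V3) :
    rotAbout w α (c • v) = c • rotAbout w α v := by
  simp only [rotAbout, map_smul, smul_add, smul_comm c]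

lemma rotAbout_neg (w : V3) (α : ℝ) (v : V3) : rotAbout w α (-v) = -rotAbout w α v := by
  simp only [rotAbout, map_neg]; module

lemma rotAbout_dot {w v : V3} (α : ℝ) (hv : v ⬝ᵥ w = 0) : rotAbout w α v ⬝ᵥ w = 0 := by
  simp only [rotAbout, add_dotProduct, smul_dotProduct, hv, cross_dot_left, smul_zero, add_zero]

lemma rotAbout_rotAbout {w v : V3} (hw : w ∈ unitSph) (hv : v ⬝ᵥ w = 0) (α β : ℝ) :
    rotAbout w α (rotAbout w β v) = rotAbout w (α + β) v := by
  simp only [rotAbout, map_add, map_smul, cross_cross_of_orthogonal hw hv, Real.cos_add,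
    Real.sin_add]
  module

lemma rotAbout_add_int_mul (w v : V3) (α : ℝ) (n : ℤ) :
    rotAbout w (α + n * (2 * Real.pi)) v = rotAbout w α v := by
  simp [rotAbout]

lemma rotAbout_mem {w u : V3} (hw : w ∈ unitSph) (hu : u ∈ unitSph) (huw : u ⬝ᵥ w = 0) (α : ℝ) :
    rotAbout w α u ∈ unitSph := by
  have h1 := cross_dot_cross_of_orthogonal (u := u) hw huw
  have h2 := cross_dot_right w u
  have h3 := dot_cross_self w u
  change _ = _ at hu ⊢
  simp only [rotAbout, add_dotProduct, dotProduct_add, smul_dotProduct, dotProduct_smul, h1, h2,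
    h3, hu, smul_eq_mul]
  linear_combination Real.cos_sq_add_sin_sq α

lemma axialFlip_rotAbout {w u : V3} (hw : w ∈ unitSph) (hu : u ∈ unitSph) (huw : u ⬝ᵥ w = 0)
    (ρ β θ : ℝ) :
    axialFlip (rotAbout w β u) (ρ • rotAbout w θ u) = ρ • rotAbout w (2 * β - θ) u := by
  have h1 := cross_dot_cross_of_orthogonal (u := u) hw huw
  have h2 := cross_dot_right w u
  have h3 := dot_cross_self w u
  have hu' : u ⬝ᵥ u = 1 := hu
  simp only [axialFlip, rotAbout, add_dotProduct, dotProduct_add, smul_dotProduct,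
    dotProduct_smul, h1, h2, h3, hu', smul_eq_mul, Real.cos_sub, Real.sin_sub, Real.cos_two_mul,
    Real.sin_two_mul]
  have hc := Real.sin_sq β
  match_scalars
  · linear_combination 0 * hc
  · linear_combination (2 * ρ * Real.sin θ) * hc

lemma exists_angle {a b : ℝ} (h : a ^ 2 + b ^ 2 = 1) :
    ∃ θ : ℝ, a = Real.cos θ ∧ b = Real.sin θ := by
  have hn : ‖(⟨a, b⟩ : ℂ)‖ = 1 := by
    rw [Complex.norm_def, Complex.normSq_apply]; simp [← sq, h]
  have := Complex.norm_mul_cos_arg ⟨a, b⟩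
  have h2 := Complex.norm_mul_sin_arg ⟨a, b⟩
  rw [hn] at this h2
  exact ⟨Complex.arg ⟨a, b⟩, by simpa using this.symm, by simpa using h2.symm⟩

lemma exists_polar_s1 (a b : ℝ) : ∃ ρ θ : ℝ, a = ρ * Real.cos θ ∧ b = ρ * Real.sin θ := by
  have := Complex.norm_mul_cos_arg ⟨a, b⟩
  have h2 := Complex.norm_mul_sin_arg ⟨a, b⟩
  exact ⟨_, _, this.symm, h2.symm⟩

/-- Expansion in the orthonormal basis `w, u, w × u`. -/
lemma eq_frame {w u : V3} (hw : w ∈ unitSph) (hu : u ∈ unitSph) (huw : u ⬝ᵥ w = 0) (v : V3) :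
    v = (v ⬝ᵥ w) • w + (v ⬝ᵥ u) • u + (v ⬝ᵥ (w ⨯₃ u)) • (w ⨯₃ u) := by
  have hw' : w ⬝ᵥ w = 1 := hw
  have hu' : u ⬝ᵥ u = 1 := hu
  have key : ∀ a : V3, a ⬝ᵥ w = 0 → a ⬝ᵥ u = 0 → a ⬝ᵥ (w ⨯₃ u) = 0 → a = 0 := by
    intro a h1 h2 h3
    have e : (a ⬝ᵥ a) = (a ⬝ᵥ w)^2 + (a ⬝ᵥ u)^2 + (a ⬝ᵥ (w ⨯₃ u))^2 := by
      have : (a ⬝ᵥ (w ⨯₃ u))^2 =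
        (a ⬝ᵥ a) * ((w ⬝ᵥ w) * (u ⬝ᵥ u) - (u ⬝ᵥ w)^2)
        - (a ⬝ᵥ w) * ((a ⬝ᵥ w) * (u ⬝ᵥ u) - (a ⬝ᵥ u) * (u ⬝ᵥ w))
        + (a ⬝ᵥ u) * ((a ⬝ᵥ w) * (u ⬝ᵥ w) - (a ⬝ᵥ u) * (w ⬝ᵥ w)) := by
        simp only [dot3, cross3]; simp; ring
      rw [this, hw', hu', huw]; ring
    rw [h1, h2, h3] at e
    exact dotProduct_self_eq_zero.mp (by simpa using e)
  rw [← sub_eq_zero]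
  have h1 := cross_dot_cross_of_orthogonal (u := u) hw huw
  have h2 := cross_dot_right w u
  have h3 := cross_dot_left w u
  have h4 := dot_cross_self w u
  have h5 := dot_self_cross w u
  have h6 : w ⬝ᵥ u = 0 := by rw [dotProduct_comm]; exact huw
  apply key <;>
    simp [sub_dotProduct, add_dotProduct, hw', hu', huw, h1, h2, h3, h4, h5, h6]

lemma exists_polar_frame {w u v : V3} (hw : w ∈ unitSph) (hu : u ∈ unitSph) (huw : u ⬝ᵥ w = 0)
    (hv : v ⬝ᵥ w = 0) : ∃ ρ θ : ℝ, v = ρ • rotAbout w θ u := by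
  obtain ⟨ρ, θ, h1, h2⟩ := exists_polar_s1 (v ⬝ᵥ u) (v ⬝ᵥ (w ⨯₃ u))
  refine ⟨ρ, θ, ?_⟩
  conv_lhs => rw [eq_frame hw hu huw v, hv, h1, h2]
  simp only [rotAbout]; module

lemma exists_unit_frame {w u v : V3} (hw : w ∈ unitSph) (hu : u ∈ unitSph) (huw : u ⬝ᵥ w = 0)
    (hv : v ∈ unitSph) (hvw : v ⬝ᵥ w = 0) : ∃ θ : ℝ, v = rotAbout w θ u := by
  have h0 := eq_frame hw hu huw v
  have h1 : (v ⬝ᵥ u) ^ 2 + (v ⬝ᵥ (w ⨯₃ u)) ^ 2 = 1 := by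
    have hv' : v ⬝ᵥ v = 1 := hv
    rw [← hv']; nth_rw 4 [h0]
    simp [dotProduct_add, hvw]; ring
  obtain ⟨θ, h1, h2⟩ := exists_angle h1
  refine ⟨θ, ?_⟩
  conv_lhs => rw [h0, hvw, h1, h2]
  simp [rotAbout]

lemma exists_unit_smul (v : V3) (hv : v ≠ 0) : ∃ c : ℝ, ∃ u ∈ unitSph, v = c • u := by
  have h : 0 < v ⬝ᵥ v := by
    have h0 : v ⬝ᵥ v ≠ 0 := fun e => hv (dotProduct_self_eq_zero.mp e)
    refine lt_of_le_of_ne ?_ h0.symm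
    rw [dot3]; nlinarith [mul_self_nonneg (v 0), mul_self_nonneg (v 1), mul_self_nonneg (v 2)]
  refine ⟨√(v ⬝ᵥ v), (√(v ⬝ᵥ v))⁻¹ • v, ?_, ?_⟩
  · change _ = _
    have := Real.mul_self_sqrt h.le
    simp only [smul_dotProduct, dotProduct_smul, smul_eq_mul]
    nth_rw 3 [← this]
    field_simp
  · rw [smul_smul, mul_inv_cancel₀ (Real.sqrt_pos.mpr h).ne', one_smul]

lemma exists_unit_orthogonal (w : V3) : ∃ u ∈ unitSph, u ⬝ᵥ w = 0 := by
  by_cases h : w 0 = 0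
  · exact ⟨![1, 0, 0], by simp [unitSph], by rw [dot3]; simp [h]⟩
  · have : (![-w 1, w 0, 0] : V3) ≠ 0 := fun e => h (by simpa using congrFun e 1)
    obtain ⟨c, u, hu, e⟩ := exists_unit_smul _ this
    refine ⟨u, hu, ?_⟩
    have hc : c ≠ 0 := by rintro rfl; exact this (by simpa using e)
    have h2 : (c • u) ⬝ᵥ w = 0 := by rw [← e, dot3]; simp; ring
    simpa [hc] using h2

lemma continuous_rotAbout {X : Type*} [TopologicalSpace X] {w v : X → V3} {α : X → ℝ}
    (hw : Continuous w) (hα : Continuous α) (hv : Continuous v) :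
    Continuous fun x => rotAbout (w x) (α x) (v x) := by
  unfold rotAbout
  simp only [cross3]
  fun_prop

lemma continuous_cross {X : Type*} [TopologicalSpace X] {w v : X → V3}
    (hw : Continuous w) (hv : Continuous v) : Continuous fun x => w x ⨯₃ v x := by
  simp only [cross3]
  fun_prop

lemma continuous_axialFlip {X : Type*} [TopologicalSpace X] {u v : X → V3}
    (hu : Continuous u) (hv : Continuous v) : Continuous fun x => axialFlip (u x) (v x) := by
  unfold axialFlip; simp only [dot3]
  fun_prop

lemma isCompact_unitSph : IsCompact unitSph := by
  refine Metric.isCompact_of_isClosed_isBounded ?_ ?_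
  · exact isClosed_eq (by simp only [dot3]; fun_prop) continuous_const
  · refine (Metric.isBounded_closedBall (x := (0 : V3)) (r := 1)).subset fun v hv => ?_
    have hv' : v ⬝ᵥ v = 1 := hv
    rw [dot3] at hv'
    rw [mem_closedBall_zero_iff, pi_norm_le_iff_of_nonneg zero_le_one]
    intro i
    rw [Real.norm_eq_abs, abs_le_one_iff_mul_self_le_one]
    fin_cases i <;> simp <;> nlinarith [mul_self_nonneg (v 0), mul_self_nonneg (v 1),
      mul_self_nonneg (v 2)]

instance : CompactSpace unitSph := isCompact_iff_compactSpace.mp isCompact_unitSph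

lemma isPreconnected_unitSph : IsPreconnected unitSph := by
  have h : IsPreconnected (Metric.sphere (0 : EuclideanSpace ℝ (Fin 3)) 1) :=
    isPreconnected_sphere (by rw [← Module.finrank_eq_rank]; simp) 0 1
  have := h.image _ (PiLp.continuous_ofLp 2 (fun _ : Fin 3 => ℝ)).continuousOn
  convert this using 1
  ext v
  constructor
  · intro hv
    refine ⟨WithLp.toLp 2 v, ?_, rfl⟩
    have hv' : v ⬝ᵥ v = 1 := hv
    rw [dot3] at hv'
    simp [EuclideanSpace.norm_eq, Fin.sum_univ_three, sq, hv']
  · rintro ⟨x, hx, rfl⟩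
    change _ = _
    rw [dot3]
    simpa [EuclideanSpace.norm_eq, Fin.sum_univ_three, sq] using hx

instance : PreconnectedSpace unitSph :=
  isPreconnected_iff_preconnectedSpace.mp isPreconnected_unitSph

variable {T : Type*}

/-- On the plane `w^⊥` the family `F`, precomposed with the rotation by `α`, equals `G`. -/
def RotRel (F G : T → V3 → ℝ) (w : V3) (α : ℝ) : Prop :=
  ∀ t v, v ⬝ᵥ w = 0 → F t (rotAbout w α v) = G t v

/-- On the plane `w^⊥` the family `F`, precomposed with the flip about `u`, equals `G`. -/
def FlipRel (F G : T → V3 → ℝ) (w u : V3) : Prop :=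
  ∀ t v, v ⬝ᵥ w = 0 → F t (axialFlip u v) = G t v

lemma forall_orthogonal_iff {w : V3} (hw : w ∈ unitSph) {P : V3 → Prop} :
    (∀ v, v ⬝ᵥ w = 0 → P v) ↔ ∀ y, P (w ⨯₃ y) := by
  refine ⟨fun h y => h _ (cross_dot_left w y), fun h v hv => ?_⟩
  obtain ⟨y, rfl⟩ := exists_cross_eq hw hv
  exact h y

lemma isClosed_rotRel {F G : T → V3 → ℝ} (hF : ∀ t, Continuous (F t))
    (hG : ∀ t, Continuous (G t)) :
    IsClosed {q : unitSph × ℝ | RotRel F G q.1 q.2} := by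
  have : {q : unitSph × ℝ | RotRel F G q.1 q.2} =
      ⋂ t, ⋂ y, {q | F t (rotAbout q.1 q.2 (q.1.1 ⨯₃ y)) = G t (q.1.1 ⨯₃ y)} := by
    ext q
    simp only [RotRel, mem_ofPred_eq, mem_iInter]
    exact forall_congr' fun t => forall_orthogonal_iff q.1.2
  rw [this]
  refine isClosed_iInter fun t => isClosed_iInter fun y => isClosed_eq ?_ ?_
  · exact (hF t).comp (continuous_rotAbout (by fun_prop) (by fun_prop)
      (continuous_cross (by fun_prop) (by fun_prop)))
  · exact (hG t).comp (continuous_cross (by fun_prop) (by fun_prop))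

lemma isClosed_flipRel {F G : T → V3 → ℝ} (hF : ∀ t, Continuous (F t))
    (hG : ∀ t, Continuous (G t)) :
    IsClosed {q : unitSph × V3 | FlipRel F G q.1 q.2} := by
  have : {q : unitSph × V3 | FlipRel F G q.1 q.2} =
      ⋂ t, ⋂ y, {q | F t (axialFlip q.2 (q.1.1 ⨯₃ y)) = G t (q.1.1 ⨯₃ y)} := by
    ext q
    simp only [FlipRel, mem_ofPred_eq, mem_iInter]
    exact forall_congr' fun t => forall_orthogonal_iff q.1.2
  rw [this]
  refine isClosed_iInter fun t => isClosed_iInter fun y => isClosed_eq ?_ ?_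
  · exact (hF t).comp (continuous_axialFlip (by fun_prop)
      (continuous_cross (by fun_prop) (by fun_prop)))
  · exact (hG t).comp (continuous_cross (by fun_prop) (by fun_prop))

lemma RotRel.add_int {F G : T → V3 → ℝ} {w : V3} {α : ℝ} (h : RotRel F G w α) (n : ℤ) :
    RotRel F G w (α + n * (2 * Real.pi)) := fun t v hv => by
  rw [rotAbout_add_int_mul]; exact h t v hv

lemma RotRel.neg {F : T → V3 → ℝ} {w : V3} (hw : w ∈ unitSph) {α : ℝ} (h : RotRel F F w α) :
    RotRel F F w (-α) := fun t v hv => by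
  have := h t _ (rotAbout_dot (-α) hv)
  rwa [rotAbout_rotAbout hw hv, add_neg_cancel, rotAbout_zero, eq_comm] at this

lemma RotRel.add {F : T → V3 → ℝ} {w : V3} (hw : w ∈ unitSph) {α β : ℝ}
    (h : RotRel F F w α) (h' : RotRel F F w β) : RotRel F F w (α + β) := fun t v hv => by
  rw [← rotAbout_rotAbout hw hv, h t _ (rotAbout_dot β hv), h' t v hv]

lemma RotRel.zero {F : T → V3 → ℝ} {w : V3} : RotRel F F w 0 := fun t v _ => by
  rw [rotAbout_zero]

/-- The angles of rotational symmetry form a subgroup of `ℝ`. -/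
def rotSymm (F : T → V3 → ℝ) {w : V3} (hw : w ∈ unitSph) : AddSubgroup ℝ where
  carrier := {α | RotRel F F w α}
  zero_mem' := RotRel.zero
  add_mem' h h' := h.add hw h'
  neg_mem' h := h.neg hw

lemma mem_rotSymm {F : T → V3 → ℝ} {w : V3} {hw : w ∈ unitSph} {α : ℝ} :
    α ∈ rotSymm F hw ↔ RotRel F F w α := Iff.rfl

lemma two_pi_mem_rotSymm (F : T → V3 → ℝ) {w : V3} (hw : w ∈ unitSph) :
    2 * Real.pi ∈ rotSymm F hw := by
  have := (RotRel.zero (F := F) (w := w)).add_int 1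
  simpa [mem_rotSymm] using this

lemma isClosed_rotSymm {F : T → V3 → ℝ} (hF : ∀ t, Continuous (F t)) {w : V3}
    (hw : w ∈ unitSph) : IsClosed (rotSymm F hw : Set ℝ) :=
  (isClosed_rotRel hF hF).preimage (f := fun α : ℝ => ((⟨w, hw⟩ : unitSph), α)) (by fun_prop)

/-- An odd function whose square is invariant under an irrational rotation of `w^⊥`
vanishes on `w^⊥`. -/
lemma odd_eq_zero_of_irrational {a : T → V3 → ℝ} (ha : ∀ t, Continuous (a t))
    (hodd : ∀ t v, a t (-v) = -a t v) {w : V3} (hw : w ∈ unitSph) {β : ℝ}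
    (hβ : Irrational (β / Real.pi)) (h : RotRel (fun t v => a t v ^ 2) (fun t v => a t v ^ 2) w β)
    (t : T) (v : V3) (hv : v ⬝ᵥ w = 0) : a t v = 0 := by
  have hp : ∀ t, Continuous fun v => a t v ^ 2 := fun t => (ha t).pow 2
  have hirr : Irrational (β / (2 * Real.pi)) := by
    have : β / (2 * Real.pi) = β / Real.pi / (2 : ℕ) := by push_cast; field_simp
    rw [this]; exact hβ.div_natCast two_ne_zero
  have hd := dense_addSubgroupClosure_pair_iff.mpr hirr
  have hle : AddSubgroup.closure {β, 2 * Real.pi} ≤ rotSymm (fun t v => a t v ^ 2) hw := by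
    rw [AddSubgroup.closure_le]
    rintro x (rfl | rfl)
    · exact h
    · exact two_pi_mem_rotSymm _ hw
  have htop : ∀ α, RotRel (fun t v => a t v ^ 2) (fun t v => a t v ^ 2) w α := by
    have := closure_minimal (s := (AddSubgroup.closure {β, 2 * Real.pi} : Set ℝ))
      (fun x hx => hle hx) (isClosed_rotSymm hp hw)
    rw [hd.closure_eq] at this
    exact fun α => this (mem_univ α)
  obtain ⟨θ, hθ⟩ : (0 : ℝ) ∈ range fun θ => a t (rotAbout w θ v) := by
    have hc : Continuous fun θ => a t (rotAbout w θ v) :=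
      (ha t).comp (continuous_rotAbout continuous_const continuous_id continuous_const)
    refine mem_range_of_exists_le_of_exists_ge hc ?_ ?_
    · rcases le_total (a t v) 0 with h0 | h0
      · exact ⟨0, by simpa [rotAbout_zero] using h0⟩
      · exact ⟨Real.pi, by simpa [rotAbout_pi, hodd] using h0⟩
    · rcases le_total (a t v) 0 with h0 | h0
      · exact ⟨Real.pi, by simpa [rotAbout_pi, hodd] using h0⟩
      · exact ⟨0, by simpa [rotAbout_zero] using h0⟩
  have := htop θ t v hv
  simp only at this hθ
  rw [hθ] at this
  simpa using this.symm

lemma rotAbout_cross_smul {x y : V3} {α : ℝ} (hx : x ∈ unitSph) (hxy : x ⬝ᵥ y = Real.cos α)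
    (hα : Real.sin α ≠ 0) : rotAbout ((Real.sin α)⁻¹ • (x ⨯₃ y)) α x = y := by
  have h : (x ⨯₃ y) ⨯₃ x = (x ⬝ᵥ x) • y - (x ⬝ᵥ y) • x := by
    ext i; fin_cases i <;> simp only [dot3, cross3] <;> simp <;> ring
  rw [rotAbout, map_smul, LinearMap.smul_apply, h, hxy, show x ⬝ᵥ x = 1 from hx, smul_smul,
    mul_inv_cancel₀ hα]
  module

lemma cross_smul_mem {x y : V3} {α : ℝ} (hx : x ∈ unitSph) (hy : y ∈ unitSph)
    (hxy : x ⬝ᵥ y = Real.cos α) (hα : Real.sin α ≠ 0) :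
    (Real.sin α)⁻¹ • (x ⨯₃ y) ∈ unitSph := by
  change _ = _
  rw [smul_dotProduct, dotProduct_smul, cross_dot_cross, show x ⬝ᵥ x = 1 from hx,
    show y ⬝ᵥ y = 1 from hy, dotProduct_comm y x, hxy]
  simp only [smul_eq_mul]
  field_simp
  linear_combination -Real.sin_sq_add_cos_sq α

lemma eq_of_rotRel_cross {p : T → V3 → ℝ} {x y : V3} {α : ℝ} (hx : x ∈ unitSph)
    (hxy : x ⬝ᵥ y = Real.cos α) (hα : Real.sin α ≠ 0)
    (h : RotRel p p ((Real.sin α)⁻¹ • (x ⨯₃ y)) α) (t : T) (c : ℝ) : p t (c • y) = p t (c • x) := by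
  have := h t (c • x) (by rw [smul_dotProduct, dotProduct_smul, dot_self_cross]; simp)
  rwa [rotAbout_smul, rotAbout_cross_smul hx hxy hα] at this

/-- The vector with coordinates `x`, `y`, `z` in the frame `u`, `w × u`, `w`. -/
def frameVec (w u : V3) (x y z : ℝ) : V3 := x • u + y • (w ⨯₃ u) + z • w

lemma frameVec_dot {w u : V3} (hw : w ∈ unitSph) (hu : u ∈ unitSph) (huw : u ⬝ᵥ w = 0)
    (x y z x' y' z' : ℝ) :
    frameVec w u x y z ⬝ᵥ frameVec w u x' y' z' = x * x' + y * y' + z * z' := by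
  have h1 := cross_dot_cross_of_orthogonal (u := u) hw huw
  have h2 := cross_dot_right w u
  have h3 := cross_dot_left w u
  have h4 := dot_cross_self w u
  have h5 := dot_self_cross w u
  have h6 : w ⬝ᵥ u = 0 := by rw [dotProduct_comm]; exact huw
  have hw' : w ⬝ᵥ w = 1 := hw
  have hu' : u ⬝ᵥ u = 1 := hu
  simp only [frameVec, add_dotProduct, dotProduct_add, smul_dotProduct, dotProduct_smul, h1, h2,
    h3, h4, h5, h6, hw', hu', huw, smul_eq_mul]
  ring

lemma cross_cross_right {w u : V3} (hu : u ∈ unitSph) (huw : u ⬝ᵥ w = 0) :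
    u ⨯₃ (w ⨯₃ u) = w := by
  have h : u ⨯₃ (w ⨯₃ u) = (u ⬝ᵥ u) • w - (u ⬝ᵥ w) • u := by
    ext i; fin_cases i <;> simp only [dot3, cross3] <;> simp <;> ring
  rw [h, huw, show u ⬝ᵥ u = 1 from hu]; simp

lemma frameVec_cross {w u : V3} (hw : w ∈ unitSph) (hu : u ∈ unitSph) (huw : u ⬝ᵥ w = 0)
    (x y z x' y' z' : ℝ) :
    frameVec w u x y z ⨯₃ frameVec w u x' y' z' =
      frameVec w u (y * z' - z * y') (z * x' - x * z') (x * y' - y * x') := by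
  have h1 := cross_cross_right hu huw
  have h2 : (w ⨯₃ u) ⨯₃ u = -w := by rw [← cross_anticomm, h1]
  have h3 : u ⨯₃ w = -(w ⨯₃ u) := by rw [← cross_anticomm]
  have h4 := cross_cross_of_orthogonal hw huw
  have h5 : (w ⨯₃ u) ⨯₃ w = u := by rw [← cross_anticomm, h4, neg_neg]
  simp only [frameVec, map_add, map_smul, LinearMap.add_apply, LinearMap.smul_apply, h1, h2, h3,
    h4, h5, cross_self]
  module

lemma continuous_frameVec {X : Type*} [TopologicalSpace X] {w u : X → V3} {x y z : X → ℝ}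
    (hw : Continuous w) (hu : Continuous u) (hx : Continuous x) (hy : Continuous y)
    (hz : Continuous z) : Continuous fun a => frameVec (w a) (u a) (x a) (y a) (z a) := by
  unfold frameVec
  have := continuous_cross hw hu
  fun_prop

/-- For vertices `X`, `Y` depending continuously on parameters, whose normalized cross product is
`w₀` at the base parameter, a property valid near `w₀` holds for the normalized cross product at
nearby parameters, uniformly on a compact set. -/
lemma eventually_normal {K : Set V3} (hK : IsCompact K) {q : ℝ → ℝ} {h₀ s : ℝ} {w₀ : V3}
    (hq : ContinuousAt q h₀) (hq1 : q h₀ = 1) (hs : s ≠ 0) {P : V3 → Prop}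
    (hP : ∀ᶠ w in 𝓝 w₀, P w) {X Y : ℝ × ℝ × V3 → V3} (hX : Continuous X) (hY : Continuous Y)
    (hXY : ∀ u ∈ K, X (h₀, 1, u) ⨯₃ Y (h₀, 1, u) = s • w₀) :
    ∀ᶠ h in 𝓝 h₀, ∀ u ∈ K, P (s⁻¹ • (X (h, q h, u) ⨯₃ Y (h, q h, u))) := by
  refine hK.eventually_forall_of_forall_eventually fun u hu => ?_
  have hc' : ContinuousAt (fun z : ℝ × V3 => (z.1, q z.1, z.2)) (h₀, u) :=
    continuousAt_fst.prodMk ((ContinuousAt.comp (f := Prod.fst) (g := q) hq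
      continuousAt_fst).prodMk continuousAt_snd)
  have hc : Continuous fun z => X z ⨯₃ Y z := continuous_cross hX hY
  have hc'' : Tendsto (fun z : ℝ × V3 => s⁻¹ • (X (z.1, q z.1, z.2) ⨯₃ Y (z.1, q z.1, z.2)))
      (𝓝 (h₀, u)) (𝓝 (s⁻¹ • (X (h₀, q h₀, u) ⨯₃ Y (h₀, q h₀, u)))) :=
    ((hc.tendsto _).comp hc').const_smul _
  rw [hq1, hXY u hu, smul_smul, inv_mul_cancel₀ hs, one_smul] at hc''
  exact hc''.eventually hP

/-- If the square of an odd function is invariant under the rotation by a fixed angle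
`α ∈ (0, π)` of `w^⊥` for all `w` near `w₀`, then the function vanishes on `w₀^⊥`. -/
lemma odd_eq_zero_of_eventually {a : T → V3 → ℝ} (ha : ∀ t, Continuous (a t))
    (hodd : ∀ t v, a t (-v) = -a t v) {w₀ : V3} (hw₀ : w₀ ∈ unitSph) {α : ℝ}
    (hα : α ∈ Ioo 0 Real.pi)
    (h : ∀ᶠ w in 𝓝 w₀, w ∈ unitSph →
      RotRel (fun t v => a t v ^ 2) (fun t v => a t v ^ 2) w α)
    (t : T) (v : V3) (hv : v ⬝ᵥ w₀ = 0) : a t v = 0 := by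
  set p : T → V3 → ℝ := fun t v => a t v ^ 2 with hp
  have hsα : Real.sin α ≠ 0 := (Real.sin_pos_of_mem_Ioo hα).ne'
  set C := Real.cos (α / 2) with hC
  set S := Real.sin (α / 2) with hS
  have hS0 : 0 < S := Real.sin_pos_of_mem_Ioo ⟨by linarith [hα.1], by linarith [hα.1, hα.2]⟩
  have hCS : C ^ 2 + S ^ 2 = 1 := Real.cos_sq_add_sin_sq _
  have hcα : Real.cos α = C ^ 2 - S ^ 2 := by
    rw [hC, hS, ← Real.cos_two_mul']; ring_nf
  have hsα2 : Real.sin α = 2 * S * C := by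
    rw [hC, hS, ← Real.sin_two_mul]; ring_nf
  set q : ℝ → ℝ := fun h => (C * Real.cos h - Real.cos α) / (S * Real.sin h) with hq
  have hq1 : q (α / 2) = 1 := by
    simp only [hq, ← hC, ← hS, hcα]; field_simp; ring
  have hqc : ContinuousAt q (α / 2) := by
    refine ContinuousAt.div (by fun_prop) (by fun_prop) ?_
    rw [← hS]; positivity
  set K : Set V3 := unitSph ∩ {u | u ⬝ᵥ w₀ = 0} with hK
  have hKc : IsCompact K := isCompact_unitSph.inter_right
    (isClosed_eq (by simp only [dot3]; fun_prop) continuous_const)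
  -- the four vertices of the zigzag, in the frame `u`, `w₀ × u`, `w₀`
  let A0 : ℝ × ℝ × V3 → V3 := fun z => frameVec w₀ z.2.2 (Real.cos z.1) (-Real.sin z.1) 0
  let A1 : ℝ × ℝ × V3 → V3 := fun z => frameVec w₀ z.2.2 C (S * z.2.1) (S * √(1 - z.2.1 ^ 2))
  let A2 : ℝ × ℝ × V3 → V3 := fun z =>
    frameVec w₀ z.2.2 C (-(S * z.2.1)) (-(S * √(1 - z.2.1 ^ 2)))
  let A3 : ℝ × ℝ × V3 → V3 := fun z => frameVec w₀ z.2.2 (Real.cos z.1) (Real.sin z.1) 0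
  have hA0 : Continuous A0 := continuous_frameVec (by fun_prop) (by fun_prop) (by fun_prop)
    (by fun_prop) (by fun_prop)
  have hA1 : Continuous A1 := continuous_frameVec (by fun_prop) (by fun_prop) (by fun_prop)
    (by fun_prop) (by fun_prop)
  have hA2 : Continuous A2 := continuous_frameVec (by fun_prop) (by fun_prop) (by fun_prop)
    (by fun_prop) (by fun_prop)
  have hA3 : Continuous A3 := continuous_frameVec (by fun_prop) (by fun_prop) (by fun_prop)
    (by fun_prop) (by fun_prop)
  have key := fun X Y hX hY => eventually_normal hKc hqc hq1 hsα h (X := X) (Y := Y) hX hY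
  have e01 := key A0 A1 hA0 hA1 fun u hu => by
    simp only [A0, A1]
    rw [frameVec_cross hw₀ hu.1 hu.2]
    simp [frameVec, ← hC, ← hS, hsα2]; congr 1; ring
  have e21 := key A2 A1 hA2 hA1 fun u hu => by
    simp only [A2, A1]
    rw [frameVec_cross hw₀ hu.1 hu.2]
    simp [frameVec, hsα2]; congr 1; ring
  have e23 := key A2 A3 hA2 hA3 fun u hu => by
    simp only [A2, A3]
    rw [frameVec_cross hw₀ hu.1 hu.2]
    simp [frameVec, ← hC, ← hS, hsα2]; congr 1; ring
  have eq1 : ∀ᶠ h in 𝓝 (α / 2), -1 < q h :=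
    hqc.eventually (lt_mem_nhds (by rw [hq1]; norm_num))
  have hlt : ∀ᶠ h in 𝓝 (α / 2), h < Real.pi - α / 2 := gt_mem_nhds (by linarith [hα.2])
  obtain ⟨b, hb, hsub⟩ := mem_nhdsGT_iff_exists_Ioo_subset.mp
    (nhdsWithin_le_nhds (s := Ioi (α / 2))
      (((e01.and e21).and (e23.and (eq1.and hlt)))))
  have hpi := Real.pi_pos
  obtain ⟨r, hr, hr1, hr2⟩ := exists_irrational_btwn
    (show α / Real.pi < 2 * b / Real.pi by
      have : α / 2 < b := hb
      gcongr; linarith)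
  rw [div_lt_iff₀ hpi] at hr1
  rw [lt_div_iff₀ hpi] at hr2
  obtain ⟨⟨f01, f21⟩, f23, g1, g2⟩ := hsub (show r * Real.pi / 2 ∈ Ioo (α / 2) b from
    ⟨by linarith, by linarith⟩)
  set h := r * Real.pi / 2 with hh
  have hh1 : α / 2 < h := by linarith
  have hsin : 0 < Real.sin h := Real.sin_pos_of_mem_Ioo ⟨by linarith [hα.1], by linarith [hα.1]⟩
  have hqeq : q h * (S * Real.sin h) = C * Real.cos h - Real.cos α := by
    simp only [hq]; field_simp
  have hqle : q h ≤ 1 := by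
    simp only [hq]
    rw [div_le_one (by positivity)]
    have : Real.cos (h + α / 2) ≤ Real.cos α :=
      Real.cos_le_cos_of_nonneg_of_le_pi hα.1.le (by linarith) (by linarith)
    rw [Real.cos_add] at this
    linarith
  have hsq : √(1 - q h ^ 2) ^ 2 = 1 - q h ^ 2 := Real.sq_sqrt (by nlinarith)
  have hinv : ∀ u ∈ K, ∀ c : ℝ, p t (c • A3 (h, q h, u)) = p t (c • A0 (h, q h, u)) := by
    intro u hu c
    have m : ∀ x y z : ℝ, x ^ 2 + y ^ 2 + z ^ 2 = 1 → frameVec w₀ u x y z ∈ unitSph := by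
      intro x y z hxyz
      change _ = _
      rw [frameVec_dot hw₀ hu.1 hu.2, ← hxyz]; ring
    have m0 : A0 (h, q h, u) ∈ unitSph := m _ _ _ (by simp)
    have m3 : A3 (h, q h, u) ∈ unitSph := m _ _ _ (by simp)
    have m1 : A1 (h, q h, u) ∈ unitSph := m _ _ _ (by
      linear_combination hCS + S ^ 2 * hsq)
    have m2 : A2 (h, q h, u) ∈ unitSph := m _ _ _ (by
      linear_combination hCS + S ^ 2 * hsq)
    have d01 : A0 (h, q h, u) ⬝ᵥ A1 (h, q h, u) = Real.cos α := by
      simp only [A0, A1]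
      rw [frameVec_dot hw₀ hu.1 hu.2]; linear_combination -hqeq
    have d21 : A2 (h, q h, u) ⬝ᵥ A1 (h, q h, u) = Real.cos α := by
      simp only [A2, A1]
      rw [frameVec_dot hw₀ hu.1 hu.2, hcα]; linear_combination -S ^ 2 * hsq
    have d23 : A2 (h, q h, u) ⬝ᵥ A3 (h, q h, u) = Real.cos α := by
      simp only [A2, A3]
      rw [frameVec_dot hw₀ hu.1 hu.2]; linear_combination -hqeq
    have l01 := eq_of_rotRel_cross m0 d01 hsα (f01 u hu (cross_smul_mem m0 m1 d01 hsα)) t c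
    have l21 := eq_of_rotRel_cross m2 d21 hsα (f21 u hu (cross_smul_mem m2 m1 d21 hsα)) t c
    have l23 := eq_of_rotRel_cross m2 d23 hsα (f23 u hu (cross_smul_mem m2 m3 d23 hsα)) t c
    rw [l23, ← l21, l01]
  have hirr : Irrational (2 * h / Real.pi) := by
    have : 2 * h / Real.pi = r := by rw [hh]; field_simp
    rwa [this]
  obtain ⟨u₀, hu₀, hu₀w⟩ := exists_unit_orthogonal w₀
  have hA3r : ∀ u, A3 (h, q h, u) = rotAbout w₀ h u := fun u => by
    simp [A3, frameVec, rotAbout]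
  have hA0r : ∀ u, A0 (h, q h, u) = rotAbout w₀ (-h) u := fun u => by
    simp [A0, frameVec, rotAbout]
  have hrel : RotRel (fun _ : Unit => p t) (fun _ => p t) w₀ (2 * h) := by
    intro _ x hx
    obtain ⟨ρ, θ, rfl⟩ := exists_polar_frame hw₀ hu₀ hu₀w hx
    have := hinv (rotAbout w₀ (θ + h) u₀)
      ⟨rotAbout_mem hw₀ hu₀ hu₀w _, rotAbout_dot _ hu₀w⟩ ρ
    rw [hA3r, hA0r, rotAbout_rotAbout hw₀ hu₀w, rotAbout_rotAbout hw₀ hu₀w] at this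
    rw [rotAbout_smul, rotAbout_rotAbout hw₀ hu₀w]
    convert this using 4 <;> ring
  exact odd_eq_zero_of_irrational (a := fun _ : Unit => a t) (fun _ => ha t) (fun _ => hodd t)
    hw₀ hirr hrel () v hv

lemma integral_sin_pow_mul_succ (k : ℕ) :
    (∫ x in (0 : ℝ)..Real.pi, Real.sin x ^ k) * (∫ x in (0 : ℝ)..Real.pi, Real.sin x ^ (k + 1)) =
      2 * Real.pi / (k + 1) := by
  induction k with
  | zero => simp; ring
  | succ n ih =>
    have h := integral_sin_pow (a := 0) (b := Real.pi) n
    simp at h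
    rw [h, mul_comm, mul_assoc, ih]
    push_cast; field_simp; ring

lemma iterated_integral_polynomial (p : Polynomial ℝ) (s : ℝ) :
    (∫ ψ in (0 : ℝ)..Real.pi, s * Real.sin ψ *
      ∫ φ in (0 : ℝ)..Real.pi, p.eval (s * Real.sin ψ * Real.sin φ)) =
      2 * Real.pi * ∫ r in (0 : ℝ)..s, p.eval r := by
  induction p using Polynomial.induction_on' with
  | add p q hp hq =>
    have hi : ∀ (p : Polynomial ℝ) (c : ℝ),
        IntervalIntegrable (fun φ => p.eval (c * Real.sin φ)) MeasureTheory.volume 0 Real.pi :=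
      fun p c => (p.continuous.comp (by fun_prop)).intervalIntegrable _ _
    have ho : ∀ p : Polynomial ℝ, IntervalIntegrable (fun ψ => s * Real.sin ψ *
        ∫ φ in (0 : ℝ)..Real.pi, p.eval (s * Real.sin ψ * Real.sin φ))
        MeasureTheory.volume 0 Real.pi := fun p => by
      refine Continuous.intervalIntegrable (Continuous.mul (by fun_prop) ?_) _ _
      exact intervalIntegral.continuous_parametric_intervalIntegral_of_continuous'
        (f := fun ψ φ => p.eval (s * Real.sin ψ * Real.sin φ))
        (p.continuous.comp (by fun_prop)) _ _
    simp only [Polynomial.eval_add]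
    simp_rw [intervalIntegral.integral_add (hi p _) (hi q _), mul_add]
    rw [intervalIntegral.integral_add (ho p) (ho q), hp, hq,
      intervalIntegral.integral_add (p.continuous.intervalIntegrable _ _)
        (q.continuous.intervalIntegrable _ _)]
    ring
  | monomial n c =>
    simp only [Polynomial.eval_monomial, mul_pow, intervalIntegral.integral_const_mul,
      integral_pow]
    have e : ∀ ψ : ℝ, s * Real.sin ψ *
        (c * (s ^ n * Real.sin ψ ^ n * ∫ φ in (0 : ℝ)..Real.pi, Real.sin φ ^ n)) =
        (c * s ^ (n + 1) * ∫ φ in (0 : ℝ)..Real.pi, Real.sin φ ^ n) * Real.sin ψ ^ (n + 1) := by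
      intro ψ; ring
    simp_rw [e, intervalIntegral.integral_const_mul]
    rw [mul_assoc, integral_sin_pow_mul_succ]
    simp; field_simp

/-- Injectivity of the Abel transform. -/
lemma eq_zero_of_abel_s1 {K : ℝ → ℝ} (hK : Continuous K)
    (h : ∀ s ∈ Icc (0 : ℝ) 1, ∫ φ in (0 : ℝ)..Real.pi, K (s * Real.sin φ) = 0) : K 1 = 0 := by
  have hpi := Real.pi_pos
  have h0 : ∀ s ∈ Icc (0 : ℝ) 1, ∫ r in (0 : ℝ)..s, K r = 0 := by
    intro s hs
    by_contra hne
    set I := ∫ r in (0 : ℝ)..s, K r with hI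
    have hIpos : 0 < |I| := abs_pos.mpr hne
    set ε := |I| / 8 with hε
    have hεpos : 0 < ε := by positivity
    obtain ⟨p, hp⟩ := exists_polynomial_near_of_continuousOn 0 1 K hK.continuousOn ε hεpos
    have hin : ∀ s ∈ Icc (0 : ℝ) 1,
        |∫ φ in (0 : ℝ)..Real.pi, p.eval (s * Real.sin φ)| ≤ ε * Real.pi := by
      intro s hs
      have e : ∫ φ in (0 : ℝ)..Real.pi, p.eval (s * Real.sin φ) =
          ∫ φ in (0 : ℝ)..Real.pi, (p.eval (s * Real.sin φ) - K (s * Real.sin φ)) := by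
        have hi₁ : IntervalIntegrable (fun φ => p.eval (s * Real.sin φ))
            MeasureTheory.volume 0 Real.pi := (p.continuous.comp (by fun_prop)).intervalIntegrable _ _
        have hi₂ : IntervalIntegrable (fun φ => K (s * Real.sin φ))
            MeasureTheory.volume 0 Real.pi := (hK.comp (by fun_prop)).intervalIntegrable _ _
        rw [intervalIntegral.integral_sub hi₁ hi₂, h s hs, sub_zero]
      rw [e, ← Real.norm_eq_abs]
      refine (intervalIntegral.norm_integral_le_of_norm_le_const (C := ε) fun φ hφ => ?_).trans ?_
      · rw [uIoc_of_le hpi.le] at hφ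
        have := Real.sin_nonneg_of_mem_Icc ⟨hφ.1.le, hφ.2⟩
        exact (hp _ ⟨mul_nonneg hs.1 this, mul_le_one₀ hs.2 this (Real.sin_le_one _)⟩).le
      · rw [sub_zero, abs_of_pos hpi]
    have hout : |2 * Real.pi * ∫ r in (0 : ℝ)..s, p.eval r| ≤ ε * Real.pi * Real.pi := by
      rw [← iterated_integral_polynomial, ← Real.norm_eq_abs]
      refine (intervalIntegral.norm_integral_le_of_norm_le_const (C := ε * Real.pi)
        fun ψ hψ => ?_).trans ?_
      · rw [uIoc_of_le hpi.le] at hψ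
        have h1 := Real.sin_nonneg_of_mem_Icc ⟨hψ.1.le, hψ.2⟩
        have h2 : s * Real.sin ψ ∈ Icc (0 : ℝ) 1 :=
          ⟨mul_nonneg hs.1 h1, mul_le_one₀ hs.2 h1 (Real.sin_le_one _)⟩
        rw [norm_mul, Real.norm_eq_abs, Real.norm_eq_abs, abs_of_nonneg h2.1]
        calc _ ≤ 1 * (ε * Real.pi) := mul_le_mul h2.2 (hin _ h2) (abs_nonneg _) zero_le_one
          _ = _ := one_mul _
      · rw [sub_zero, abs_of_pos hpi]
    have hdiff : |(∫ r in (0 : ℝ)..s, p.eval r) - I| ≤ ε := by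
      rw [hI, ← intervalIntegral.integral_sub (p.continuous.intervalIntegrable _ _)
        (hK.intervalIntegrable _ _), ← Real.norm_eq_abs]
      refine (intervalIntegral.norm_integral_le_of_norm_le_const (C := ε) fun r hr => ?_).trans ?_
      · rw [uIoc_of_le hs.1] at hr
        exact (hp r ⟨hr.1.le, hr.2.trans hs.2⟩).le
      · rw [sub_zero, abs_of_nonneg hs.1]
        nlinarith [hs.2]
    rw [abs_mul, abs_of_pos (by positivity : 0 < 2 * Real.pi)] at hout
    have h3 : |∫ r in (0 : ℝ)..s, p.eval r| ≤ ε * Real.pi / 2 := by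
      rw [le_div_iff₀ two_pos]
      have : Real.pi * (|∫ r in (0 : ℝ)..s, p.eval r| * 2) ≤ Real.pi * (ε * Real.pi) := by linarith
      exact le_of_mul_le_mul_left this hpi
    have h4 : |I| ≤ |∫ r in (0 : ℝ)..s, p.eval r| + ε := by
      have := abs_sub_abs_le_abs_sub I (∫ r in (0 : ℝ)..s, p.eval r)
      rw [abs_sub_comm] at this
      linarith
    nlinarith [Real.pi_le_four]
  have hzero : ∀ s ∈ Ioo (0 : ℝ) 1, K s = 0 := by
    intro s hs
    have hd := hK.integral_hasStrictDerivAt 0 s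
    have he : (fun u => ∫ r in (0 : ℝ)..u, K r) =ᶠ[𝓝 s] fun _ => 0 := by
      filter_upwards [isOpen_Ioo.mem_nhds hs] with u hu using h0 u ⟨hu.1.le, hu.2.le⟩
    exact (hd.hasDerivAt.congr_of_eventuallyEq he.symm).unique (hasDerivAt_const s 0)
  have hcl : closure (Ioo (0 : ℝ) 1) ⊆ {s | K s = 0} :=
    closure_minimal (fun s hs => hzero s hs) (isClosed_eq hK continuous_const)
  rw [closure_Ioo zero_ne_one] at hcl
  exact hcl ⟨zero_le_one, le_rfl⟩

lemma integral_shift {k : ℝ → ℝ} (hk : ∀ x, k (x + 2 * Real.pi) = k x) (c : ℝ) :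
    ∫ x in (0 : ℝ)..2 * Real.pi, k (x + c) = ∫ x in (0 : ℝ)..2 * Real.pi, k x := by
  rw [intervalIntegral.integral_comp_add_right, zero_add, add_comm (2 * Real.pi)]
  have := (show Function.Periodic k (2 * Real.pi) from hk).intervalIntegral_add_eq c 0
  simpa using this

lemma rotAbout_add_two_pi (w v : V3) (α : ℝ) :
    rotAbout w (α + 2 * Real.pi) v = rotAbout w α v := by
  simpa using rotAbout_add_int_mul w v α 1

/-- Injectivity of the Funk transform on even functions. -/
lemma add_neg_eq_zero_of_funk {h : V3 → ℝ} (hh : Continuous h)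
    (hint : ∀ w ∈ unitSph, ∀ u ∈ unitSph, u ⬝ᵥ w = 0 →
      ∫ φ in (0 : ℝ)..2 * Real.pi, h (rotAbout w φ u) = 0) {p : V3} (hp : p ∈ unitSph) :
    h p + h (-p) = 0 := by
  have hpi := Real.pi_pos
  obtain ⟨e, he, hep⟩ := exists_unit_orthogonal p
  set H : ℝ → ℝ := fun z =>
    ∫ β in (0 : ℝ)..2 * Real.pi, h (z • p + √(1 - z ^ 2) • rotAbout p β e) with hH
  have hHc : Continuous H := by
    refine intervalIntegral.continuous_parametric_intervalIntegral_of_continuous' ?_ _ _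
    refine hh.comp ?_
    have : Continuous fun x : ℝ × ℝ => rotAbout p x.2 e :=
      continuous_rotAbout continuous_const continuous_snd continuous_const
    fun_prop
  have hHs : ∀ s ∈ Icc (0 : ℝ) 1, ∫ φ in (0 : ℝ)..2 * Real.pi, H (s * Real.sin φ) = 0 := by
    intro s hs
    set c := √(1 - s ^ 2) with hc
    have hc2 : c ^ 2 = 1 - s ^ 2 := Real.sq_sqrt (by nlinarith [hs.1, hs.2])
    -- the point at parameter `φ` of the great circle tilted to height `s` towards `β`
    let P : ℝ → ℝ → V3 := fun φ β => (s * Real.sin φ) • p +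
      ((c * Real.sin φ) • rotAbout p β e + Real.cos φ • (p ⨯₃ rotAbout p β e))
    have hP : Continuous fun x : ℝ × ℝ => h (P x.1 x.2) := by
      refine hh.comp ?_
      have h1 : Continuous fun x : ℝ × ℝ => rotAbout p x.2 e :=
        continuous_rotAbout continuous_const continuous_snd continuous_const
      have h2 := continuous_cross (continuous_const (y := p)) h1
      simp only [P]
      fun_prop
    have hinner : ∀ φ, H (s * Real.sin φ) = ∫ β in (0 : ℝ)..2 * Real.pi, h (P φ β) := by
      intro φ
      set r := √(1 - (s * Real.sin φ) ^ 2) with hr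
      have hs2 := Real.sin_sq_add_cos_sq φ
      have hr2 : r ^ 2 = 1 - (s * Real.sin φ) ^ 2 := Real.sq_sqrt (by
        nlinarith [hs.1, hs.2, sq_nonneg (Real.cos φ), sq_nonneg (c * Real.sin φ)])
      obtain ⟨ψ, h1, h2⟩ : ∃ ψ, c * Real.sin φ = r * Real.cos ψ ∧ Real.cos φ = r * Real.sin ψ := by
        have hsum : (c * Real.sin φ) ^ 2 + Real.cos φ ^ 2 = r ^ 2 := by
          rw [hr2, mul_pow, hc2]; linear_combination hs2
        by_cases hr0 : r = 0
        · rw [hr0] at hsum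
          refine ⟨0, ?_, ?_⟩ <;> rw [hr0] <;> nlinarith [sq_nonneg (c * Real.sin φ), sq_nonneg (Real.cos φ)]
        · obtain ⟨ψ, e1, e2⟩ := exists_angle (a := c * Real.sin φ / r) (b := Real.cos φ / r) (by
            rw [div_pow, div_pow, ← add_div, hsum, div_self (pow_ne_zero 2 hr0)])
          refine ⟨ψ, ?_, ?_⟩
          · rw [← e1]; field_simp
          · rw [← e2]; field_simp
      have hPφ : ∀ β, P φ β = (s * Real.sin φ) • p + r • rotAbout p (β + ψ) e := by
        intro β
        simp only [P]
        rw [h1, h2, add_comm β ψ, ← rotAbout_rotAbout hp hep, rotAbout.eq_1 p ψ]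
        module
      simp_rw [hPφ]
      exact (integral_shift (k := fun β => h ((s * Real.sin φ) • p + r • rotAbout p β e))
        (fun x => by simp only [rotAbout_add_two_pi]) ψ).symm
    simp_rw [hinner]
    rw [MeasureTheory.intervalIntegral_intervalIntegral_swap (F := fun φ β => h (P φ β))]
    · have hz : ∀ β, ∫ φ in (0 : ℝ)..2 * Real.pi, h (P φ β) = 0 := by
        intro β
        set q := rotAbout p β e with hq
        have hqm : q ∈ unitSph := rotAbout_mem hp he hep β
        have hqp : q ⬝ᵥ p = 0 := rotAbout_dot β hep
        have hpq : p ⬝ᵥ q = 0 := by rw [dotProduct_comm]; exact hqp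
        have hp' : p ⬝ᵥ p = 1 := hp
        have hq' : q ⬝ᵥ q = 1 := hqm
        have h1 : p ⨯₃ (p ⨯₃ q) = -q := cross_cross_of_orthogonal hp hqp
        have h2 : q ⨯₃ (p ⨯₃ q) = p := by
          rw [← cross_anticomm q p, map_neg, cross_cross_of_orthogonal hqm hpq, neg_neg]
        have hw : (-c) • p + s • q ∈ unitSph := by
          change _ ⬝ᵥ _ = (1 : ℝ)
          simp only [add_dotProduct, dotProduct_add, smul_dotProduct, dotProduct_smul, hp', hq',
            hpq, hqp, smul_eq_mul]
          linear_combination hc2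
        have hu : p ⨯₃ q ∈ unitSph := by
          change _ ⬝ᵥ _ = (1 : ℝ)
          rw [cross_dot_cross_of_orthogonal hp hqp, hq']
        have huw : (p ⨯₃ q) ⬝ᵥ ((-c) • p + s • q) = 0 := by
          simp only [dotProduct_add, dotProduct_smul, cross_dot_left, cross_dot_right]; simp
        have hPφ : ∀ φ, P φ β = rotAbout ((-c) • p + s • q) φ (p ⨯₃ q) := by
          intro φ
          simp only [P, ← hq]
          clear_value q
          simp only [rotAbout, map_add, map_smul, LinearMap.add_apply, LinearMap.smul_apply, h1, h2]
          module
        simp only [hPφ]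
        exact hint _ hw _ hu huw
      simp [hz]
    · refine (hP.continuousOn.integrableOn_compact
        (isCompact_uIcc (a := 0) (b := 2 * Real.pi) |>.prod
          (isCompact_uIcc (a := 0) (b := 2 * Real.pi)))).mono_set ?_
      exact prod_mono uIoc_subset_uIcc uIoc_subset_uIcc
  have habel := eq_zero_of_abel_s1 (K := fun z => H z + H (-z))
    (hHc.add (hHc.comp continuous_neg)) fun s hs => by
      have hc : Continuous fun φ => H (s * Real.sin φ) := hHc.comp (by fun_prop)
      have hc' : Continuous fun φ => H (-(s * Real.sin φ)) := hHc.comp (by fun_prop)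
      rw [intervalIntegral.integral_add (hc.intervalIntegrable _ _) (hc'.intervalIntegrable _ _)]
      refine Eq.trans ?_ (hHs s hs)
      refine Eq.trans ?_ (intervalIntegral.integral_add_adjacent_intervals (a := 0) (b := Real.pi)
        (c := 2 * Real.pi) (hc.intervalIntegrable _ _) (hc.intervalIntegrable _ _))
      congr 1
      have := intervalIntegral.integral_comp_add_right (a := 0) (b := Real.pi)
        (fun φ => H (s * Real.sin φ)) Real.pi
      simp only [Real.sin_add_pi, zero_add, ← two_mul, mul_neg] at this
      exact this
  simp only [hH] at habel
  norm_num at habel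
  have h3 : (2 * Real.pi) * (h p + h (-p)) = 0 := by linarith
  exact (mul_eq_zero.mp h3).resolve_left (by positivity)

lemma exists_smul_mem_unitSph (v : V3) : ∃ c : ℝ, ∃ p ∈ unitSph, v = c • p := by
  by_cases hv : v = 0
  · obtain ⟨u, hu, -⟩ := exists_unit_orthogonal 0
    exact ⟨0, u, hu, by simp [hv]⟩
  · exact exists_unit_smul v hv

lemma exists_orthogonal_mem_unitSph (v : V3) : ∃ w ∈ unitSph, v ⬝ᵥ w = 0 := by
  obtain ⟨w, hw, h⟩ := exists_unit_orthogonal v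
  exact ⟨w, hw, by rwa [dotProduct_comm]⟩

/-- Functions that agree up to a rotation on every plane have the same even part. -/
lemma add_neg_eq_of_rotRel {F G : V3 → ℝ} (hF : Continuous F) (hG : Continuous G)
    (h : ∀ w ∈ unitSph, ∃ α, ∀ v, v ⬝ᵥ w = 0 → F (rotAbout w α v) = G v) (v : V3) :
    F v + F (-v) = G v + G (-v) := by
  obtain ⟨c, p, hp, rfl⟩ := exists_smul_mem_unitSph v
  have := add_neg_eq_zero_of_funk (h := fun x => F (c • x) - G (c • x)) (by fun_prop) ?_ hp
  · simp only [smul_neg] at this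
    linarith
  intro w hw u hu huw
  obtain ⟨α, hα⟩ := h w hw
  have hr : Continuous fun φ => rotAbout w φ u :=
    continuous_rotAbout continuous_const continuous_id continuous_const
  have hi₁ : Continuous fun φ => F (c • rotAbout w φ u) := by fun_prop
  have hi₂ : Continuous fun φ => G (c • rotAbout w φ u) := by fun_prop
  rw [intervalIntegral.integral_sub (hi₁.intervalIntegrable _ _) (hi₂.intervalIntegrable _ _),
    sub_eq_zero, ← integral_shift (fun φ => by rw [rotAbout_add_two_pi]) α]
  congr 1
  ext φ
  rw [← hα _ (by rw [smul_dotProduct, rotAbout_dot φ huw, smul_zero]), rotAbout_smul,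
    rotAbout_rotAbout hw huw, add_comm]

/-- The squared odd parts of such functions agree. -/
lemma sq_sub_neg_eq_of_rotRel {F G : V3 → ℝ} (hF : Continuous F) (hG : Continuous G)
    (h : ∀ w ∈ unitSph, ∃ α, ∀ v, v ⬝ᵥ w = 0 → F (rotAbout w α v) = G v) (v : V3) :
    (F v - F (-v)) ^ 2 = (G v - G (-v)) ^ 2 := by
  have h1 := add_neg_eq_of_rotRel hF hG h v
  have h2 := add_neg_eq_of_rotRel (hF.pow 2) (hG.pow 2)
    (fun w hw => (h w hw).imp fun α hα v hv => by simp only [Pi.pow_apply, hα v hv]) v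
  simp only [Pi.pow_apply] at h2
  linear_combination 2 * h2 - (F v + F (-v) + (G v + G (-v))) * h1

/-- Reduction of an angle of symmetry to `(0, π)`. -/
lemma exists_angle_mem_Ioo {p : T → V3 → ℝ} {w : V3} (hw : w ∈ unitSph) {α : ℝ}
    (h : RotRel p p w α) (h0 : ∀ n : ℤ, α ≠ n * Real.pi) :
    ∃ β ∈ Ioo 0 Real.pi, RotRel p p w β := by
  have hpi := Real.pi_pos
  have h2 : 0 < 2 * Real.pi := by positivity
  set n := ⌊α / (2 * Real.pi)⌋ with hn
  set β := α - n * (2 * Real.pi) with hβ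
  have hr : RotRel p p w β := by
    have := h.add_int (-n)
    rwa [Int.cast_neg, neg_mul, ← sub_eq_add_neg] at this
  have hn1 : n * (2 * Real.pi) ≤ α := (le_div_iff₀ h2).mp (Int.floor_le _)
  have hn2 : α < (n + 1) * (2 * Real.pi) := (div_lt_iff₀ h2).mp (Int.lt_floor_add_one _)
  have hβ0 : β ≠ 0 := fun e => h0 (2 * n) (by push_cast; linarith)
  have hβpi : β ≠ Real.pi := fun e => h0 (2 * n + 1) (by push_cast; linarith)
  have hβpos : 0 < β := lt_of_le_of_ne (by linarith) hβ0.symm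
  rcases lt_or_gt_of_ne hβpi with hlt | hgt
  · exact ⟨β, ⟨hβpos, hlt⟩, hr⟩
  · refine ⟨-β + 2 * Real.pi, ⟨by linarith, by linarith⟩, ?_⟩
    simpa using (hr.neg hw).add_int 1

lemma isClosed_setOf_rotRel {F G : T → V3 → ℝ} (hF : ∀ t, Continuous (F t))
    (hG : ∀ t, Continuous (G t)) (α : ℝ) : IsClosed {w : unitSph | RotRel F G w α} :=
  (isClosed_rotRel hF hG).preimage (f := fun w : unitSph => (w, α)) (by fun_prop)

/-- If two families of functions agree up to a rotation on every plane, and none of the restrictions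
of the first is even, then they agree, or agree after the antipodal map. -/
theorem eq_or_eq_neg_of_rotRel {F G : T → V3 → ℝ} (hF : ∀ t, Continuous (F t))
    (hG : ∀ t, Continuous (G t)) (hA : ∀ w ∈ unitSph, ∃ α, RotRel F G w α)
    (hsym : ∀ w ∈ unitSph, ¬ RotRel F F w Real.pi) :
    (∀ t v, F t v = G t v) ∨ (∀ t v, F t (-v) = G t v) := by
  have hpi := Real.pi_pos
  set a : T → V3 → ℝ := fun t v => F t v - F t (-v) with ha
  have hac : ∀ t, Continuous (a t) := fun t => (hF t).sub ((hF t).comp continuous_neg)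
  have hodd : ∀ t v, a t (-v) = -a t v := fun t v => by simp [ha]
  have hna : ∀ w ∈ unitSph, ¬ ∀ t v, v ⬝ᵥ w = 0 → a t v = 0 := fun w hw h0 => hsym w hw
    fun t v hv => by rw [rotAbout_pi]; have := h0 t v hv; simp only [ha] at this; linarith
  have hsq : ∀ t v, a t v ^ 2 = (G t v - G t (-v)) ^ 2 := fun t v =>
    sq_sub_neg_eq_of_rotRel (hF t) (hG t) (fun w hw => (hA w hw).imp fun α h => h t) v
  have hrel : ∀ w α, RotRel F G w α → RotRel (fun t v => a t v ^ 2) (fun t v => a t v ^ 2) w α := by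
    intro w α h t v hv
    beta_reduce
    rw [hsq t v, ← h t v hv, ← h t (-v) (by rw [neg_dotProduct, hv, neg_zero]), rotAbout_neg]
  set C : Bool ⊕ {q : ℚ // q ∈ Ioo (0 : ℚ) 1} → Set unitSph := fun
    | .inl true => {w | RotRel F G w 0}
    | .inl false => {w | RotRel F G w Real.pi}
    | .inr q => {w | RotRel (fun t v => a t v ^ 2) (fun t v => a t v ^ 2) w (q.1 * Real.pi)} with hC
  have hCc : ∀ i, IsClosed (C i) := by
    rintro ((_ | _) | q)
    · exact isClosed_setOf_rotRel hF hG _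
    · exact isClosed_setOf_rotRel hF hG _
    · exact isClosed_setOf_rotRel (fun t => (hac t).pow 2) (fun t => (hac t).pow 2) _
  have hcov : ∀ w : unitSph, w ∈ C (.inl true) ∪ C (.inl false) ∨
      ∃ q, w ∈ C (.inr q) := by
    rintro ⟨w, hw⟩
    obtain ⟨α, hα⟩ := hA w hw
    by_cases h0 : ∃ n : ℤ, α = n * Real.pi
    · left
      obtain ⟨n, rfl⟩ := h0
      rcases Int.even_or_odd' n with ⟨m, rfl | rfl⟩
      · left
        have := hα.add_int (-m)
        push_cast at this
        ring_nf at this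
        exact this
      · right
        have := hα.add_int (-m)
        push_cast at this
        ring_nf at this
        exact this
    · right
      push Not at h0
      obtain ⟨β, hβ, hr⟩ := exists_angle_mem_Ioo hw (hrel w α hα) h0
      by_cases hirr : Irrational (β / Real.pi)
      · exact absurd (odd_eq_zero_of_irrational hac hodd hw hirr hr) (hna w hw)
      · obtain ⟨q, hq⟩ := not_not.mp hirr
        have hβq : β = q * Real.pi := by rw [hq]; field_simp
        refine ⟨⟨q, ?_, ?_⟩, ?_⟩
        · have : (0 : ℝ) < q := by rw [hq]; exact div_pos hβ.1 hpi
          exact_mod_cast this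
        · have : (q : ℝ) < 1 := by rw [hq, div_lt_one hpi]; exact hβ.2
          exact_mod_cast this
        · change RotRel (fun t v => a t v ^ 2) (fun t v => a t v ^ 2) w (q * Real.pi)
          rw [← hβq]; exact hr
  have hunion : C (.inl true) ∪ C (.inl false) = univ := by
    by_contra hne
    have hop : IsOpen (C (.inl true) ∪ C (.inl false))ᶜ :=
      ((hCc (.inl true)).union (hCc (.inl false))).isOpen_compl
    have hd : Dense (⋃ i, interior (C i)) := dense_iUnion_interior_of_closed hCc (by
      refine eq_univ_of_forall fun w => mem_iUnion.mpr ?_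
      rcases hcov w with (h | h) | ⟨q, h⟩
      exacts [⟨.inl true, h⟩, ⟨.inl false, h⟩, ⟨.inr q, h⟩])
    obtain ⟨w, hwV, hwi⟩ := hd.inter_open_nonempty _ hop (nonempty_compl.mpr hne)
    obtain ⟨i, hi⟩ := mem_iUnion.mp hwi
    rcases i with (_ | _) | q
    · exact hwV (.inr (interior_subset hi))
    · exact hwV (.inl (interior_subset hi))
    · refine hna w w.2 (odd_eq_zero_of_eventually hac hodd w.2 (α := q.1 * Real.pi) ⟨?_, ?_⟩ ?_)
      · have : (0 : ℝ) < q.1 := by exact_mod_cast q.2.1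
        positivity
      · have : (q.1 : ℝ) < 1 := by exact_mod_cast q.2.2
        nlinarith
      · have := mem_interior_iff_mem_nhds.mp hi
        rw [nhds_subtype_eq_comap, mem_comap] at this
        obtain ⟨s, hs, hsub⟩ := this
        filter_upwards [hs] with x hx hxu using hsub (show (⟨x, hxu⟩ : unitSph) ∈ _ from hx)
  have hdisj : C (.inl true) ∩ C (.inl false) = ∅ := by
    refine eq_empty_of_forall_notMem fun w ⟨h1, h2⟩ => hsym w w.2 fun t v hv => ?_
    have h1' := h1 t v hv
    rw [rotAbout_zero] at h1'
    rw [h1']; exact h2 t v hv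
  have hcase := isPreconnected_iff_subset_of_disjoint_closed.mp
    (isPreconnected_univ (α := unitSph)) _ _ (hCc (.inl true)) (hCc (.inl false)) hunion.symm.subset
    (by rw [hdisj, inter_empty])
  rcases hcase with h | h
  · left
    intro t v
    obtain ⟨w, hw, hv⟩ := exists_orthogonal_mem_unitSph v
    have := (show RotRel F G w 0 from h (mem_univ ⟨w, hw⟩)) t v hv
    rwa [rotAbout_zero] at this
  · right
    intro t v
    obtain ⟨w, hw, hv⟩ := exists_orthogonal_mem_unitSph v
    have := (show RotRel F G w Real.pi from h (mem_univ ⟨w, hw⟩)) t v hv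
    rwa [rotAbout_pi] at this

lemma continuous_of_isClosed_graph {X Y : Type*} [TopologicalSpace X] [TopologicalSpace Y]
    [CompactSpace Y] {f : X → Y} (h : IsClosed {q : X × Y | f q.1 = q.2}) : Continuous f := by
  refine continuous_iff_isClosed.mpr fun C hC => ?_
  have : f ⁻¹' C = Prod.fst '' ({q : X × Y | f q.1 = q.2} ∩ Prod.snd ⁻¹' C) := by
    ext x
    refine ⟨fun hx => ⟨(x, f x), ⟨rfl, hx⟩, rfl⟩, ?_⟩
    rintro ⟨⟨x, y⟩, ⟨h1, h2⟩, rfl⟩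
    have h1 : f x = y := h1
    have h2 : y ∈ C := h2
    change f x ∈ C
    rwa [h1]
  rw [this]
  exact isClosedMap_fst_of_compactSpace _ (h.inter (hC.preimage continuous_snd))

lemma FlipRel.rotRel {F G : T → V3 → ℝ} {w u : V3} {θ : ℝ} (hw : w ∈ unitSph) (hu : u ∈ unitSph)
    (huw : u ⬝ᵥ w = 0) (h : FlipRel F G w u) (h' : FlipRel F G w (rotAbout w θ u)) :
    RotRel F F w (2 * θ) := by
  intro t v hv
  obtain ⟨ρ, ψ, rfl⟩ := exists_polar_frame hw hu huw hv
  have hm : (ρ • rotAbout w (-ψ) u) ⬝ᵥ w = 0 := by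
    rw [smul_dotProduct, rotAbout_dot _ huw, smul_zero]
  have h1 := h t _ hm
  have h2 := h' t _ hm
  rw [axialFlip_rotAbout hw hu huw] at h2
  have h3 := axialFlip_rotAbout hw hu huw ρ 0 (-ψ)
  rw [rotAbout_zero] at h3
  rw [h3, ← h2] at h1
  rw [rotAbout_smul, rotAbout_rotAbout hw huw, show 2 * θ + ψ = 2 * θ - -ψ by ring, ← h1]
  ring_nf

/-- Without symmetries of angle `π`, there are no symmetries of small angle. -/
lemma exists_forall_not_rotRel {F : T → V3 → ℝ} (hF : ∀ t, Continuous (F t))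
    (hsym : ∀ w ∈ unitSph, ¬ RotRel F F w Real.pi) :
    ∃ δ > 0, ∀ w ∈ unitSph, ∀ α ∈ Ioo 0 δ, ¬ RotRel F F w α := by
  obtain ⟨U, V, -, hV, hU, hpV, hsub⟩ := generalized_tube_lemma (isCompact_univ (X := unitSph))
    (isCompact_singleton (x := Real.pi)) (isClosed_rotRel hF hF).isOpen_compl (by
      rintro ⟨w, β⟩ ⟨-, hβ⟩
      obtain rfl : β = Real.pi := hβ
      exact hsym w w.2)
  obtain ⟨δ, hδ, hball⟩ := Metric.isOpen_iff.mp hV Real.pi (hpV rfl)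
  refine ⟨δ, hδ, fun w hw α hα h => ?_⟩
  have hm : ⌊Real.pi / α⌋ • α ∈ rotSymm F hw := zsmul_mem (mem_rotSymm.mpr h) _
  have h1 : ⌊Real.pi / α⌋ * α ≤ Real.pi := (le_div_iff₀ hα.1).mp (Int.floor_le _)
  have h2 : Real.pi < (⌊Real.pi / α⌋ + 1) * α := (div_lt_iff₀ hα.1).mp (Int.lt_floor_add_one _)
  rw [zsmul_eq_mul] at hm
  refine hsub (a := ((⟨w, hw⟩ : unitSph), ⌊Real.pi / α⌋ * α))
    (mk_mem_prod (hU (mem_univ _)) (hball ?_)) hm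
  rw [Metric.mem_ball, Real.dist_eq, abs_lt]
  constructor <;> nlinarith [hα.2]

lemma exists_pos_forall_mul_eq {F : T → V3 → ℝ} (hF : ∀ t, Continuous (F t))
    (hsym : ∀ w ∈ unitSph, ¬ RotRel F F w Real.pi) :
    ∃ M : ℕ, 0 < M ∧ ∀ w ∈ unitSph, ∀ θ, RotRel F F w θ → ∃ k : ℤ, M * θ = k * (2 * Real.pi) := by
  obtain ⟨δ, hδ, hno⟩ := exists_forall_not_rotRel hF hsym
  have hpi := Real.pi_pos
  obtain ⟨N, hN⟩ := exists_nat_gt (2 * Real.pi / δ)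
  have hN0 : 0 < N := by
    have : (0 : ℝ) < N := lt_trans (by positivity) hN
    exact_mod_cast this
  refine ⟨N.factorial, N.factorial_pos, fun w hw θ h => ?_⟩
  obtain ⟨j, k, hk0, hkN, hjk⟩ := Real.exists_int_int_abs_mul_sub_le (θ / (2 * Real.pi)) hN0
  have hm : k • θ - j • (2 * Real.pi) ∈ rotSymm F hw :=
    sub_mem (zsmul_mem (mem_rotSymm.mpr h) _) (zsmul_mem (two_pi_mem_rotSymm F hw) _)
  rw [zsmul_eq_mul, zsmul_eq_mul] at hm
  have habs : |k * θ - j * (2 * Real.pi)| < δ := by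
    have e : k * θ - j * (2 * Real.pi) = (k * (θ / (2 * Real.pi)) - j) * (2 * Real.pi) := by
      field_simp
    rw [e, abs_mul, abs_of_pos (by positivity : 0 < 2 * Real.pi)]
    calc _ ≤ 1 / ((N : ℝ) + 1) * (2 * Real.pi) := by gcongr
      _ < δ := by
        rw [div_mul_eq_mul_div, one_mul, div_lt_iff₀ (by positivity)]
        rw [div_lt_iff₀ hδ] at hN
        nlinarith
  have hzero : k * θ - j * (2 * Real.pi) = 0 := by
    by_contra hne
    refine hno w hw _ ⟨abs_pos.mpr hne, habs⟩ (?_ : RotRel F F w _)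
    rcases abs_choice (k * θ - j * (2 * Real.pi)) with e | e <;> rw [e]
    · exact hm
    · exact RotRel.neg hw hm
  lift k to ℕ using hk0.le
  obtain ⟨l, hl⟩ := Nat.dvd_factorial (by exact_mod_cast hk0 : 0 < k) (by exact_mod_cast hkN)
  refine ⟨l * j, ?_⟩
  rw [hl]
  push_cast at hzero ⊢
  linear_combination (l : ℝ) * hzero

/-- The point of the unit sphere with polar angle `r` and azimuth `β`. -/
def polarPt (r β : ℝ) : V3 :=
  ![Real.sin r * Real.cos β, Real.sin r * Real.sin β, Real.cos r]

/-- The unit tangent vector of the meridian through `polarPt r β`. -/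
def polarTan (r β : ℝ) : V3 :=
  ![Real.cos r * Real.cos β, Real.cos r * Real.sin β, -Real.sin r]

lemma polarPt_mem (r β : ℝ) : polarPt r β ∈ unitSph := by
  change _ = _
  rw [dot3]; simp [polarPt]
  linear_combination Real.sin_sq_add_cos_sq r + Real.sin r ^ 2 * Real.sin_sq_add_cos_sq β

lemma polarTan_mem (r β : ℝ) : polarTan r β ∈ unitSph := by
  change _ = _
  rw [dot3]; simp [polarTan]
  linear_combination Real.sin_sq_add_cos_sq r + Real.cos r ^ 2 * Real.sin_sq_add_cos_sq β

lemma polarTan_dot (r β : ℝ) : polarTan r β ⬝ᵥ polarPt r β = 0 := by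
  rw [dot3]; simp [polarTan, polarPt]
  linear_combination Real.sin r * Real.cos r * Real.sin_sq_add_cos_sq β

lemma continuous_polarPt : Continuous fun x : ℝ × ℝ => polarPt x.1 x.2 := by
  refine continuous_pi fun i => ?_
  fin_cases i <;> simp [polarPt] <;> fun_prop

lemma continuous_polarTan : Continuous fun x : ℝ × ℝ => polarTan x.1 x.2 := by
  refine continuous_pi fun i => ?_
  fin_cases i <;> simp [polarTan] <;> fun_prop

lemma polarPt_zero (β : ℝ) : polarPt 0 β = polarPt 0 0 := by simp [polarPt]

lemma polarPt_pi (β : ℝ) : polarPt Real.pi β = polarPt Real.pi 0 := by simp [polarPt]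

lemma polarTan_zero (β : ℝ) : polarTan 0 β = rotAbout (polarPt 0 0) β (polarTan 0 0) := by
  ext i; fin_cases i <;> simp [polarTan, polarPt, rotAbout, cross3]

lemma polarTan_pi (β : ℝ) :
    polarTan Real.pi β = rotAbout (polarPt Real.pi 0) (-β) (polarTan Real.pi 0) := by
  ext i; fin_cases i <;> simp [polarTan, polarPt, rotAbout, cross3]

lemma polarPt_two_pi (r : ℝ) : polarPt r (2 * Real.pi) = polarPt r 0 := by simp [polarPt]

lemma polarTan_two_pi (r : ℝ) : polarTan r (2 * Real.pi) = polarTan r 0 := by simp [polarTan]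

/-- There is no continuous field of finitely many flip axes on the sphere: the underlying
topological obstruction, expressed through polar coordinates. -/
lemma false_of_continuous_field {Z : ℝ × ℝ → Circle} (hZ : Continuous Z) {M : ℕ} (hM : 0 < M)
    (hper : ∀ r, Z (r, 2 * Real.pi) = Z (r, 0))
    (h0 : ∀ β, Z (0, β) = Z (0, 0) * Circle.exp (-(2 * M * β)))
    (hpi : ∀ β, Z (Real.pi, β) = Z (Real.pi, 0) * Circle.exp (2 * M * β)) : False := by
  obtain ⟨ψ, ⟨-, hψ⟩, -⟩ := Circle.isCoveringMap_exp.existsUnique_continuousMap_lifts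
    ⟨Z, hZ⟩ (0, 0) (Complex.arg (Z (0, 0))) (Circle.exp_arg _)
  have hψ : ∀ x, Circle.exp (ψ x) = Z x := congrFun hψ
  have e1 := Circle.isCoveringMap_exp.const_of_comp
    (g := fun β => ψ (0, β) + 2 * M * β) (by fun_prop) (fun β β' => by
      simp only [Circle.exp_add, hψ, h0 β, h0 β', Circle.exp_neg, inv_mul_cancel_right]) 0
      (2 * Real.pi)
  have e2 := Circle.isCoveringMap_exp.const_of_comp
    (g := fun β => ψ (Real.pi, β) - 2 * M * β) (by fun_prop) (fun β β' => by
      rw [Circle.exp_sub, Circle.exp_sub, hψ, hψ, hpi β, hpi β', mul_div_cancel_right,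
        mul_div_cancel_right]) 0 (2 * Real.pi)
  have e3 := Circle.isCoveringMap_exp.const_of_comp
    (g := fun r => ψ (r, 2 * Real.pi) - ψ (r, 0)) (by fun_prop) (fun r r' => by
      simp only [Circle.exp_sub, hψ, hper, div_self']) 0 Real.pi
  have hpos : 0 < M * Real.pi := mul_pos (by exact_mod_cast hM) Real.pi_pos
  nlinarith

/-- The flip axes cannot be distributed over all planes if the family has no symmetries of
angle `π`. -/
theorem not_forall_exists_flipRel {F G : T → V3 → ℝ} (hF : ∀ t, Continuous (F t))
    (hG : ∀ t, Continuous (G t)) (hsym : ∀ w ∈ unitSph, ¬ RotRel F F w Real.pi) :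
    ¬ ∀ w ∈ unitSph, ∃ u ∈ unitSph, u ⬝ᵥ w = 0 ∧ FlipRel F G w u := by
  intro hB
  obtain ⟨M, hM, hMF⟩ := exists_pos_forall_mul_eq hF hsym
  have hex : ∀ x : ℝ × ℝ, ∃ θ : ℝ,
      FlipRel F G (polarPt x.1 x.2) (rotAbout (polarPt x.1 x.2) θ (polarTan x.1 x.2)) := by
    intro x
    obtain ⟨u, hu, huw, h⟩ := hB _ (polarPt_mem x.1 x.2)
    obtain ⟨θ, rfl⟩ := exists_unit_frame (polarPt_mem x.1 x.2) (polarTan_mem x.1 x.2)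
      (polarTan_dot x.1 x.2) hu huw
    exact ⟨θ, h⟩
  choose Θ hΘ using hex
  set Z : ℝ × ℝ → Circle := fun x => Circle.exp (2 * M * Θ x) with hZdef
  have hval : ∀ x θ, FlipRel F G (polarPt x.1 x.2)
      (rotAbout (polarPt x.1 x.2) θ (polarTan x.1 x.2)) → Z x = Circle.exp (2 * M * θ) := by
    intro x θ h
    have hw := polarPt_mem x.1 x.2
    have ht := polarTan_dot x.1 x.2
    have h' : FlipRel F G (polarPt x.1 x.2) (rotAbout (polarPt x.1 x.2) (Θ x - θ)
        (rotAbout (polarPt x.1 x.2) θ (polarTan x.1 x.2))) := by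
      rw [rotAbout_rotAbout hw ht, sub_add_cancel]
      exact hΘ x
    have := h.rotRel hw (rotAbout_mem hw (polarTan_mem x.1 x.2) ht θ) (rotAbout_dot θ ht) h'
    obtain ⟨k, hk⟩ := hMF _ hw _ this
    exact Circle.exp_eq_exp.mpr ⟨k, by linear_combination hk⟩
  have hZ : Continuous Z := by
    refine continuous_of_isClosed_graph ?_
    have hcl : IsClosed {q : ((ℝ × ℝ) × Circle) × Icc (0 : ℝ) (2 * Real.pi) |
        FlipRel F G (polarPt q.1.1.1 q.1.1.2)
          (rotAbout (polarPt q.1.1.1 q.1.1.2) q.2 (polarTan q.1.1.1 q.1.1.2)) ∧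
        Circle.exp (2 * M * q.2) = q.1.2} := by
      refine IsClosed.and ?_ (isClosed_eq (by fun_prop) (by fun_prop))
      refine (isClosed_flipRel hF hG).preimage
        (f := fun q : ((ℝ × ℝ) × Circle) × Icc (0 : ℝ) (2 * Real.pi) =>
          ((⟨polarPt q.1.1.1 q.1.1.2, polarPt_mem _ _⟩ : unitSph),
            rotAbout (polarPt q.1.1.1 q.1.1.2) q.2 (polarTan q.1.1.1 q.1.1.2))) ?_
      have hc : Continuous fun q : ((ℝ × ℝ) × Circle) × Icc (0 : ℝ) (2 * Real.pi) =>
        polarPt q.1.1.1 q.1.1.2 := continuous_polarPt.comp (by fun_prop)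
      have hc' : Continuous fun q : ((ℝ × ℝ) × Circle) × Icc (0 : ℝ) (2 * Real.pi) =>
        polarTan q.1.1.1 q.1.1.2 := continuous_polarTan.comp (by fun_prop)
      exact (hc.subtype_mk _).prodMk (continuous_rotAbout hc (by fun_prop) hc')
    convert isClosedMap_fst_of_compactSpace _ hcl using 1
    ext ⟨x, z⟩
    constructor
    · intro h
      have h : Z x = z := h
      have hpi : 0 < 2 * Real.pi := Real.two_pi_pos
      have hm : toIcoMod hpi 0 (Θ x) ∈ Icc 0 (2 * Real.pi) := by
        have := toIcoMod_mem_Ico hpi 0 (Θ x)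
        rw [zero_add] at this
        exact ⟨this.1, this.2.le⟩
      have hf : FlipRel F G (polarPt x.1 x.2) (rotAbout (polarPt x.1 x.2)
          (toIcoMod hpi 0 (Θ x)) (polarTan x.1 x.2)) := by
        have e : Θ x = toIcoMod hpi 0 (Θ x) + toIcoDiv hpi 0 (Θ x) * (2 * Real.pi) := by
          rw [← zsmul_eq_mul, toIcoMod_add_toIcoDiv_zsmul]
        have := hΘ x
        rw [e, rotAbout_add_int_mul] at this
        exact this
      exact ⟨((x, z), ⟨_, hm⟩), ⟨hf, by rw [← h]; exact (hval x _ hf).symm⟩, rfl⟩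
    · rintro ⟨⟨⟨x', z'⟩, θ⟩, ⟨h1, h2⟩, he⟩
      obtain ⟨rfl, rfl⟩ := Prod.mk.inj he
      exact (hval x' θ h1).trans h2
  refine false_of_continuous_field hZ hM (fun r => ?_) (fun β => ?_) fun β => ?_
  · refine hval (r, 2 * Real.pi) _ ?_
    simp only [polarPt_two_pi, polarTan_two_pi]
    exact hΘ (r, 0)
  · have h := hΘ (0, β)
    simp only [polarPt_zero β, polarTan_zero β] at h
    rw [rotAbout_rotAbout (polarPt_mem _ _) (polarTan_dot _ _)] at h
    rw [hval (0, 0) _ h, ← Circle.exp_add]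
    simp only [hZdef]
    congr 1; ring
  · have h := hΘ (Real.pi, β)
    simp only [polarPt_pi β, polarTan_pi β] at h
    rw [rotAbout_rotAbout (polarPt_mem _ _) (polarTan_dot _ _)] at h
    rw [hval (Real.pi, 0) _ h, ← Circle.exp_add]
    simp only [hZdef]
    congr 1; ring

lemma isClosed_setOf_exists_rotRel {F G : T → V3 → ℝ} (hF : ∀ t, Continuous (F t))
    (hG : ∀ t, Continuous (G t)) : IsClosed {w : unitSph | ∃ α, RotRel F G w α} := by
  have hcl : IsClosed {q : unitSph × Icc (0 : ℝ) (2 * Real.pi) | RotRel F G q.1 q.2} :=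
    (isClosed_rotRel hF hG).preimage
      (f := fun q : unitSph × Icc (0 : ℝ) (2 * Real.pi) => (q.1, (q.2 : ℝ))) (by fun_prop)
  convert isClosedMap_fst_of_compactSpace _ hcl using 1
  ext w
  constructor
  · rintro ⟨α, h⟩
    have hpi : 0 < 2 * Real.pi := Real.two_pi_pos
    have hm : toIcoMod hpi 0 α ∈ Icc 0 (2 * Real.pi) := by
      have := toIcoMod_mem_Ico hpi 0 α
      rw [zero_add] at this
      exact ⟨this.1, this.2.le⟩
    refine ⟨(w, ⟨_, hm⟩), ?_, rfl⟩
    have := h.add_int (-toIcoDiv hpi 0 α)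
    rwa [Int.cast_neg, neg_mul, ← sub_eq_add_neg, ← zsmul_eq_mul, self_sub_toIcoDiv_zsmul] at this
  · rintro ⟨⟨w', α⟩, h, rfl⟩
    exact ⟨α, h⟩

lemma isClosed_setOf_exists_flipRel {F G : T → V3 → ℝ} (hF : ∀ t, Continuous (F t))
    (hG : ∀ t, Continuous (G t)) :
    IsClosed {w : unitSph | ∃ u ∈ unitSph, u ⬝ᵥ w = 0 ∧ FlipRel F G w u} := by
  have hcl : IsClosed {q : unitSph × unitSph | (q.2 : V3) ⬝ᵥ q.1 = 0 ∧ FlipRel F G q.1 q.2} := by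
    refine IsClosed.and (isClosed_eq ((continuous_subtype_val.comp continuous_snd).dotProduct
      (continuous_subtype_val.comp continuous_fst)) continuous_const) ?_
    exact (isClosed_flipRel hF hG).preimage
      (f := fun q : unitSph × unitSph => (q.1, (q.2 : V3))) (by fun_prop)
  convert isClosedMap_fst_of_compactSpace _ hcl using 1
  ext w
  constructor
  · rintro ⟨u, hu, h⟩
    exact ⟨(w, ⟨u, hu⟩), h, rfl⟩
  · rintro ⟨⟨w', u⟩, h, rfl⟩
    exact ⟨u, u.2, h⟩

lemma FlipRel.of_rotRel {F F' G : T → V3 → ℝ} {w u : V3} {α : ℝ} (hw : w ∈ unitSph)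
    (hu : u ∈ unitSph) (huw : u ⬝ᵥ w = 0) (h : RotRel F G w α) (h' : FlipRel F' G w u) :
    FlipRel F' F w (rotAbout w (α / 2) u) := by
  intro t v hv
  obtain ⟨ρ, θ, rfl⟩ := exists_polar_frame hw hu huw hv
  have hm : (ρ • rotAbout w (θ - α) u) ⬝ᵥ w = 0 := by
    rw [smul_dotProduct, rotAbout_dot _ huw, smul_zero]
  have h1 := h t _ hm
  have h2 := h' t _ hm
  have h3 := axialFlip_rotAbout hw hu huw ρ 0 (θ - α)
  rw [rotAbout_zero] at h3
  rw [rotAbout_smul, rotAbout_rotAbout hw huw, add_sub_cancel] at h1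
  rw [axialFlip_rotAbout hw hu huw, h1, ← h2, h3]
  ring_nf

/-- The rigidity theorem for two families of functions on three-dimensional space. -/
theorem eq_or_eq_neg_of_rotRel_or_flipRel {F G : ℝ → V3 → ℝ} (hF : ∀ t, Continuous (F t))
    (hG : ∀ t, Continuous (G t))
    (h : ∀ w ∈ unitSph, (∃ α, RotRel F G w α) ∨
      ∃ u ∈ unitSph, u ⬝ᵥ w = 0 ∧ FlipRel (fun a => F (-a)) G w u)
    (hsym : ∀ w ∈ unitSph, ¬ RotRel F F w Real.pi)
    (hflip : ∀ w ∈ unitSph, ∀ u ∈ unitSph, u ⬝ᵥ w = 0 → ¬ FlipRel (fun a => F (-a)) F w u) :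
    (∀ t v, F t v = G t v) ∨ (∀ t v, F t (-v) = G t v) := by
  have hF' : ∀ t, Continuous ((fun a => F (-a)) t) := fun t => hF (-t)
  have hcase := isPreconnected_iff_subset_of_disjoint_closed.mp
    (isPreconnected_univ (α := unitSph)) _ _ (isClosed_setOf_exists_rotRel hF hG)
    (isClosed_setOf_exists_flipRel hF' hG) (fun w _ => h w w.2) (by
      refine eq_empty_of_forall_notMem ?_
      rintro w ⟨-, ⟨α, h1⟩, u, hu, huw, h2⟩
      exact hflip w w.2 _ (rotAbout_mem w.2 hu huw _) (rotAbout_dot _ huw)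
        (FlipRel.of_rotRel w.2 hu huw h1 h2))
  rcases hcase with hA | hB
  · exact eq_or_eq_neg_of_rotRel hF hG (fun w hw => hA (mem_univ ⟨w, hw⟩)) hsym
  · refine absurd (fun w hw => hB (mem_univ ⟨w, hw⟩)) (not_forall_exists_flipRel hF' hG ?_)
    intro w hw h'
    refine hsym w hw fun t v hv => ?_
    simpa using h' (-t) v hv

/-- The positively homogeneous extension of degree one of a function on the sphere. -/
def homogExt (f : E4 → ℝ) (z : E4) : ℝ := ‖z‖ * f (‖z‖⁻¹ • z)

lemma mem_sph {z : E4} : z ∈ sph ↔ ‖z‖ = 1 := by simp [sph]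

lemma inv_norm_smul_mem_sph {z : E4} (hz : z ≠ 0) : ‖z‖⁻¹ • z ∈ sph := by
  rw [mem_sph, norm_smul, norm_inv, norm_norm, inv_mul_cancel₀ (norm_ne_zero_iff.mpr hz)]

lemma homogExt_of_mem {f : E4 → ℝ} {z : E4} (hz : z ∈ sph) : homogExt f z = f z := by
  rw [homogExt, mem_sph.mp hz]; simp

lemma continuous_homogExt {f : E4 → ℝ} (hf : ContinuousOn f sph) : Continuous (homogExt f) := by
  rw [continuous_iff_continuousAt]
  intro z
  by_cases hz : z = 0
  · subst hz
    obtain ⟨C, hC⟩ := (isCompact_sphere (0 : E4) 1).exists_bound_of_continuousOn hf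
    have hle : ∀ y, ‖homogExt f y‖ ≤ C * ‖y‖ := by
      intro y
      by_cases hy : y = 0
      · simp [homogExt, hy]
      · rw [homogExt, norm_mul, norm_norm, mul_comm]
        exact mul_le_mul_of_nonneg_right (hC _ (inv_norm_smul_mem_sph hy)) (norm_nonneg _)
    have h0 : homogExt f 0 = 0 := by simp [homogExt]
    rw [ContinuousAt, h0]
    refine squeeze_zero_norm hle ?_
    have : Continuous fun y : E4 => C * ‖y‖ := by fun_prop
    simpa using this.tendsto 0
  · have hon : ContinuousOn (homogExt f) {0}ᶜ := by
      refine continuous_norm.continuousOn.mul (hf.comp ?_ fun y hy => inv_norm_smul_mem_sph hy)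
      exact (continuous_norm.continuousOn.inv₀ fun y hy => norm_ne_zero_iff.mpr hy).smul
        continuousOn_id
    exact hon.continuousAt (isOpen_compl_singleton.mem_nhds hz)

lemma homogExt_isometry {f g : E4 → ℝ} {w : E4} {φ : E4 ≃ₗᵢ[ℝ] E4}
    (h : ∀ θ ∈ S2 w, f (φ θ) = g θ) {z : E4} (hz : ⟪z, w⟫ = 0) :
    homogExt f (φ z) = homogExt g z := by
  by_cases h0 : z = 0
  · simp [homogExt, h0]
  · rw [homogExt, homogExt, φ.norm_map, ← map_smul, h _ ⟨inv_norm_smul_mem_sph h0, ?_⟩]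
    rw [inner_smul_left, hz, mul_zero]

/-- The embedding of `V3` as the orthogonal complement of the first basis vector. -/
def embed (b : OrthonormalBasis (Fin 4) ℝ E4) : V3 →ₗ[ℝ] E4 :=
  ∑ i : Fin 3, (LinearMap.proj i).smulRight (b i.succ)

lemma embed_apply (b : OrthonormalBasis (Fin 4) ℝ E4) (v : V3) :
    embed b v = ∑ i : Fin 3, v i • b i.succ := by
  simp [embed, LinearMap.sum_apply]

lemma inner_embed (b : OrthonormalBasis (Fin 4) ℝ E4) (v w : V3) :
    ⟪embed b v, embed b w⟫ = v ⬝ᵥ w := by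
  simp [embed_apply, sum_inner, inner_sum, inner_smul_left, inner_smul_right, dotProduct,
    OrthonormalBasis.inner_eq_ite, mul_comm]

lemma inner_embed_zero (b : OrthonormalBasis (Fin 4) ℝ E4) (v : V3) : ⟪embed b v, b 0⟫ = 0 := by
  simp [embed_apply, sum_inner, inner_smul_left]

lemma inner_zero_embed (b : OrthonormalBasis (Fin 4) ℝ E4) (v : V3) : ⟪b 0, embed b v⟫ = 0 := by
  rw [real_inner_comm, inner_embed_zero]

lemma inner_basis_self (b : OrthonormalBasis (Fin 4) ℝ E4) : ⟪b 0, b 0⟫ = (1 : ℝ) := by simp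

lemma exists_eq_smul_add_embed (b : OrthonormalBasis (Fin 4) ℝ E4) (z : E4) :
    ∃ (a : ℝ) (v : V3), z = a • b 0 + embed b v := by
  refine ⟨⟪b 0, z⟫, fun i => ⟪b i.succ, z⟫, ?_⟩
  conv_lhs => rw [← b.sum_repr' z, Fin.sum_univ_succ]
  rw [embed_apply]

lemma exists_eq_embed (b : OrthonormalBasis (Fin 4) ℝ E4) {z : E4} (hz : ⟪z, b 0⟫ = 0) :
    ∃ v, z = embed b v := by
  obtain ⟨a, v, rfl⟩ := exists_eq_smul_add_embed b z
  rw [inner_add_left, inner_smul_left, inner_embed_zero, inner_basis_self] at hz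
  have : a = 0 := by simpa using hz
  exact ⟨v, by simp [this]⟩

lemma norm_embed (b : OrthonormalBasis (Fin 4) ℝ E4) {v : V3} (hv : v ∈ unitSph) :
    ‖embed b v‖ = 1 := by
  rw [← sq_eq_sq₀ (norm_nonneg _) zero_le_one, ← real_inner_self_eq_norm_sq, inner_embed, one_pow]
  exact hv

lemma embed_mem_S2 (b : OrthonormalBasis (Fin 4) ℝ E4) {v : V3} (hv : v ∈ unitSph) :
    embed b v ∈ S2 (b 0) := 
  ⟨mem_sph.mpr (norm_embed b hv), inner_embed_zero b v⟩

lemma det_eq_of_forall {B : Module.Basis (Fin 4) ℝ E4} {L : E4 →ₗ[ℝ] E4}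
    {A : Matrix (Fin 4) (Fin 4) ℝ} (h : ∀ j, L (B j) = ∑ i, A i j • B i) :
    LinearMap.det L = A.det := by
  have : L = Matrix.toLin B B A := B.ext fun j => by rw [h, Matrix.toLin_self]
  rw [this, LinearMap.det_toLin]

/-- The orthonormal frame `ζ, w, u, w × u`. -/
lemma orthonormal_frame (b : OrthonormalBasis (Fin 4) ℝ E4) {w u : V3} (hw : w ∈ unitSph)
    (hu : u ∈ unitSph) (huw : u ⬝ᵥ w = 0) :
    Orthonormal ℝ ![b 0, embed b w, embed b u, embed b (w ⨯₃ u)] := by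
  have hwu : w ⬝ᵥ u = 0 := by rw [dotProduct_comm]; exact huw
  have hc : (w ⨯₃ u) ∈ unitSph := (cross_dot_cross_of_orthogonal hw huw).trans hu
  rw [orthonormal_iff_ite]
  intro i j
  fin_cases i <;> fin_cases j <;>
    simp [inner_embed, inner_embed_zero, inner_zero_embed, cross_dot_left, cross_dot_right,
      dot_self_cross, dot_cross_self, norm_embed, hw, hu, hc, hwu, huw]

/-- A rotation fixing `w` and preserving the axis of `ζ` is a rotation of the plane `w^⊥`
or a flip of it. -/
lemma exists_angle_of_isRot (b : OrthonormalBasis (Fin 4) ℝ E4) {w u : V3} (hw : w ∈ unitSph)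
    (hu : u ∈ unitSph) (huw : u ⬝ᵥ w = 0) {φ : E4 ≃ₗᵢ[ℝ] E4} (hφ : IsRot (embed b w) φ)
    {ε : ℝ} (hε : ε = 1 ∨ ε = -1) (hb : φ (b 0) = ε • b 0) :
    ∃ α, ∀ θ, φ (embed b (rotAbout w θ u)) = embed b (rotAbout w (α + ε * θ) u) := by
  have hcw := cross_dot_left w u
  have hcu : (w ⨯₃ u) ∈ unitSph := (cross_dot_cross_of_orthogonal hw huw).trans hu
  have hε0 : ε ≠ 0 := by rcases hε with rfl | rfl <;> norm_num
  have himg : ∀ v, v ∈ unitSph → v ⬝ᵥ w = 0 →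
      ∃ x ∈ unitSph, x ⬝ᵥ w = 0 ∧ φ (embed b v) = embed b x := by
    intro v hv hvw
    have h0 : ⟪φ (embed b v), b 0⟫ = 0 := by
      have := φ.inner_map_map (embed b v) (b 0)
      rw [hb, inner_smul_right, inner_embed_zero] at this
      exact (mul_eq_zero.mp this).resolve_left hε0
    obtain ⟨x, hx⟩ := exists_eq_embed b h0
    refine ⟨x, ?_, ?_, hx⟩
    · change _ = _
      rw [← inner_embed b, ← hx, φ.inner_map_map, inner_embed]; exact hv
    · have := φ.inner_map_map (embed b v) (embed b w)
      rwa [hφ.1, hx, inner_embed, inner_embed, hvw] at this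
  obtain ⟨x, hx, hxw, ex⟩ := himg u hu huw
  obtain ⟨y, hy, hyw, ey⟩ := himg _ hcu hcw
  obtain ⟨α, rfl⟩ := exists_unit_frame hw hu huw hx hxw
  have hxy : y ⬝ᵥ rotAbout w α u = 0 := by
    rw [← inner_embed b, ← ex, ← ey, φ.inner_map_map, inner_embed, cross_dot_right]
  -- the second image vector is determined up to sign
  set σ := y ⬝ᵥ (w ⨯₃ rotAbout w α u) with hσ
  have hyσ : y = σ • (w ⨯₃ rotAbout w α u) := by
    have := eq_frame hw hx hxw y
    rw [hyw, hxy, zero_smul, zero_smul, zero_add, zero_add] at this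
    exact this
  have hcr : w ⨯₃ rotAbout w α u = Real.cos α • (w ⨯₃ u) - Real.sin α • u := by
    simp only [rotAbout, map_add, map_smul, cross_cross_of_orthogonal hw huw]; module
  have hdet : ε * σ = 1 := by
    have hon := orthonormal_frame b hw hu huw
    set B := basisOfOrthonormalOfCardEqFinrank hon (by simp) with hB
    have hBi : ∀ i, B i = ![b 0, embed b w, embed b u, embed b (w ⨯₃ u)] i := fun i => by
      rw [hB, coe_basisOfOrthonormalOfCardEqFinrank]
    have := det_eq_of_forall (B := B) (L := (φ.toLinearEquiv : E4 →ₗ[ℝ] E4))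
      (A := !![ε, 0, 0, 0; 0, 1, 0, 0; 0, 0, Real.cos α, -(σ * Real.sin α);
        0, 0, Real.sin α, σ * Real.cos α]) (by
      intro j
      fin_cases j <;> simp [hBi, Fin.sum_univ_four]
      · exact hb
      · exact hφ.1
      · rw [ex]; simp [rotAbout]
      · rw [ey, hyσ, hcr]; simp only [map_smul, map_sub]; module)
    rw [hφ.2] at this
    simp [Matrix.det_succ_row_zero, Fin.sum_univ_succ] at this
    linear_combination -this - ε * σ * Real.sin_sq_add_cos_sq α
  have hσε : σ = ε := by
    rcases hε with rfl | rfl <;> linarith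
  refine ⟨α, fun θ => ?_⟩
  have e1 : φ (embed b (rotAbout w θ u)) =
      embed b (Real.cos θ • rotAbout w α u + Real.sin θ • y) := by
    rw [rotAbout.eq_1 w θ]
    simp only [map_add, map_smul, ex, ey]
  rw [e1, hyσ, hσε, add_comm α, ← rotAbout_rotAbout hw huw, rotAbout.eq_1 w (ε * θ)]
  rcases hε with rfl | rfl <;> simp [-cross_anticomm]

/-- The slices of the homogeneous extension of `f` orthogonal to the first basis vector. -/
def slice (b : OrthonormalBasis (Fin 4) ℝ E4) (f : E4 → ℝ) (a : ℝ) (v : V3) : ℝ :=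
  homogExt f (a • b 0 + embed b v)

lemma continuous_slice (b : OrthonormalBasis (Fin 4) ℝ E4) {f : E4 → ℝ}
    (hf : ContinuousOn f sph) (a : ℝ) : Continuous (slice b f a) :=
  (continuous_homogExt hf).comp
    (continuous_const.add (embed b).continuous_of_finiteDimensional)

lemma slice_eq (b : OrthonormalBasis (Fin 4) ℝ E4) (f : E4 → ℝ) {a : ℝ} {v : V3}
    (h : a • b 0 + embed b v ∈ sph) : slice b f a v = f (a • b 0 + embed b v) :=
  homogExt_of_mem h

lemma inner_smul_add_embed (b : OrthonormalBasis (Fin 4) ℝ E4) (a : ℝ) (v w : V3) :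
    ⟪a • b 0 + embed b v, embed b w⟫ = v ⬝ᵥ w := by
  rw [inner_add_left, inner_smul_left, inner_zero_embed, inner_embed, mul_zero, zero_add]

lemma rotRel_of_isRot (b : OrthonormalBasis (Fin 4) ℝ E4) {f g : E4 → ℝ} {w : V3}
    (hw : w ∈ unitSph) {φ : E4 ≃ₗᵢ[ℝ] E4} (hφ : IsRot (embed b w) φ) (hb : φ (b 0) = b 0)
    (h : ∀ θ ∈ S2 (embed b w), f (φ θ) = g θ) :
    ∃ α, RotRel (slice b f) (slice b g) w α := by
  obtain ⟨u, hu, huw⟩ := exists_unit_orthogonal w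
  obtain ⟨α, hα⟩ := exists_angle_of_isRot b hw hu huw hφ (Or.inl rfl) (by rw [hb, one_smul])
  refine ⟨α, fun a v hv => ?_⟩
  rw [slice, slice, ← homogExt_isometry h (by rw [inner_smul_add_embed, hv])]
  obtain ⟨ρ, θ, rfl⟩ := exists_polar_frame hw hu huw hv
  rw [rotAbout_smul, rotAbout_rotAbout hw huw]
  simp only [map_add, map_smul, hb, hα, one_mul]

lemma flipRel_of_isRot (b : OrthonormalBasis (Fin 4) ℝ E4) {f g : E4 → ℝ} {w : V3}
    (hw : w ∈ unitSph) {φ : E4 ≃ₗᵢ[ℝ] E4} (hφ : IsRot (embed b w) φ) (hb : φ (b 0) = -b 0)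
    (h : ∀ θ ∈ S2 (embed b w), f (φ θ) = g θ) :
    ∃ u ∈ unitSph, u ⬝ᵥ w = 0 ∧ FlipRel (fun a => slice b f (-a)) (slice b g) w u := by
  obtain ⟨u, hu, huw⟩ := exists_unit_orthogonal w
  obtain ⟨α, hα⟩ := exists_angle_of_isRot b hw hu huw hφ (Or.inr rfl) (by rw [hb, neg_one_smul])
  refine ⟨rotAbout w (α / 2) u, rotAbout_mem hw hu huw _, rotAbout_dot _ huw, fun a v hv => ?_⟩
  change homogExt f _ = homogExt g _
  rw [← homogExt_isometry h (by rw [inner_smul_add_embed, hv])]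
  obtain ⟨ρ, θ, rfl⟩ := exists_polar_frame hw hu huw hv
  rw [axialFlip_rotAbout hw hu huw]
  simp only [map_add, map_smul, hb, hα]
  congr 1
  rw [mul_div_cancel₀ α two_ne_zero, neg_one_mul, ← sub_eq_add_neg, smul_neg, neg_smul]

/-- The rotation of `ℝ⁴` by the angle `π` which fixes the plane spanned by `w` and `u`. -/
def halfTurn (w u : E4) : E4 ≃ₗᵢ[ℝ] E4 := (Submodule.span ℝ {w, u}).reflection

lemma halfTurn_left (w u : E4) : halfTurn w u w = w :=
  Submodule.reflection_mem_subspace_eq_self (Submodule.subset_span (by simp))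

lemma halfTurn_right (w u : E4) : halfTurn w u u = u :=
  Submodule.reflection_mem_subspace_eq_self (Submodule.subset_span (by simp))

lemma halfTurn_of_orthogonal {w u v : E4} (hw : ⟪v, w⟫ = 0) (hu : ⟪v, u⟫ = 0) :
    halfTurn w u v = -v := by
  apply Submodule.reflection_mem_subspace_orthogonalComplement_eq_neg
  rw [Submodule.mem_orthogonal']
  intro x hx
  obtain ⟨a, c, rfl⟩ := Submodule.mem_span_pair.mp hx
  simp [inner_add_right, inner_smul_right, hw, hu]

lemma isRotAngleAbout_halfTurn {w u : E4} (hw : w ∈ sph) (hu : u ∈ S2 w) :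
    IsRotAngleAbout w u 1 (halfTurn w u) := by
  refine ⟨⟨halfTurn_left w u, ?_⟩, halfTurn_right w u, fun v hvw hvu => ?_⟩
  · have hrank : Module.finrank ℝ (Submodule.span ℝ {w, u} : Submodule ℝ E4) = 2 := by
      have hon : Orthonormal ℝ ![w, u] := by
        have huw : ⟪u, w⟫ = 0 := hu.2
        have hwu : ⟪w, u⟫ = 0 := by rw [real_inner_comm, huw]
        have hw1 := mem_sph.mp hw
        have hu1 := mem_sph.mp hu.1
        rw [orthonormal_iff_ite]
        intro i j
        fin_cases i <;> fin_cases j <;> simp [huw, hwu, hw1, hu1]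
      have := finrank_span_eq_card hon.linearIndependent
      rwa [Matrix.range_cons, Matrix.range_cons, Matrix.range_empty, union_empty,
        Fintype.card_fin] at this
    have hadd := (Submodule.span ℝ {w, u} : Submodule ℝ E4).finrank_add_finrank_orthogonal
    rw [hrank, finrank_euclideanSpace_fin] at hadd
    have h2 : Module.finrank ℝ (Submodule.span ℝ {w, u} : Submodule ℝ E4)ᗮ = 2 := by omega
    have := (Submodule.span ℝ {w, u} : Submodule ℝ E4).det_reflection
    rw [h2, neg_one_sq] at this
    exact this
  · rw [halfTurn_of_orthogonal hvw hvu]; simp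

lemma hasPiRotSym_of_halfTurn {f : E4 → ℝ} {w u : E4} (hw : w ∈ sph) (hu : u ∈ S2 w)
    (h : ∀ θ ∈ S2 w, f (halfTurn w u θ) = f θ) : HasPiRotSym f w u :=
  ⟨_, isRotAngleAbout_halfTurn hw hu, h⟩

lemma not_rotRel_pi (b : OrthonormalBasis (Fin 4) ℝ E4) {f : E4 → ℝ} {w : V3}
    (hw : w ∈ unitSph) (h : ¬ HasPiRotSym f (embed b w) (b 0)) :
    ¬ RotRel (slice b f) (slice b f) w Real.pi := by
  intro hrel
  refine h (hasPiRotSym_of_halfTurn (embed_mem_S2 b hw).1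
    ⟨mem_sph.mpr (b.norm_eq_one 0), inner_zero_embed b w⟩ ?_)
  rintro θ ⟨hθ, hθw⟩
  obtain ⟨a, v, rfl⟩ := exists_eq_smul_add_embed b θ
  rw [inner_smul_add_embed] at hθw
  have e : halfTurn (embed b w) (b 0) (a • b 0 + embed b v) = a • b 0 + embed b (-v) := by
    rw [map_add, map_smul, halfTurn_right, map_neg, halfTurn_of_orthogonal _ (inner_embed_zero b v)]
    rw [inner_embed, hθw]
  have hmem : a • b 0 + embed b (-v) ∈ sph := by
    rw [← e, mem_sph, LinearIsometryEquiv.norm_map]; exact mem_sph.mp hθ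
  rw [e, ← slice_eq b f hmem, ← slice_eq b f hθ, ← rotAbout_pi w]
  exact hrel a v hθw

lemma not_flipRel (b : OrthonormalBasis (Fin 4) ℝ E4) {f : E4 → ℝ} {w u : V3}
    (hw : w ∈ unitSph) (hu : u ∈ unitSph) (huw : u ⬝ᵥ w = 0)
    (h : ¬ HasPiRotSym f (embed b w) (embed b u)) :
    ¬ FlipRel (fun a => slice b f (-a)) (slice b f) w u := by
  intro hrel
  refine h (hasPiRotSym_of_halfTurn (embed_mem_S2 b hw).1
    ⟨(embed_mem_S2 b hu).1, by rw [inner_embed, huw]⟩ ?_)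
  rintro θ ⟨hθ, hθw⟩
  obtain ⟨a, v, rfl⟩ := exists_eq_smul_add_embed b θ
  rw [inner_smul_add_embed] at hθw
  have hu' : u ⬝ᵥ u = 1 := hu
  have e : halfTurn (embed b w) (embed b u) (a • b 0 + embed b v) =
      (-a) • b 0 + embed b (axialFlip u v) := by
    have e1 : v = (v ⬝ᵥ u) • u + (v - (v ⬝ᵥ u) • u) := by module
    have e2 : halfTurn (embed b w) (embed b u) (embed b (v - (v ⬝ᵥ u) • u)) =
        -embed b (v - (v ⬝ᵥ u) • u) := by
      apply halfTurn_of_orthogonal <;> rw [inner_embed] <;>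
        simp [sub_dotProduct, smul_dotProduct, hθw, huw, hu']
    have e3 : halfTurn (embed b w) (embed b u) (b 0) = -b 0 :=
      halfTurn_of_orthogonal (inner_zero_embed b w) (inner_zero_embed b u)
    conv_lhs => rw [e1]
    rw [map_add (embed b), map_add, map_add, e2, map_smul (embed b), map_smul, map_smul,
      halfTurn_right, e3, axialFlip]
    simp only [map_sub, map_smul]
    module
  have hmem : (-a) • b 0 + embed b (axialFlip u v) ∈ sph := by
    rw [← e, mem_sph, LinearIsometryEquiv.norm_map]; exact mem_sph.mp hθ
  rw [e, ← slice_eq b f hmem, ← slice_eq b f hθ]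
  exact hrel a v hθw

lemma Ocal_smul_add_embed (b : OrthonormalBasis (Fin 4) ℝ E4) (a : ℝ) (v : V3) :
    Ocal (b 0) (a • b 0 + embed b v) = a • b 0 + embed b (-v) := by
  have : ⟪a • b 0 + embed b v, b 0⟫ = a := by
    rw [inner_add_left, inner_smul_left, inner_embed_zero, inner_basis_self]; simp
  rw [Ocal, this, map_neg]
  module

lemma smul_add_embed_neg_mem_sph (b : OrthonormalBasis (Fin 4) ℝ E4) {a : ℝ} {v : V3}
    (h : a • b 0 + embed b v ∈ sph) : a • b 0 + embed b (-v) ∈ sph := by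
  rw [mem_sph, ← sq_eq_sq₀ (norm_nonneg _) zero_le_one, ← real_inner_self_eq_norm_sq] at h ⊢
  simp only [map_neg, inner_add_left, inner_add_right, inner_smul_left, inner_smul_right,
    inner_neg_left, inner_neg_right, inner_embed_zero, inner_zero_embed] at h ⊢
  linarith

lemma exists_orthonormalBasis_zero_eq {ζ : E4} (hζ : ζ ∈ sph) :
    ∃ b : OrthonormalBasis (Fin 4) ℝ E4, b 0 = ζ := by
  have hon : Orthonormal ℝ (({0} : Set (Fin 4)).domRestrict fun _ => ζ) :=
    ⟨fun _ => mem_sph.mp hζ, fun i j hij => (hij (Subsingleton.elim i j)).elim⟩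
  obtain ⟨b, hb⟩ := hon.exists_orthonormalBasis_extension_of_card_eq (by simp)
  exact ⟨b, hb 0 rfl⟩

/-- Proposition, hypothesis (b). -/
theorem stmt_1 (ζ : E4) (hζ : ζ ∈ sph) (f g : E4 → ℝ)
    (hf : ContinuousOn f sph) (hg : ContinuousOn g sph)
    (hrot : ∀ w ∈ S2 ζ, ∃ φ : E4 ≃ₗᵢ[ℝ] E4,
      IsRot w φ ∧ (φ ζ = ζ ∨ φ ζ = -ζ) ∧ ∀ θ ∈ S2 w, f (φ θ) = g θ)
    (hsym : ∀ w ∈ S2 ζ,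
      (¬ HasPiRotSym f w ζ ∧ ¬ HasPiRotSym g w ζ) ∧
      ∀ u ∈ S2 ζ ∩ S2 w, ¬ HasPiRotSym f w u ∧ ¬ HasPiRotSym g w u) :
    (∀ θ ∈ sph, f θ = g θ) ∨ (∀ θ ∈ sph, f θ = g (Ocal ζ θ)) := by
  obtain ⟨b, rfl⟩ := exists_orthonormalBasis_zero_eq hζ
  refine (eq_or_eq_neg_of_rotRel_or_flipRel (continuous_slice b hf) (continuous_slice b hg)
    (fun w hw => ?_) (fun w hw => ?_) (fun w hw u hu huw => ?_)).imp
    (fun h θ hθ => ?_) (fun h θ hθ => ?_)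
  · obtain ⟨φ, hφ, hb, h⟩ := hrot _ (embed_mem_S2 b hw)
    exact hb.imp (rotRel_of_isRot b hw hφ · h) (flipRel_of_isRot b hw hφ · h)
  · exact not_rotRel_pi b hw (hsym _ (embed_mem_S2 b hw)).1.1
  · refine not_flipRel b hw hu huw ((hsym _ (embed_mem_S2 b hw)).2 _ ⟨embed_mem_S2 b hu, ?_⟩).1
    exact ⟨(embed_mem_S2 b hu).1, by rw [inner_embed, huw]⟩
  · obtain ⟨a, v, rfl⟩ := exists_eq_smul_add_embed b θ
    rw [← slice_eq b f hθ, ← slice_eq b g hθ, h]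
  · obtain ⟨a, v, rfl⟩ := exists_eq_smul_add_embed b θ
    rw [Ocal_smul_add_embed, ← slice_eq b f hθ,
      ← slice_eq b g (smul_add_embed_neg_mem_sph b hθ), ← h, neg_neg]
end
end

section
/- Let f and g be continuous real-valued functions on S³ and let ζ ∈ S³. For every α ∈ [0,2], the set Ξ_α is a closed subset of S²(ζ); likewise, the set Ψ is a closed subset of S²(ζ). -/
noncomputable section

open scoped RealInnerProductSpace

/-- The set `Ξ_α`: directions `w ∈ S²(ζ)` admitting a rotation by the angle `α·π`
about `ζ` carrying `f` to `g` on `S²(w)`. -/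
def Xi (f g : E4 → ℝ) (ζ : E4) (α : ℝ) : Set E4 :=
  {w ∈ S2 ζ | ∃ φ : E4 ≃ₗᵢ[ℝ] E4, IsRotAngleAbout w ζ α φ ∧ ∀ θ ∈ S2 w, f (φ θ) = g θ}

/-- The set `Ψ`: directions `w ∈ S²(ζ)` admitting a rotation `φ ∈ SO(3, S²(w))` with
`φ ζ = -ζ` carrying `f` to `g` on `S²(w)`. -/
def Psi (f g : E4 → ℝ) (ζ : E4) : Set E4 :=
  {w ∈ S2 ζ | ∃ φ : E4 ≃ₗᵢ[ℝ] E4, IsRot w φ ∧ φ ζ = -ζ ∧ ∀ θ ∈ S2 w, f (φ θ) = g θ}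

open Filter Topology

/-- The linear isometric automorphisms of a finite-dimensional inner product space form a compact
set of continuous linear maps. -/
theorem isCompact_range_linearIsometryEquiv (E : Type*) [NormedAddCommGroup E]
    [InnerProductSpace ℝ E] [FiniteDimensional ℝ E] :
    IsCompact (Set.range fun φ : E ≃ₗᵢ[ℝ] E => (φ.toContinuousLinearEquiv : E →L[ℝ] E)) := by
  have hrange : (Set.range fun φ : E ≃ₗᵢ[ℝ] E => (φ.toContinuousLinearEquiv : E →L[ℝ] E)) =
      {A : E →L[ℝ] E | ∀ x, ‖A x‖ = ‖x‖} := by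
    ext A
    constructor
    · rintro ⟨φ, rfl⟩ x
      exact φ.norm_map x
    · intro hA
      refine ⟨LinearIsometry.toLinearIsometryEquiv ⟨A.toLinearMap, hA⟩ rfl, ?_⟩
      ext x
      rfl
  have : ProperSpace (E →L[ℝ] E) := FiniteDimensional.proper_real _
  rw [hrange]
  refine Metric.isCompact_of_isClosed_isBounded ?_ ?_
  · simp only [Set.ofPred_forall]
    exact isClosed_iInter fun x => isClosed_eq (by fun_prop) continuous_const
  · refine isBounded_iff_forall_norm_le.2 ⟨1, fun A hA => ?_⟩
    exact A.opNorm_le_bound zero_le_one fun x => by rw [hA x, one_mul]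

/-- Every sequence of linear isometric automorphisms of a finite-dimensional inner product space
has a subsequence along which it converges, jointly with its argument, to such an automorphism. -/
theorem exists_subseq_tendsto_linearIsometryEquiv {E : Type*} [NormedAddCommGroup E]
    [InnerProductSpace ℝ E] [FiniteDimensional ℝ E] (φ : ℕ → E ≃ₗᵢ[ℝ] E) :
    ∃ (ψ : E ≃ₗᵢ[ℝ] E) (k : ℕ → ℕ), StrictMono k ∧
      Tendsto (fun n => LinearMap.det ((φ (k n)).toLinearEquiv : E →ₗ[ℝ] E)) atTop
        (𝓝 (LinearMap.det (ψ.toLinearEquiv : E →ₗ[ℝ] E))) ∧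
      ∀ (x : ℕ → E) (y : E), Tendsto x atTop (𝓝 y) →
        Tendsto (fun n => φ (k n) (x n)) atTop (𝓝 (ψ y)) := by
  obtain ⟨_, ⟨ψ, rfl⟩, k, hk, hlim⟩ :=
    (isCompact_range_linearIsometryEquiv E).tendsto_subseq fun n => Set.mem_range_self (φ n)
  refine ⟨ψ, k, hk, ?_, fun x y hx => ?_⟩
  · exact (ContinuousLinearMap.continuous_det.tendsto _).comp hlim
  · exact (isBoundedBilinearMap_apply (𝕜 := ℝ) (E := E) (F := E)).continuous.continuousAt.tendsto.comp
      (hlim.prodMk_nhds hx)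

theorem isClosed_S2 (w : E4) : IsClosed (S2 w) :=
  Metric.isClosed_sphere.inter (isClosed_eq (by fun_prop) continuous_const)

theorem inner_sub_inner_smul_self {w : E4} (hw : w ∈ sph) (v : E4) :
    ⟪v - ⟪v, w⟫ • w, w⟫ = 0 := by
  have hw1 : ‖w‖ = 1 := mem_sphere_zero_iff_norm.1 hw
  rw [inner_sub_left, real_inner_smul_left, real_inner_self_eq_norm_sq, hw1]
  ring

theorem tendsto_sub_inner_smul {w : ℕ → E4} {w₀ : E4} (hw : Tendsto w atTop (𝓝 w₀)) {v : E4}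
    (hv : ⟪v, w₀⟫ = 0) : Tendsto (fun n => v - ⟪v, w n⟫ • w n) atTop (𝓝 v) := by
  have hinner : Continuous fun u : E4 => ⟪v, u⟫ := by fun_prop
  have h := (tendsto_const_nhds (x := v)).sub
    ((hinner.tendsto w₀).comp hw |>.smul hw)
  simpa only [Function.comp_apply, hv, zero_smul, sub_zero] using h

/-- Points of a great subsphere are limits of points of nearby great subspheres. -/
theorem exists_tendsto_mem_S2 {w : ℕ → E4} {w₀ : E4} (hw : Tendsto w atTop (𝓝 w₀))
    (hws : ∀ n, w n ∈ sph) {θ : E4} (hθ : θ ∈ S2 w₀) :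
    ∃ x : ℕ → E4, Tendsto x atTop (𝓝 θ) ∧ ∀ᶠ n in atTop, x n ∈ S2 (w n) := by
  have hθ1 : ‖θ‖ = 1 := mem_sphere_zero_iff_norm.1 hθ.1
  have hy := tendsto_sub_inner_smul hw hθ.2
  have hne : ‖θ‖ ≠ 0 := by simp [hθ1]
  refine ⟨fun n => ‖θ - ⟪θ, w n⟫ • w n‖⁻¹ • (θ - ⟪θ, w n⟫ • w n), ?_, ?_⟩
  · have h := (hy.norm.inv₀ hne).smul hy
    rwa [hθ1, inv_one, one_smul] at h
  · filter_upwards [hy.norm.eventually_ne hne] with n hn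
    refine ⟨mem_sphere_zero_iff_norm.2 ?_, ?_⟩
    · rw [norm_smul, norm_inv, norm_norm, inv_mul_cancel₀ hn]
    · rw [real_inner_smul_left, inner_sub_inner_smul_self (hws n), mul_zero]

theorem map_mem_sph (φ : E4 ≃ₗᵢ[ℝ] E4) {x : E4} (hx : x ∈ sph) : φ x ∈ sph :=
  mem_sphere_zero_iff_norm.2 ((φ.norm_map x).trans (mem_sphere_zero_iff_norm.1 hx))

/-- Rotations carrying `f` to `g` on great subspheres subconverge to a rotation carrying `f` to `g`
on the limiting great subsphere. -/
theorem exists_limit_rotation {f g : E4 → ℝ} (hf : ContinuousOn f sph) (hg : ContinuousOn g sph)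
    {w : ℕ → E4} {w₀ : E4} (hw : Tendsto w atTop (𝓝 w₀)) (hws : ∀ n, w n ∈ sph)
    (φ : ℕ → E4 ≃ₗᵢ[ℝ] E4) (hrot : ∀ n, IsRot (w n) (φ n))
    (hfg : ∀ n, ∀ θ ∈ S2 (w n), f (φ n θ) = g θ) :
    ∃ (ψ : E4 ≃ₗᵢ[ℝ] E4) (k : ℕ → ℕ), StrictMono k ∧
      (∀ (x : ℕ → E4) (y : E4), Tendsto x atTop (𝓝 y) →
        Tendsto (fun n => φ (k n) (x n)) atTop (𝓝 (ψ y))) ∧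
      IsRot w₀ ψ ∧ ∀ θ ∈ S2 w₀, f (ψ θ) = g θ := by
  obtain ⟨ψ, k, hk, hdet, hlim⟩ := exists_subseq_tendsto_linearIsometryEquiv φ
  have hwk : Tendsto (fun n => w (k n)) atTop (𝓝 w₀) := hw.comp hk.tendsto_atTop
  refine ⟨ψ, k, hk, hlim, ⟨?_, ?_⟩, fun θ hθ => ?_⟩
  · have h := hlim _ _ hwk
    simp only [(hrot _).1] at h
    exact tendsto_nhds_unique h hwk
  · simp only [(hrot _).2] at hdet
    exact tendsto_nhds_unique hdet tendsto_const_nhds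
  · obtain ⟨x, hx, hxS⟩ := exists_tendsto_mem_S2 hwk (fun n => hws (k n)) hθ
    have hl : Tendsto (fun n => f (φ (k n) (x n))) atTop (𝓝 (f (ψ θ))) :=
      (hf _ (map_mem_sph ψ hθ.1)).tendsto.comp (tendsto_nhdsWithin_iff.2
        ⟨hlim x θ hx, hxS.mono fun n hn => map_mem_sph _ hn.1⟩)
    have hr : Tendsto (fun n => g (x n)) atTop (𝓝 (g θ)) :=
      (hg _ hθ.1).tendsto.comp (tendsto_nhdsWithin_iff.2 ⟨hx, hxS.mono fun n hn => hn.1⟩)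
    exact tendsto_nhds_unique (hl.congr' (hxS.mono fun n hn => hfg _ _ hn)) hr

/-- Lemma: the sets `Ξ_α` and `Ψ` are closed subsets of `S²(ζ)`. -/
theorem stmt_3 (ζ : E4) (hζ : ζ ∈ sph) (f g : E4 → ℝ)
    (hf : ContinuousOn f sph) (hg : ContinuousOn g sph) :
    (∀ α ∈ Set.Icc (0:ℝ) 2, IsClosed (Xi f g ζ α)) ∧ IsClosed (Psi f g ζ) := by
  refine ⟨fun α _ => IsSeqClosed.isClosed fun w w₀ hmem hw => ?_,
    IsSeqClosed.isClosed fun w w₀ hmem hw => ?_⟩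
  · have hw₀ : w₀ ∈ S2 ζ := (isClosed_S2 ζ).mem_of_tendsto hw (.of_forall fun n => (hmem n).1)
    choose φ hφ hfg using fun n => (hmem n).2
    obtain ⟨ψ, k, hk, hlim, hrot, hψ⟩ := exists_limit_rotation hf hg hw
      (fun n => (hmem n).1.1) φ (fun n => (hφ n).1) hfg
    refine ⟨hw₀, ψ, ⟨hrot, ?_, fun v hvw hvζ => ?_⟩, hψ⟩
    · have h := hlim _ ζ tendsto_const_nhds
      simp only [(hφ _).2.1] at h
      exact tendsto_nhds_unique h tendsto_const_nhds
    · have hx := tendsto_sub_inner_smul (hw.comp hk.tendsto_atTop) hvw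
      refine tendsto_nhds_unique (((hlim _ v hx).inner hx).congr fun n => ?_)
        ((hx.inner hx).const_mul _)
      refine (hφ (k n)).2.2 _ (inner_sub_inner_smul_self (hmem (k n)).1.1 v) ?_
      simp only [Function.comp_apply]
      rw [inner_sub_left, real_inner_smul_left, hvζ, (hmem (k n)).1.2, mul_zero, sub_zero]
  · have hw₀ : w₀ ∈ S2 ζ := (isClosed_S2 ζ).mem_of_tendsto hw (.of_forall fun n => (hmem n).1)
    choose φ hφ hφζ hfg using fun n => (hmem n).2
    obtain ⟨ψ, k, -, hlim, hrot, hψ⟩ := exists_limit_rotation hf hg hw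
      (fun n => (hmem n).1.1) φ hφ hfg
    refine ⟨hw₀, ψ, hrot, ?_, hψ⟩
    have h := hlim _ ζ tendsto_const_nhds
    simp only [hφζ] at h
    exact tendsto_nhds_unique h tendsto_const_nhds
end
end
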